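/- arXiv:2008.03583 — 3 statements merged into one kernel-verified Lean document; each statement's English description precedes it below -/
import Mathlib

section
/- Let A be a separable unital C*-algebra, H a separable infinite-dimensional complex Hilbert space, and π: A → B(H) a unital *-homomorphism. Then the closure (in the topology of pointwise norm convergence) of the unitary orbit {a ↦ u* π(a) u : u unitary in B(H)} is path-connected. -/
/-- The unitary orbit of a unital *-homomorphism `π : A → B(H)`, as a set of functions
`A → (H →L[ℂ] H)` with the topology of pointwise norm convergence (the product topology). -/
def unitaryOrbitBH {A H : Type*} [CStarAlgebra A] [NormedAddCommGroup H]
    [InnerProductSpace ℂ H] [CompleteSpace H] (π : A →⋆ₐ[ℂ] (H →L[ℂ] H)) :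
    Set (A → (H →L[ℂ] H)) :=
  {f | ∃ u ∈ unitary (H →L[ℂ] H), f = fun a => star u * π a * u}

open Filter Topology

/-- A sequence of paths with consecutive endpoints which accumulates uniformly at a point `y` can be
concatenated to a path ending in `y`. -/
theorem joinedIn_of_tendsto_paths {X : Type*} [TopologicalSpace X] {S : Set X} (x : ℕ → X) (y : X)
    (γ : ∀ n, Path (x n) (x (n + 1))) (hS : ∀ n t, γ n t ∈ S) (hy : y ∈ S)
    (hlim : ∀ O ∈ 𝓝 y, ∀ᶠ n in atTop, ∀ t, γ n t ∈ O) : JoinedIn S (x 0) y := by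
  let g : ℕ → ℝ → X := fun n => Nat.rec (fun _ => x 0)
    (fun (n : ℕ) f (t : ℝ) => if t ≤ n then f t else (γ n).extend (t - n)) n
  have g0 : ∀ t, g 0 t = x 0 := fun t => rfl
  have gs : ∀ (n : ℕ) (t : ℝ), g (n + 1) t = if t ≤ n then g n t else (γ n).extend (t - n) :=
    fun n t => rfl
  have gend : ∀ (n : ℕ) (t : ℝ), (n : ℝ) ≤ t → g n t = x n := by
    intro n
    cases n with
    | zero => intro t _; rfl
    | succ n =>
      intro t ht
      push_cast at ht
      rw [gs, if_neg (by linarith), Path.extend_of_one_le _ (by linarith)]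
  have gc : ∀ n, Continuous (g n) := by
    intro n
    induction n with
    | zero => exact continuous_const
    | succ n ih =>
      have : g (n + 1) = fun t : ℝ => if t ≤ n then g n t else (γ n).extend (t - n) := by
        funext t; exact gs n t
      rw [this]
      refine Continuous.if_le ih ((γ n).continuous_extend.comp (by fun_prop)) continuous_id
        continuous_const ?_
      rintro t rfl
      rw [gend n _ le_rfl]
      simp
  have gmono : ∀ (n m : ℕ) (t : ℝ), t ≤ n → g (n + m) t = g n t := by
    intro n m t ht
    induction m with
    | zero => rfl
    | succ m ih =>
      rw [← add_assoc, gs, if_pos (by push_cast; linarith [(Nat.cast_nonneg m : (0 : ℝ) ≤ m)]), ih]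
  let f : ℝ → X := fun t => g (⌊t⌋₊ + 1) t
  have fg : ∀ (n : ℕ) (t : ℝ), t ≤ n → f t = g n t := by
    intro n t ht
    have h1 : t ≤ ((⌊t⌋₊ + 1 : ℕ) : ℝ) := by push_cast; exact (Nat.lt_floor_add_one t).le
    rcases le_total n (⌊t⌋₊ + 1) with h | h
    · obtain ⟨m, hm⟩ := Nat.exists_eq_add_of_le h
      simp only [f]
      rw [hm, gmono n m t ht]
    · obtain ⟨m, hm⟩ := Nat.exists_eq_add_of_le h
      simp only [f]
      conv_rhs => rw [hm]
      rw [gmono _ m t h1]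
  have fc : Continuous f := by
    rw [continuous_iff_continuousAt]
    intro t
    obtain ⟨n, hn⟩ := exists_nat_gt t
    refine (gc n).continuousAt.congr ?_
    filter_upwards [Iio_mem_nhds hn] with s hs
    exact (fg n s (le_of_lt hs)).symm
  have fform : ∀ t : ℝ, 0 < t → ∃ (n : ℕ) (r : unitInterval), (t ≤ n + 1) ∧ f t = γ n r := by
    intro t ht
    have hr : t - ⌊t⌋₊ ∈ unitInterval :=
      ⟨by linarith [Nat.floor_le ht.le], by linarith [Nat.lt_floor_add_one t]⟩
    refine ⟨⌊t⌋₊, ⟨t - ⌊t⌋₊, hr⟩, (Nat.lt_floor_add_one t).le, ?_⟩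
    rw [← (γ ⌊t⌋₊).extend_apply hr]
    change g (⌊t⌋₊ + 1) t = _
    rw [gs]
    split_ifs with h
    · have he : t - ⌊t⌋₊ = 0 := sub_eq_zero.2 (le_antisymm h (Nat.floor_le ht.le))
      rw [gend _ _ (Nat.floor_le ht.le), he]
      simp
    · rfl
  have flim : Tendsto f atTop (𝓝 y) := by
    intro O hO
    change ∀ᶠ t in atTop, f t ∈ O
    obtain ⟨N, hN⟩ := eventually_atTop.1 (hlim O hO)
    filter_upwards [eventually_ge_atTop ((N : ℝ) + 1), eventually_gt_atTop (0 : ℝ)] with t ht ht0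
    obtain ⟨n, r, hn, h⟩ := fform t ht0
    rw [h]
    refine hN n ?_ r
    have : (N : ℝ) ≤ n := by linarith
    exact_mod_cast this
  let F : ℝ → X := fun t => if t < 1 then f (1 - t)⁻¹ else y
  have Flim : Tendsto (fun t : ℝ => f (1 - t)⁻¹) (𝓝[<] 1) (𝓝 y) := by
    refine flim.comp (tendsto_inv_nhdsGT_zero.comp ?_)
    refine tendsto_nhdsWithin_iff.2 ⟨?_, ?_⟩
    · have : Tendsto (fun t : ℝ => 1 - t) (𝓝 1) (𝓝 (1 - 1)) :=
        (by fun_prop : Continuous _).tendsto 1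
      simpa using this.mono_left nhdsWithin_le_nhds
    · filter_upwards [self_mem_nhdsWithin] with t ht
      simpa using ht
  have Fc : Continuous F := by
    rw [continuous_iff_continuousAt]
    intro t
    rcases lt_trichotomy t 1 with h | rfl | h
    · have : ContinuousAt (fun t : ℝ => f (1 - t)⁻¹) t :=
        fc.continuousAt.comp (ContinuousAt.inv₀ (by fun_prop) (by linarith))
      refine this.congr ?_
      filter_upwards [Iio_mem_nhds h] with s hs
      exact (if_pos hs).symm
    · rw [continuousAt_iff_continuous_left'_right']
      have F1 : F 1 = y := if_neg (lt_irrefl _)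
      constructor
      · unfold ContinuousWithinAt
        rw [F1]
        refine Flim.congr' ?_
        filter_upwards [self_mem_nhdsWithin] with s hs
        exact (if_pos hs).symm
      · unfold ContinuousWithinAt
        rw [F1]
        refine tendsto_const_nhds.congr' ?_
        filter_upwards [self_mem_nhdsWithin] with s hs
        exact (if_neg (not_lt.2 (le_of_lt hs))).symm
    · refine continuousAt_const.congr (f := fun _ => y) ?_
      filter_upwards [Ioi_mem_nhds h] with s hs
      exact (if_neg (not_lt.2 (le_of_lt hs))).symm
  have hmem : ∀ t, 0 ≤ t → F t ∈ S := by
    intro t ht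
    by_cases h : t < 1
    · simp only [F, if_pos h]
      obtain ⟨n, r, _, hr⟩ := fform (1 - t)⁻¹ (inv_pos.2 (by linarith))
      rw [hr]; exact hS n r
    · simp only [F, if_neg h]; exact hy
  have hF0 : F 0 = x 1 := by
    simp only [F, if_pos zero_lt_one, sub_zero, inv_one]
    rw [fg 1 1 (by simp), gend 1 1 (by simp)]
  have hF1 : F 1 = y := if_neg (lt_irrefl _)
  refine JoinedIn.trans (y := x 1) ⟨(γ 0), hS 0⟩ ⟨⟨⟨fun t => F t, by fun_prop⟩, ?_, ?_⟩, ?_⟩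
  · simpa using hF0
  · simpa using hF1
  · intro t; exact hmem _ t.2.1
theorem norm_le_one_of_mem_unitary {A : Type*} [CStarAlgebra A] {u : A} (hu : u ∈ unitary A) :
    ‖u‖ ≤ 1 := by
  nontriviality A
  exact (CStarRing.norm_of_mem_unitary hu).le

set_option maxHeartbeats 1000000 in
theorem joinedIn_unitary_one {H : Type*} [NormedAddCommGroup H]
    [InnerProductSpace ℂ H] [CompleteSpace H] (u : H →L[ℂ] H) (hu : u ∈ unitary (H →L[ℂ] H)) :
    JoinedIn (unitary (H →L[ℂ] H) : Set (H →L[ℂ] H)) u 1 := by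
  obtain ⟨h1, h2⟩ := Unitary.mem_iff.1 hu
  set c : H →L[ℂ] H := (1 / 2 : ℂ) • (u + star u) with hc
  set s : H →L[ℂ] H := (-(Complex.I / 2)) • (u - star u) with hs
  have hcs : IsSelfAdjoint c := by
    rw [IsSelfAdjoint, hc]; simp [add_comm]
  have hss : IsSelfAdjoint s := by
    rw [IsSelfAdjoint, hs]; simp only [star_smul, star_sub, star_star, star_neg]
    rw [← neg_sub u (star u), smul_neg, ← neg_smul]; congr 1; simp [neg_div]
  have hcomm : Commute s c := by
    rw [commute_iff_eq]
    simp only [hc, hs, smul_mul_smul_comm, mul_add, add_mul, sub_mul, mul_sub, h1, h2]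
    module
  have hsq : s * s = 1 - c * c := by
    simp only [hc, hs, smul_mul_smul_comm, mul_add, add_mul, sub_mul, mul_sub, h1, h2]
    have : (-(Complex.I / 2)) * (-(Complex.I / 2)) = -(1/4) := by
      ring_nf; rw [Complex.I_sq]; ring
    rw [this]
    module
  have hucs : u = c + Complex.I • s := by
    rw [hc, hs, smul_smul]
    have : Complex.I * -(Complex.I / 2) = 1 / 2 := by
      ring_nf; rw [Complex.I_sq]; ring
    rw [this]; module
  have hcn : ‖c‖ ≤ 1 := by
    have : ‖u‖ ≤ 1 := norm_le_one_of_mem_unitary hu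
    rw [hc, norm_smul]
    have h3 := norm_add_le u (star u)
    rw [norm_star] at h3
    simp; linarith
  clear_value c s
  -- a self-adjoint unitary `r` commuting with `c` such that `r |s| = s`
  obtain ⟨r, hr, hrr, hrc, hrs⟩ : ∃ r : H →L[ℂ] H, IsSelfAdjoint r ∧ r * r = 1 ∧ Commute r c ∧
      r * (s⁺ + s⁻) = s := by
    let K : Submodule ℂ H := LinearMap.ker (s⁻ : H →L[ℂ] H).toLinearMap
    have hKc : IsClosed (K : Set H) := ContinuousLinearMap.isClosed_ker (s⁻)
    have : CompleteSpace K := hKc.completeSpace_coe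
    set p : H →L[ℂ] H := K.starProjection with hp
    have hps : star p = p := isSelfAdjoint_starProjection K
    have hpp : p * p = p := K.isIdempotentElem_starProjection
    have hnp : s⁻ * p = 0 := by
      ext x
      have : p x ∈ K := K.starProjection_apply_mem x
      exact this
    have hpn : p * s⁻ = 0 := by
      have := congrArg star hnp
      rwa [star_mul, hps, star_zero, (CFC.negPart_nonneg s).isSelfAdjoint.star_eq] at this
    have hps' : p * s⁺ = s⁺ := by
      ext x
      refine Submodule.starProjection_eq_self_iff.2 ?_
      have := congrArg (fun T : H →L[ℂ] H => T x) (CFC.negPart_mul_posPart s)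
      exact this
    have hnc : Commute s⁻ c := by
      rw [CFC.negPart_def]
      exact hcomm.cfcₙ_real _
    have hcp : c * p = p * (c * p) := by
      ext x
      refine (Submodule.starProjection_eq_self_iff.2 ?_).symm
      have h : p x ∈ K := K.starProjection_apply_mem x
      have h' : (s⁻ : H →L[ℂ] H) (p x) = 0 := h
      have := congrArg (fun T : H →L[ℂ] H => T (p x)) hnc.eq
      change (s⁻ : H →L[ℂ] H) (c (p x)) = c ((s⁻ : H →L[ℂ] H) (p x)) at this
      rw [h', map_zero] at this
      exact this
    have hpc : Commute p c := by
      have := congrArg star hcp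
      simp only [star_mul, hps, hcs.star_eq] at this
      rw [commute_iff_eq, this, hcp, mul_assoc]
    refine ⟨p + p - 1, ?_, ?_, ?_, ?_⟩
    · rw [IsSelfAdjoint]; simp [hps]
    · simp only [mul_add, add_mul, sub_mul, mul_sub, hpp, one_mul, mul_one]; abel
    · exact (hpc.add_left hpc).sub_left (Commute.one_left c)
    · conv_rhs => rw [← CFC.posPart_sub_negPart s hss]
      simp only [mul_add, add_mul, sub_mul, hps', hpn, one_mul]; abel
  let f : ℝ → ℝ := fun x => √(1 - x ^ 2)
  have hf : Continuous f := by fun_prop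
  let C : ℝ → H →L[ℂ] H := fun t => (1 - t) • c + t • 1
  have hCc : Continuous C := by fun_prop
  have hCs : ∀ t, IsSelfAdjoint (C t) := fun t => by
    rw [IsSelfAdjoint]; simp [C, hcs.star_eq]
  have hspec : ∀ t ∈ Set.Icc (0 : ℝ) 1, spectrum ℝ (C t) ⊆ Set.Icc (-1) 1 := by
    intro t ht x hx
    have h1 : ‖C t‖ ≤ 1 := by
      have h := norm_add_le ((1 - t) • c) (t • (1 : H →L[ℂ] H))
      rw [norm_smul, norm_smul, Real.norm_of_nonneg ht.1,
        Real.norm_of_nonneg (by linarith [ht.2])] at h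
      have h3 : ‖(1 : H →L[ℂ] H)‖ ≤ 1 := norm_le_one_of_mem_unitary (one_mem _)
      have := mul_le_mul_of_nonneg_left hcn (by linarith [ht.2] : 0 ≤ 1 - t)
      have := mul_le_mul_of_nonneg_left h3 ht.1
      simp only [C]
      linarith
    have h2 := spectrum.norm_le_norm_mul_of_mem hx
    have h3 : ‖(1 : H →L[ℂ] H)‖ ≤ 1 := norm_le_one_of_mem_unitary (one_mem _)
    have : ‖x‖ ≤ 1 := h2.trans (by nlinarith [norm_nonneg (C t)])
    exact abs_le.1 this
  let S : ℝ → H →L[ℂ] H := fun t => cfc f (C t)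
  have hSc : ContinuousOn S (Set.Icc 0 1) :=
    ContinuousOn.cfc' isCompact_Icc f hCc.continuousOn hspec
      (fun t _ => hCs t) hf.continuousOn
  have hSs : ∀ t, IsSelfAdjoint (S t) := fun t => cfc_predicate f (C t)
  have hSC : ∀ t, Commute (S t) (C t) := fun t => (Commute.refl (C t)).cfc_real f
  have hrC : ∀ t, Commute (C t) r := fun t =>
    (hrc.symm.smul_left _).add_left ((Commute.one_left r).smul_left _)
  have hrS : ∀ t, Commute (S t) r := fun t => (hrC t).cfc_real f
  have hSS : ∀ t ∈ Set.Icc (0 : ℝ) 1, S t * S t = 1 - C t * C t := by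
    intro t ht
    have e1 : S t * S t = cfc (fun x => f x * f x) (C t) := (cfc_mul f f (C t)).symm
    have e2 : cfc (fun x : ℝ => 1 - x * x) (C t) = 1 - C t * C t := by
      rw [cfc_sub (fun _ : ℝ => (1 : ℝ)) (fun x => x * x) (C t), cfc_const_one ℝ (C t) (hCs t),
        cfc_mul (fun x : ℝ => x) (fun x => x) (C t), cfc_id' ℝ (C t) (hCs t)]
    rw [e1, ← e2]
    refine cfc_congr ?_
    intro x hx
    have := hspec t ht hx
    simp only [f]
    rw [Real.mul_self_sqrt (by nlinarith [this.1, this.2])]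
    ring
  let g : ℝ → H →L[ℂ] H := fun t => C t + Complex.I • (r * S t)
  have hg : ∀ t ∈ Set.Icc (0 : ℝ) 1, g t ∈ unitary (H →L[ℂ] H) := by
    intro t ht
    have hstar : star (g t) = C t - Complex.I • (r * S t) := by
      simp [g, (hCs t).star_eq, (hSs t).star_eq, hr.star_eq, (hrS t).eq, sub_eq_add_neg]
    have e1 : (r * S t) * (r * S t) = 1 - C t * C t := by
      rw [mul_assoc, ← mul_assoc (S t), (hrS t).eq, mul_assoc r, ← mul_assoc r r, hrr, one_mul,
        hSS t ht]
    have e2 : (r * S t) * C t = C t * (r * S t) := by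
      rw [mul_assoc, (hSC t).eq, ← mul_assoc, ← (hrC t).eq, mul_assoc]
    have hI : ∀ z : H →L[ℂ] H, Complex.I • (Complex.I • z) = -z := fun z => by
      rw [smul_smul, Complex.I_mul_I, neg_one_smul]
    have e3 : Complex.I • (r * S t) * Complex.I • (r * S t) = -(1 - C t * C t) := by
      rw [smul_mul_assoc, mul_smul_comm, hI, e1]
    have e4 : Complex.I • (r * S t) * C t = C t * Complex.I • (r * S t) := by
      rw [smul_mul_assoc, mul_smul_comm, e2]
    rw [Unitary.mem_iff, hstar]
    constructor
    · simp only [g, sub_mul, mul_add, e3, e4]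
      abel
    · simp only [g, add_mul, mul_sub, e3, e4]
      abel
  have hgc : ContinuousOn g (Set.Icc 0 1) := by
    have := hCc.continuousOn (s := Set.Icc (0 : ℝ) 1)
    fun_prop
  have hS0 : S 0 = s⁺ + s⁻ := by
    have e : C 0 = c := by simp [C]
    have h0 : 0 ≤ S 0 := cfc_nonneg (fun x _ => Real.sqrt_nonneg _)
    have h1 : 0 ≤ s⁺ + s⁻ := add_nonneg (CFC.posPart_nonneg s) (CFC.negPart_nonneg s)
    have h2 : (s⁺ + s⁻) * (s⁺ + s⁻) = s * s := by
      conv_rhs => rw [← CFC.posPart_sub_negPart s hss]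
      simp only [mul_add, add_mul, mul_sub, sub_mul, CFC.posPart_mul_negPart,
        CFC.negPart_mul_posPart]
      abel
    rw [← CFC.sqrt_unique h2 h1, hsq, ← CFC.sqrt_unique (hSS 0 (by simp)) h0, e]
  have hS1 : S 1 = 0 := by
    have e : C 1 = 1 := by simp [C]
    have := hSS 1 (by simp)
    rw [e, one_mul, sub_self] at this
    rw [← (hSs 1).star_eq] at this
    nth_rewrite 2 [(hSs 1).star_eq] at this
    rwa [CStarRing.star_mul_self_eq_zero_iff] at this
  refine JoinedIn.ofLine (f := g) hgc ?_ ?_ ?_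
  · simp only [g, hS0, hrs]; simp [C, hucs]
  · simp [g, hS1, C]
  · rintro _ ⟨t, ht, rfl⟩
    exact hg t ht

section Intertwine

variable {H : Type*} [NormedAddCommGroup H] [InnerProductSpace ℂ H] [CompleteSpace H]

theorem inner_star_left (T : H →L[ℂ] H) (x y : H) : inner ℂ (star T x) y = inner ℂ x (T y) := by
  rw [ContinuousLinearMap.star_eq_adjoint, ContinuousLinearMap.adjoint_inner_left]

theorem inner_star_right (T : H →L[ℂ] H) (x y : H) : inner ℂ x (star T y) = inner ℂ (T x) y := by
  rw [ContinuousLinearMap.star_eq_adjoint, ContinuousLinearMap.adjoint_inner_right]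

theorem norm_mul_unitary_le {u : H →L[ℂ] H} (hu : u ∈ unitary (H →L[ℂ] H)) (x : H →L[ℂ] H) :
    ‖x * u‖ ≤ ‖x‖ :=
  (norm_mul_le _ _).trans (mul_le_of_le_one_right (norm_nonneg _) (norm_le_one_of_mem_unitary hu))

theorem norm_unitary_mul_le {u : H →L[ℂ] H} (hu : u ∈ unitary (H →L[ℂ] H)) (x : H →L[ℂ] H) :
    ‖u * x‖ ≤ ‖x‖ :=
  (norm_mul_le _ _).trans (mul_le_of_le_one_left (norm_nonneg _) (norm_le_one_of_mem_unitary hu))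

theorem norm_star_mul_sub_le {u b c : H →L[ℂ] H} (hu : u ∈ unitary (H →L[ℂ] H)) :
    ‖star u * c - b * star u‖ ≤ ‖u * b - c * u‖ := by
  obtain ⟨h1, h2⟩ := Unitary.mem_iff.1 hu
  have : star u * c - b * star u = -(star u * (u * b - c * u) * star u) := by
    rw [mul_sub, sub_mul, ← mul_assoc, h1, mul_assoc _ (c * u), mul_assoc c, h2]
    simp
  rw [this, norm_neg]
  exact (norm_mul_unitary_le (Unitary.star_mem hu) _).trans
    (norm_unitary_mul_le (Unitary.star_mem hu) _)

theorem eq_zero_of_norm_le_mul {E : Type*} [NormedAddCommGroup E] {z : E} (K : ℝ)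
    (h : ∀ ε : ℝ, 0 < ε → ‖z‖ ≤ ε * K) : z = 0 := by
  have h1 : Tendsto (fun ε : ℝ => ε * K) (𝓝[>] 0) (𝓝 (0 * K)) :=
    ((by fun_prop : Continuous fun ε : ℝ => ε * K).tendsto 0).mono_left nhdsWithin_le_nhds
  rw [zero_mul] at h1
  have := ge_of_tendsto h1 (by filter_upwards [self_mem_nhdsWithin] with ε hε using h ε hε)
  exact norm_le_zero_iff.1 this

/-- `T` is a weak limit of unitaries which asymptotically intertwine the families `b` and `c`. -/
def ApproxIntertwines (b c : ℕ → H →L[ℂ] H) (T : H →L[ℂ] H) : Prop :=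
  ∀ (m : ℕ) (G : Finset H) (ε : ℝ), 0 < ε → ∃ u ∈ unitary (H →L[ℂ] H),
    (∀ l < m, ‖u * b l - c l * u‖ ≤ ε) ∧
      ∀ g ∈ G, ∀ g' ∈ G, ‖inner ℂ (u g - T g) g'‖ ≤ ε

theorem exists_approxIntertwines (b c : ℕ → H →L[ℂ] H)
    (h : ∀ (m : ℕ) (ε : ℝ), 0 < ε → ∃ u ∈ unitary (H →L[ℂ] H),
      ∀ l < m, ‖u * b l - c l * u‖ ≤ ε) : ∃ T, ApproxIntertwines b c T := by
  choose u hu hub using fun n : ℕ => h n (1 / (n + 1)) (by positivity)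
  let 𝒰 : Ultrafilter ℕ := hyperfilter ℕ
  have hbd : ∀ n x y, ‖inner ℂ (u n x) y‖ ≤ ‖x‖ * ‖y‖ := fun n x y => by
    rw [← ContinuousLinearMap.norm_map_of_mem_unitary (hu n) x]
    exact norm_inner_le_norm _ _
  have hlim : ∀ x y, ∃ z : ℂ, Tendsto (fun n => inner ℂ (u n x) y) 𝒰 (𝓝 z) := by
    intro x y
    obtain ⟨z, -, hz⟩ := (isCompact_closedBall (0 : ℂ) (‖x‖ * ‖y‖)).ultrafilter_le_nhds
      (𝒰.map (fun n => inner ℂ (u n x) y)) (by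
        rw [le_principal_iff]
        refine Filter.mem_map.2 (Filter.univ_mem' fun n => ?_)
        simpa using hbd n x y)
    exact ⟨z, hz⟩
  choose φ hφ using hlim
  have huniq : ∀ {x y z}, Tendsto (fun n => inner ℂ (u n x) y) 𝒰 (𝓝 z) → φ x y = z :=
    fun hz => tendsto_nhds_unique (hφ _ _) hz
  let B : H →L⋆[ℂ] H →L[ℂ] ℂ := LinearMap.mkContinuous₂
    (LinearMap.mk₂'ₛₗ (starRingEnd ℂ) (RingHom.id ℂ) φ
      (fun x x' y => huniq (by simpa only [map_add, inner_add_left] using (hφ x y).add (hφ x' y)))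
      (fun a x y => huniq (by
        simpa only [map_smul, inner_smul_left, smul_eq_mul] using
          (hφ x y).const_mul (starRingEnd ℂ a)))
      (fun x y y' => huniq (by simpa only [inner_add_right] using (hφ x y).add (hφ x y')))
      (fun a x y => huniq (by
        simpa only [inner_smul_right, smul_eq_mul, RingHom.id_apply] using
          (hφ x y).const_mul a))) 1 (fun x y => by
        rw [one_mul]
        exact le_of_tendsto (hφ x y).norm (Eventually.of_forall fun n => hbd n x y))
  refine ⟨InnerProductSpace.continuousLinearMapOfBilin B, ?_⟩
  intro m G ε hε
  have hT : ∀ x y, inner ℂ (InnerProductSpace.continuousLinearMapOfBilin B x) y = φ x y :=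
    fun x y => InnerProductSpace.continuousLinearMapOfBilin_apply B x y
  have h1 : ∀ᶠ n in (𝒰 : Filter ℕ), ∀ g ∈ G, ∀ g' ∈ G,
      ‖inner ℂ (u n g - InnerProductSpace.continuousLinearMapOfBilin B g) g'‖ ≤ ε := by
    rw [eventually_all_finset]
    intro g _
    rw [eventually_all_finset]
    intro g' _
    have := (Metric.tendsto_nhds.1 (hφ g g')) ε hε
    filter_upwards [this] with n hn
    rw [inner_sub_left, hT, ← dist_eq_norm]
    exact hn.le
  have h2 : ∀ᶠ n in (𝒰 : Filter ℕ), (m : ℕ) ≤ n ∧ 1 / ((n : ℝ) + 1) ≤ ε := by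
    have : (𝒰 : Filter ℕ) ≤ atTop := by
      rw [← Nat.cofinite_eq_atTop]; exact hyperfilter_le_cofinite
    refine Filter.Eventually.filter_mono this ((eventually_ge_atTop m).and ?_)
    exact (tendsto_one_div_add_atTop_nhds_zero_nat (𝕜 := ℝ)).eventually_le_const hε
  obtain ⟨n, hn1, hn2, hn3⟩ := (h1.and h2).exists
  exact ⟨u n, hu n, fun l hl => (hub n l (hl.trans_le hn2)).trans hn3, hn1⟩

namespace ApproxIntertwines

variable {b c d : ℕ → H →L[ℂ] H} {T S : H →L[ℂ] H}

theorem one (b : ℕ → H →L[ℂ] H) : ApproxIntertwines b b 1 :=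
  fun m G ε hε => ⟨1, one_mem _, by simp [hε.le], by simp [hε.le]⟩

theorem mul (hS : ApproxIntertwines c d S) (hT : ApproxIntertwines b c T) :
    ApproxIntertwines b d (S * T) := by
  classical
  intro m G ε hε
  obtain ⟨v, hv, hv1, hv2⟩ := hS m (G ∪ G.image T) (ε / 2) (by linarith)
  obtain ⟨u, hu, hu1, hu2⟩ := hT m (G ∪ G.image (fun x => Star.star v x)) (ε / 2) (by linarith)
  refine ⟨v * u, mul_mem hv hu, fun l hl => ?_, fun g hg g' hg' => ?_⟩
  · have e : v * u * b l - d l * (v * u) = v * (u * b l - c l * u) + (v * c l - d l * v) * u := by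
      noncomm_ring
    rw [e]
    have h1 := (norm_unitary_mul_le hv _).trans (hu1 l hl)
    have h2 := (norm_mul_unitary_le hu _).trans (hv1 l hl)
    exact (norm_add_le _ _).trans (by linarith)
  · have h1 := hu2 g (by simp [hg]) (Star.star v g') (by
      exact Finset.mem_union_right _ (Finset.mem_image_of_mem _ hg'))
    rw [inner_star_right] at h1
    have h2 := hv2 (T g) (Finset.mem_union_right _ (Finset.mem_image_of_mem _ hg)) g'
      (Finset.mem_union_left _ hg')
    have e : (v * u) g - (S * T) g = v (u g - T g) + (v (T g) - S (T g)) := by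
      rw [map_sub]
      change v (u g) - S (T g) = _
      abel
    rw [e, inner_add_left]
    exact (norm_add_le _ _).trans (by linarith)

theorem star (hT : ApproxIntertwines b c T) : ApproxIntertwines c b (star T) := by
  intro m G ε hε
  obtain ⟨u, hu, hu1, hu2⟩ := hT m G ε hε
  refine ⟨Star.star u, Unitary.star_mem hu, fun l hl => (norm_star_mul_sub_le hu).trans (hu1 l hl),
    fun g hg g' hg' => ?_⟩
  rw [inner_sub_left, inner_star_left, inner_star_left, ← inner_sub_right, norm_inner_symm]
  exact hu2 g' hg' g hg

theorem of_tendsto {T : ℕ → H →L[ℂ] H} (hT : ∀ n, ApproxIntertwines b c (T n))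
    (hS : ∀ x, Tendsto (fun n => T n x) atTop (𝓝 (S x))) : ApproxIntertwines b c S := by
  intro m G ε hε
  have h1 : ∀ᶠ n in atTop, ∀ g ∈ G, ∀ g' ∈ G, ‖inner ℂ (T n g - S g) g'‖ ≤ ε / 2 := by
    rw [eventually_all_finset]
    intro g _
    rw [eventually_all_finset]
    intro g' _
    have : Tendsto (fun n => ‖inner ℂ (T n g - S g) g'‖) atTop
        (𝓝 ‖inner ℂ (S g - S g) g'‖) :=
      (((hS g).sub_const _).inner tendsto_const_nhds).norm
    rw [sub_self, inner_zero_left, norm_zero] at this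
    exact this.eventually_le_const (by linarith)
  obtain ⟨n, hn⟩ := h1.exists
  obtain ⟨u, hu, hu1, hu2⟩ := hT n m G (ε / 2) (by linarith)
  refine ⟨u, hu, fun l hl => (hu1 l hl).trans (by linarith), fun g hg g' hg' => ?_⟩
  rw [← sub_add_sub_cancel (u g) (T n g) (S g), inner_add_left]
  exact (norm_add_le _ _).trans (by linarith [hn g hg g' hg', hu2 g hg g' hg'])

theorem norm_le_one (hT : ApproxIntertwines b c T) : ‖T‖ ≤ 1 := by
  classical
  refine ContinuousLinearMap.opNorm_le_bound _ zero_le_one fun x => ?_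
  rw [one_mul]
  have key : ‖T x‖ * ‖T x‖ ≤ ‖x‖ * ‖T x‖ := by
    refine le_of_forall_pos_le_add fun ε hε => ?_
    obtain ⟨u, hu, -, hu2⟩ := hT 0 {x, T x} ε hε
    have h1 := hu2 x (by simp) (T x) (by simp)
    rw [inner_sub_left] at h1
    have h2 := norm_inner_le_norm (𝕜 := ℂ) (u x) (T x)
    rw [ContinuousLinearMap.norm_map_of_mem_unitary hu] at h2
    have h3 : ‖inner ℂ (T x) (T x)‖ = ‖T x‖ * ‖T x‖ := by
      rw [inner_self_eq_norm_sq_to_K, norm_pow]; simp [sq]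
    have h4 := norm_sub_norm_le (inner ℂ (T x) (T x)) (inner ℂ (u x) (T x))
    rw [norm_sub_rev] at h4
    linarith
  by_contra hlt
  push Not at hlt
  nlinarith [norm_nonneg x]

theorem mul_eq (hT : ApproxIntertwines b c T) (l : ℕ) : T * b l = c l * T := by
  classical
  ext x
  refine ext_inner_right ℂ fun y => ?_
  change inner ℂ (T (b l x)) y = inner ℂ (c l (T x)) y
  rw [← inner_star_right (c l), ← sub_eq_zero]
  refine eq_zero_of_norm_le_mul (2 + ‖x‖ * ‖y‖) fun ε hε => ?_
  obtain ⟨u, hu, hu1, hu2⟩ := hT (l + 1) {x, b l x, y, Star.star (c l) y} ε hε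
  have h1 := hu2 (b l x) (by simp) y (by simp)
  have h2 := hu2 x (by simp) (Star.star (c l) y) (by simp)
  have h3 : ‖inner ℂ ((u * b l - c l * u) x) y‖ ≤ ε * (‖x‖ * ‖y‖) := by
    refine (norm_inner_le_norm _ _).trans ?_
    rw [← mul_assoc]
    gcongr
    exact ((u * b l - c l * u).le_opNorm x).trans
      (mul_le_mul_of_nonneg_right (hu1 l (Nat.lt_succ_self l)) (norm_nonneg _))
  have e1 : inner ℂ ((u * b l - c l * u) x) y
      = inner ℂ (u (b l x)) y - inner ℂ (u x) (Star.star (c l) y) := by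
    rw [inner_star_right, ← inner_sub_left]
    rfl
  rw [inner_sub_left] at h1 h2
  have e : inner ℂ (T (b l x)) y - inner ℂ (T x) (Star.star (c l) y) =
      -(inner ℂ (u (b l x)) y - inner ℂ (T (b l x)) y) +
      (inner ℂ (u x) (Star.star (c l) y) - inner ℂ (T x) (Star.star (c l) y)) +
      inner ℂ ((u * b l - c l * u) x) y := by
    rw [e1]; ring
  rw [e]
  refine (norm_add₃_le).trans ?_
  rw [norm_neg]
  linarith

end ApproxIntertwines

end Intertwine

section PartialIsometry

variable {H : Type*} [NormedAddCommGroup H] [InnerProductSpace ℂ H] [CompleteSpace H]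

theorem exists_clm_of_tendsto {T : ℕ → H →L[ℂ] H}
    (h : ∀ x, ∃ y, Tendsto (fun n => T n x) atTop (𝓝 y)) :
    ∃ S : H →L[ℂ] H, ∀ x, Tendsto (fun n => T n x) atTop (𝓝 (S x)) := by
  choose f hf using h
  exact ⟨continuousLinearMapOfTendsto T (tendsto_pi_nhds.2 hf), hf⟩

/-- Powers of a positive contraction, taken along even exponents, converge strongly. -/
theorem exists_tendsto_even_pow {A : H →L[ℂ] H} (hA : star A = A) (hA1 : ‖A‖ ≤ 1) :
    ∃ P : H →L[ℂ] H, ∀ x, Tendsto (fun n : ℕ => (A ^ (2 * n)) x) atTop (𝓝 (P x)) := by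
  refine exists_clm_of_tendsto fun x => cauchySeq_tendsto_of_complete ?_
  have hin : ∀ j k, inner ℂ ((A ^ (j + j)) x) ((A ^ (k + k)) x) =
      ((‖(A ^ (j + k)) x‖ ^ 2 : ℝ) : ℂ) := by
    intro j k
    have e1 : (A ^ (j + j)) x = (star (A ^ j)) ((A ^ j) x) := by
      rw [star_pow, hA, pow_add]; rfl
    rw [e1, inner_star_left, ← mul_apply_eq_comp, ← pow_add]
    have e2 : A ^ (j + (k + k)) = A ^ k * A ^ (j + k) := by rw [← pow_add]; congr 1; omega
    have e3 : A ^ k = star (A ^ k) := by rw [star_pow, hA]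
    rw [e2, e3, mul_apply_eq_comp, inner_star_right,
      ← mul_apply_eq_comp, ← pow_add, add_comm k j, inner_self_eq_norm_sq_to_K]
    simp
  let f : ℕ → ℝ := fun j => ‖(A ^ j) x‖ ^ 2
  have hf : Antitone f := antitone_nat_of_succ_le fun n => by
    have : ‖(A ^ (n + 1)) x‖ ≤ ‖(A ^ n) x‖ := by
      rw [pow_succ', mul_apply_eq_comp]
      refine (A.le_opNorm _).trans (mul_le_of_le_one_left (norm_nonneg _) hA1)
    exact pow_le_pow_left₀ (norm_nonneg _) this 2
  obtain ⟨L, hL⟩ : ∃ L, Tendsto f atTop (𝓝 L) :=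
    ⟨_, tendsto_atTop_ciInf hf ⟨0, by rintro _ ⟨n, rfl⟩; exact sq_nonneg _⟩⟩
  have hd : ∀ k m : ℕ, ‖(A ^ (2 * k)) x - (A ^ (2 * m)) x‖ ^ 2 =
      f (2 * k) - 2 * f (k + m) + f (2 * m) := by
    intro k m
    rw [norm_sub_sq (𝕜 := ℂ), two_mul k, two_mul m, hin k m]
    simp only [f, RCLike.re_to_complex, Complex.ofReal_re]
  rw [Metric.cauchySeq_iff]
  intro ε hε
  have := (Metric.tendsto_atTop.1 hL) (ε ^ 2 / 4) (by positivity)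
  obtain ⟨N, hN⟩ := this
  refine ⟨N, fun m hm n hn => ?_⟩
  have h1 := abs_lt.1 (hN (2 * m) (by omega))
  have h2 := abs_lt.1 (hN (2 * n) (by omega))
  have h3 := abs_lt.1 (hN (m + n) (by omega))
  rw [dist_eq_norm]
  refine lt_of_pow_lt_pow_left₀ 2 hε.le ?_
  rw [hd]
  linarith [h1.1, h1.2, h2.1, h2.2, h3.1, h3.2]

theorem ApproxIntertwines.pow {b : ℕ → H →L[ℂ] H} {T : H →L[ℂ] H} (hT : ApproxIntertwines b b T)
    (n : ℕ) : ApproxIntertwines b b (T ^ n) := by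
  induction n with
  | zero => simpa using ApproxIntertwines.one b
  | succ n ih => rw [pow_succ]; exact ih.mul hT

theorem ApproxIntertwines.exists_partialIsometry {b c : ℕ → H →L[ℂ] H} {T : H →L[ℂ] H}
    (hT : ApproxIntertwines b c T) : ∃ V, ApproxIntertwines b c V ∧ V * Star.star V * V = V := by
  set A : H →L[ℂ] H := Star.star T * T with hAdef
  have hA : ApproxIntertwines b b A := hT.star.mul hT
  have hAs : Star.star A = A := by rw [hAdef, star_mul, star_star]
  obtain ⟨P, hP⟩ := exists_tendsto_even_pow hAs hA.norm_le_one
  have hPi : ApproxIntertwines b b P := ApproxIntertwines.of_tendsto (fun n => hA.pow (2 * n)) hP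
  have hAAP : ∀ x, A (A (P x)) = P x := by
    intro x
    have h1 := (hP x).comp (tendsto_add_atTop_nat 1)
    have h2 : Tendsto (fun n : ℕ => A (A ((A ^ (2 * n)) x))) atTop (𝓝 (A (A (P x)))) :=
      ((A.comp A).continuous.tendsto _).comp (hP x)
    refine tendsto_nhds_unique h2 (h1.congr fun n => ?_)
    change (A ^ (2 * (n + 1))) x = (A * (A * A ^ (2 * n))) x
    rw [← pow_succ', ← pow_succ']
    rfl
  have hAP : A * P = P := by
    ext x
    change A (P x) = P x
    set y := P x - A (P x) with hy
    have h1 : A y = - y := by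
      rw [hy, map_sub, hAAP]; abel
    have h2 : (inner ℂ (A y) y : ℂ) = ((‖T y‖ ^ 2 : ℝ) : ℂ) := by
      rw [hAdef, mul_apply_eq_comp, inner_star_left,
        inner_self_eq_norm_sq_to_K]; simp
    rw [h1, inner_neg_left, inner_self_eq_norm_sq_to_K] at h2
    have h3 : -(‖y‖ ^ 2) = ‖T y‖ ^ 2 := by
      have := congrArg Complex.re h2
      norm_cast at this
    have h4 : ‖y‖ = 0 := by
      have : ‖y‖ ^ 2 ≤ 0 := by nlinarith [sq_nonneg ‖T y‖]
      exact pow_eq_zero_iff (two_ne_zero) |>.1 (le_antisymm this (sq_nonneg _))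
    rw [norm_eq_zero, hy, sub_eq_zero] at h4
    exact h4.symm
  have hAnP : ∀ n : ℕ, A ^ n * P = P := by
    intro n
    induction n with
    | zero => simp
    | succ n ih => rw [pow_succ, mul_assoc, hAP, ih]
  have hPP : P * P = P := by
    ext x
    refine tendsto_nhds_unique (hP (P x)) (tendsto_const_nhds.congr fun n => ?_)
    exact (congrArg (fun S : H →L[ℂ] H => S x) (hAnP (2 * n))).symm
  have hPs : Star.star P = P := by
    ext x
    refine ext_inner_right ℂ fun y => ?_
    rw [inner_star_left]
    refine tendsto_nhds_unique ((tendsto_const_nhds (x := x)).inner (hP y)) (((hP x).inner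
      (tendsto_const_nhds (x := y))).congr fun n => ?_)
    rw [← inner_star_left, star_pow, hAs]
  refine ⟨T * P, hT.mul hPi, ?_⟩
  rw [star_mul, hPs]
  calc T * P * (P * Star.star T) * (T * P) = T * (P * P) * (A * P) := by
        rw [hAdef]; simp only [mul_assoc]
    _ = T * P := by rw [hAP, hPP, mul_assoc, hPP]

/-- Operators with mutually orthogonal ranges and square-summable action can be summed strongly. -/
theorem exists_hasSum_of_orthogonal (y : ℕ → H →L[ℂ] H)
    (horth : ∀ i j, i ≠ j → star (y i) * y j = 0)
    (hbd : ∀ x, Summable fun i => ‖y i x‖ ^ 2) :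
    ∃ Y : H →L[ℂ] H, ∀ x, HasSum (fun i => y i x) (Y x) := by
  have hs : ∀ x, Summable fun i => y i x := by
    intro x
    have hin : ∀ i j, i ≠ j → inner ℂ (y i x) (y j x) = 0 := by
      intro i j hij
      rw [← inner_star_right, ← mul_apply_eq_comp, horth i j hij]; simp
    have hsq : ∀ s : Finset ℕ, ‖∑ i ∈ s, y i x‖ ^ 2 = ∑ i ∈ s, ‖y i x‖ ^ 2 := by
      intro s
      induction s using Finset.induction_on with
      | empty => simp
      | insert a s ha ih =>
        rw [Finset.sum_insert ha, Finset.sum_insert ha, norm_add_sq (𝕜 := ℂ), ih, inner_sum,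
          Finset.sum_eq_zero (fun j hj => hin a j (by rintro rfl; exact ha hj))]
        simp
    rw [summable_iff_vanishing_norm]
    intro ε hε
    obtain ⟨s, hs⟩ := summable_iff_vanishing_norm.1 (hbd x) (ε ^ 2) (by positivity)
    refine ⟨s, fun t ht => ?_⟩
    have := hs t ht
    rw [Real.norm_of_nonneg (Finset.sum_nonneg fun _ _ => sq_nonneg _), ← hsq] at this
    exact lt_of_pow_lt_pow_left₀ 2 hε.le this
  obtain ⟨Y, hY⟩ := exists_clm_of_tendsto (T := fun n => ∑ i ∈ Finset.range n, y i) (fun x => by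
    refine ⟨_, (hs x).hasSum.tendsto_sum_nat.congr fun n => ?_⟩
    simp)
  refine ⟨Y, fun x => ?_⟩
  have h1 := (hs x).hasSum
  convert h1 using 1
  refine tendsto_nhds_unique (hY x) (h1.tendsto_sum_nat.congr fun n => ?_)
  simp

omit [CompleteSpace H] in
theorem opNorm_le_of_hasSum {E : ℕ → H →L[ℂ] H} {F : H →L[ℂ] H} {ε : ℕ → ℝ} {K : ℝ}
    (hE : ∀ x, HasSum (fun i => E i x) (F x)) (hε : ∀ i, ‖E i‖ ≤ ε i) (hK : HasSum ε K) :
    ‖F‖ ≤ K := by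
  have hK0 : 0 ≤ K := hK.nonneg fun i => (norm_nonneg _).trans (hε i)
  refine ContinuousLinearMap.opNorm_le_bound _ hK0 fun x => ?_
  rw [← (hE x).tsum_eq]
  exact tsum_of_norm_bounded (hK.mul_right ‖x‖) fun i =>
    ((E i).le_opNorm x).trans (mul_le_mul_of_nonneg_right (hε i) (norm_nonneg _))

end PartialIsometry

section Absorption

variable {H : Type*} [NormedAddCommGroup H] [InnerProductSpace ℂ H] [CompleteSpace H]

/-- A sequence of unitaries `(X n, Y n) : H ⊕ Q H → H` which asymptotically intertwine `c ⊕ b` and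
`c`, any two consecutive of which differ by a symmetry `s n` asymptotically commuting with `c`. -/
structure AbsorbingSequence (b c : ℕ → H →L[ℂ] H) (Q : H →L[ℂ] H) where
  X : ℕ → H →L[ℂ] H
  Y : ℕ → H →L[ℂ] H
  s : ℕ → H →L[ℂ] H
  star_X_mul_X : ∀ n, star (X n) * X n = 1
  star_X_mul_Y : ∀ n, star (X n) * Y n = 0
  star_Y_mul_Y : ∀ n, star (Y n) * Y n = Q
  sum_eq_one : ∀ n, X n * star (X n) + Y n * star (Y n) = 1
  star_s : ∀ n, star (s n) = s n
  s_mul_s : ∀ n, s n * s n = 1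
  X_succ : ∀ n, X (n + 1) = s n * X n
  Y_succ : ∀ n, Y (n + 1) = s n * Y n
  tendsto_X : ∀ l, Tendsto (fun n => ‖X n * c l - c l * X n‖) atTop (𝓝 0)
  tendsto_Y : ∀ l, Tendsto (fun n => ‖Y n * b l - c l * Y n‖) atTop (𝓝 0)
  tendsto_s : ∀ l, Tendsto (fun n => ‖s n * c l - c l * s n‖) atTop (𝓝 0)

theorem norm_le_one_of_star_mul_self {v Q : H →L[ℂ] H} (hQ : star Q = Q) (hQQ : Q * Q = Q)
    (hv : star v * v = Q) : ‖v‖ ≤ 1 := by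
  have h1 : ‖Q‖ ≤ 1 := by
    have : ‖Q‖ * ‖Q‖ = ‖Q‖ := by rw [← CStarRing.norm_star_mul_self, hQ, hQQ]
    by_contra hlt
    push Not at hlt
    nlinarith
  have h2 : ‖v‖ * ‖v‖ = ‖Q‖ := by rw [← CStarRing.norm_star_mul_self, hv]
  by_contra hlt
  push Not at hlt
  nlinarith

theorem mul_eq_self_of_star_mul_self {v Q : H →L[ℂ] H} (hQ : star Q = Q) (hQQ : Q * Q = Q)
    (hv : star v * v = Q) : v * Q = v := by
  have h : star (v - v * Q) * (v - v * Q) = 0 := by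
    rw [star_sub, star_mul, hQ]
    have : (star v - Q * star v) * (v - v * Q) =
      star v * v - star v * v * Q - Q * (star v * v) + Q * (star v * v) * Q := by noncomm_ring
    rw [this, hv, hQQ, hQQ]; abel
  rw [CStarRing.star_mul_self_eq_zero_iff, sub_eq_zero] at h
  exact h.symm

theorem norm_mul_le_two_mul {x y : H →L[ℂ] H} {k : ℝ} (hx : ‖x‖ ≤ 2) (hy : ‖y‖ ≤ k) :
    ‖x * y‖ ≤ 2 * k :=
  (norm_mul_le _ _).trans (mul_le_mul hx hy (norm_nonneg _) zero_le_two)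

theorem norm_mul_le_mul_two {x y : H →L[ℂ] H} {k : ℝ} (hx : ‖x‖ ≤ 2) (hy : ‖y‖ ≤ k) :
    ‖y * x‖ ≤ 2 * k := by
  rw [mul_comm 2]
  exact (norm_mul_le _ _).trans (mul_le_mul hy hx (norm_nonneg _) ((norm_nonneg _).trans hy))

/-- The unilateral shift along isometries `v 0, v 1, …` with orthogonal ranges, extended by the
identity to the rest of the space. -/
theorem exists_unilateralShift {Q : H →L[ℂ] H}
    (hQ : star Q = Q) (hQQ : Q * Q = Q) (v : ℕ → H →L[ℂ] H) (hv : ∀ n, star (v n) * v n = Q)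
    (hvo : ∀ n m, n ≠ m → star (v n) * v m = 0) :
    ∃ W : H →L[ℂ] H, (∀ x, HasSum (fun n => ((v (n + 1) - v n) * star (v n)) x) (W x)) ∧
      star (1 + W) * (1 + W) = 1 ∧ (1 + W) * star (1 + W) + v 0 * star (v 0) = 1 ∧
      star (1 + W) * v 0 = 0 := by
  have hvQ : ∀ n, v n * Q = v n := fun n => mul_eq_self_of_star_mul_self hQ hQQ (hv n)
  have hQv : ∀ n, Q * star (v n) = star (v n) := fun n => by
    have := congrArg star (hvQ n); rwa [star_mul, hQ] at this
  have hvvv : ∀ n, v n * (star (v n) * v n) = v n := fun n => by rw [hv, hvQ]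
  -- Bessel's inequality
  have hnorm : ∀ n m x, ‖(v m * star (v n)) x‖ ^ 2 = ‖star (v n) x‖ ^ 2 := by
    intro n m x
    have h1 : (inner ℂ ((v m * star (v n)) x) ((v m * star (v n)) x) : ℂ) =
        inner ℂ (star (v n) x) (star (v n) x) := by
      rw [mul_apply_eq_comp, ← inner_star_right, ← mul_apply_eq_comp, ← mul_apply_eq_comp, hv, hQv]
    rw [inner_self_eq_norm_sq_to_K, inner_self_eq_norm_sq_to_K] at h1
    exact_mod_cast h1
  have hbes : ∀ x, Summable fun n => ‖star (v n) x‖ ^ 2 := by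
    intro x
    refine summable_of_sum_range_le (c := ‖x‖ ^ 2) (fun n => sq_nonneg _) fun n => ?_
    set P : H →L[ℂ] H := ∑ i ∈ Finset.range n, v i * star (v i) with hP
    have hPs : star P = P := by rw [hP, star_sum]; simp
    have hPP : P * P = P := by
      rw [hP, Finset.sum_mul]
      refine Finset.sum_congr rfl fun i hi => ?_
      rw [Finset.mul_sum, Finset.sum_eq_single i]
      · rw [mul_assoc, ← mul_assoc (star (v i)), hv, hQv]
      · intro j _ hj
        rw [mul_assoc, ← mul_assoc (star (v i)), hvo i j hj.symm]; simp
      · exact fun h => absurd hi h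
    have h1 : ‖P‖ ≤ 1 := norm_le_one_of_star_mul_self hPs hPP (by rw [hPs, hPP])
    have h2 : ∑ i ∈ Finset.range n, ‖star (v i) x‖ ^ 2 = RCLike.re (inner ℂ (P x) x) := by
      rw [hP, sum_apply, sum_inner, map_sum]
      refine Finset.sum_congr rfl fun i _ => ?_
      rw [mul_apply_eq_comp, ← inner_star_right, inner_self_eq_norm_sq_to_K]
      norm_cast
    rw [h2]
    refine (RCLike.re_le_norm _).trans ((norm_inner_le_norm _ _).trans ?_)
    rw [sq]
    gcongr
    exact (P.le_opNorm x).trans (mul_le_of_le_one_left (norm_nonneg _) h1)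
  obtain ⟨p, hp⟩ := exists_hasSum_of_orthogonal (fun n => v n * star (v n)) (fun i j hij => by
    rw [star_mul, star_star, mul_assoc, ← mul_assoc (star (v i)), hvo i j hij]; simp) (fun x => by
    simpa only [hnorm] using hbes x)
  obtain ⟨A, hA⟩ := exists_hasSum_of_orthogonal (fun n => v (n + 1) * star (v n)) (fun i j hij => by
    rw [star_mul, star_star, mul_assoc, ← mul_assoc (star (v (i + 1))),
      hvo (i + 1) (j + 1) (by omega)]; simp) (fun x => by
    simpa only [hnorm] using hbes x)
  have hpush : ∀ (T S : H →L[ℂ] H) (f : ℕ → H →L[ℂ] H), (∀ x, HasSum (fun n => f n x) (S x)) →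
      ∀ x, HasSum (fun n => (T * f n) x) ((T * S) x) := fun T S f h x =>
    (h x).mapL T
  have hpv : ∀ j, p * v j = v j := by
    intro j
    refine ContinuousLinearMap.ext fun x => (hp (v j x)).unique ?_
    convert hasSum_single j ?_ using 1
    · rw [← mul_apply_eq_comp, mul_assoc, hvvv]
    · intro n hn
      rw [← mul_apply_eq_comp, mul_assoc, hvo n j hn]; simp
  have hAv : ∀ j, A * v j = v (j + 1) := by
    intro j
    refine ContinuousLinearMap.ext fun x => (hA (v j x)).unique ?_
    convert hasSum_single j ?_ using 1
    · rw [← mul_apply_eq_comp, mul_assoc, hv, hvQ]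
    · intro n hn
      rw [← mul_apply_eq_comp, mul_assoc, hvo n j hn]; simp
  have hcomp : ∀ (T : H →L[ℂ] H) (x : H) (a : H →L[ℂ] H)
      (f : ℕ → H →L[ℂ] H) (S : H →L[ℂ] H) (j : ℕ),
      (∀ x, HasSum (fun n => f n x) (S x)) → T * f j = a → (∀ n, n ≠ j → T * f n = 0) →
      T * S = a := by
    intro T x a f S j h h1 h2
    refine ContinuousLinearMap.ext fun x => (hpush T S f h x).unique ?_
    rw [← h1]
    refine hasSum_single j fun n hn => ?_
    rw [h2 n hn]; simp
  have hvp : ∀ j, star (v j) * p = star (v j) := by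
    intro j
    refine hcomp _ 0 _ _ _ j hp ?_ fun n hn => ?_
    · rw [← mul_assoc, hv, hQv]
    · rw [← mul_assoc, hvo j n hn.symm, zero_mul]
  have hvA : ∀ j, star (v (j + 1)) * A = star (v j) := by
    intro j
    refine hcomp _ 0 _ _ _ j hA ?_ fun n hn => ?_
    · rw [← mul_assoc, hv, hQv]
    · rw [← mul_assoc, hvo (j + 1) (n + 1) (by omega), zero_mul]
  have hvA0 : star (v 0) * A = 0 := by
    refine hcomp _ 0 _ _ _ 0 hA ?_ fun n hn => ?_ <;>
    rw [← mul_assoc, hvo 0 _ (by omega), zero_mul]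
  have hlift : ∀ (T S : H →L[ℂ] H) (f g : ℕ → H →L[ℂ] H) (R : H →L[ℂ] H),
      (∀ x, HasSum (fun n => f n x) (S x)) → (∀ x, HasSum (fun n => g n x) (R x)) →
      (∀ n, T * f n = g n) → T * S = R := by
    intro T S f g R h h' h2
    refine ContinuousLinearMap.ext fun x => (hpush T S f h x).unique ?_
    simpa only [h2] using h' x
  have hpsp : star p * p = p := by
    refine hlift _ _ _ _ _ hp hp fun n => ?_
    have := congrArg star (hvp n)
    rw [star_mul, star_star] at this
    rw [← mul_assoc, this]
  have hps : star p = p := by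
    have := congrArg star hpsp
    rw [star_mul, star_star] at this
    rw [← this, hpsp]
  have hpp : p * p = p := by rw [hps] at hpsp; exact hpsp
  have hpA : p * A = A := hlift _ _ _ _ _ hA hA fun n => by rw [← mul_assoc, hpv]
  have hAp : A * p = A := hlift _ _ _ _ _ hp hA fun n => by rw [← mul_assoc, hAv]
  have hsAv : ∀ j, star A * v (j + 1) = v j := fun j => by
    have := congrArg star (hvA j); rwa [star_mul, star_star, star_star] at this
  have hsAv0 : star A * v 0 = 0 := by
    have := congrArg star hvA0; rwa [star_mul, star_star, star_zero] at this
  have hAsA : star A * A = p := hlift _ _ _ _ _ hA hp fun n => by rw [← mul_assoc, hsAv]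
  have hsAp : star A * p = star A := by
    have := congrArg star hpA; rwa [star_mul, hps] at this
  have hpsA : p * star A = star A := by
    have := congrArg star hAp; rwa [star_mul, hps] at this
  have hAAs : A * star A + v 0 * star (v 0) = p := by
    have h1 : (A * star A + v 0 * star (v 0)) * p = A * star A + v 0 * star (v 0) := by
      rw [add_mul, mul_assoc, hsAp, mul_assoc, hvp]
    rw [← h1]
    refine hlift _ _ _ _ _ hp hp fun n => ?_
    rw [← mul_assoc]
    congr 1
    cases n with
    | zero => rw [add_mul, mul_assoc, hsAv0, mul_assoc, hvvv]; simp
    | succ n => rw [add_mul, mul_assoc, hsAv, hAv, mul_assoc, hvo 0 _ (by omega)]; simp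
  refine ⟨A - p, fun x => ?_, ?_, ?_, ?_⟩
  · refine ((hA x).sub (hp x)).congr_fun fun n => ?_
    rw [sub_mul]; rfl
  · have : star (1 + (A - p)) * (1 + (A - p)) = 1 := by
      rw [star_add, star_sub, star_one, hps]
      simp only [add_mul, mul_add, sub_mul, mul_sub, hAsA, hsAp, hpA, hpp, one_mul, mul_one]
      abel
    exact this
  · have h1 : v 0 * star (v 0) = p - A * star A := by rw [← hAAs]; abel
    rw [star_add, star_sub, star_one, hps, h1]
    simp only [add_mul, mul_add, sub_mul, mul_sub, hpsA, hAp, hpp, one_mul, mul_one]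
    abel
  · rw [star_add, star_sub, star_one, hps, add_mul, sub_mul, hsAv0, hpv]
    simp

theorem nonempty_absorbingSequence {b c : ℕ → H →L[ℂ] H} {Q : H →L[ℂ] H}
    (hb : ∀ l, star (b l) = b l) (hc : ∀ l, star (c l) = c l)
    (hQ : star Q = Q) (hQQ : Q * Q = Q) (v : ℕ → H →L[ℂ] H) (hv : ∀ n, star (v n) * v n = Q)
    (hvo : ∀ n m, n ≠ m → star (v n) * v m = 0) (κ : ℕ → ℝ)
    (hκ : ∀ l n, l ≤ n → ‖v n * b l - c l * v n‖ ≤ κ l * (1 / 2) ^ n) :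
    Nonempty (AbsorbingSequence b c Q) := by
  have hv1 : ∀ n, ‖v n‖ ≤ 1 := fun n => norm_le_one_of_star_mul_self hQ hQQ (hv n)
  have hvQ : ∀ n, v n * Q = v n := fun n => mul_eq_self_of_star_mul_self hQ hQQ (hv n)
  have hQv : ∀ n, Q * star (v n) = star (v n) := fun n => by
    have := congrArg star (hvQ n); rwa [star_mul, hQ] at this
  obtain ⟨W, hW, hX1, hX2, hX3⟩ := exists_unilateralShift hQ hQQ v hv hvo
  set z : ℕ → H →L[ℂ] H := fun n => v (n + 1) - v n with hz
  have hz2 : ∀ n, ‖z n‖ ≤ 2 := fun n =>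
    (norm_sub_le _ _).trans (by linarith [hv1 n, hv1 (n + 1)])
  have hzs2 : ∀ n, ‖star (z n)‖ ≤ 2 := fun n => by rw [norm_star]; exact hz2 n
  have hzs : ∀ n, star (z n) = star (v (n + 1)) - star (v n) := fun n => star_sub _ _
  have hzv : ∀ n, star (z n) * v n = -Q := fun n => by
    rw [hzs, sub_mul, hv, hvo _ _ (by omega), zero_sub]
  have hzv1 : ∀ n, star (z n) * v (n + 1) = Q := fun n => by
    rw [hzs, sub_mul, hv, hvo n _ (by omega), sub_zero]
  have hzvo : ∀ n m, n < m → star (z n) * v (m + 1) = 0 := fun n m h => by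
    rw [hzs, sub_mul, hvo _ _ (by omega), hvo _ _ (by omega), sub_zero]
  have hzz : ∀ n, star (z n) * z n = Q + Q := fun n => by
    change star (z n) * (v (n + 1) - v n) = _
    rw [mul_sub, hzv, hzv1, sub_neg_eq_add]
  have hzQ : ∀ n, z n * Q = z n := fun n => by rw [hz]; simp only [sub_mul, hvQ]
  have hQz : ∀ n, Q * star (z n) = star (z n) := fun n => by
    have := congrArg star (hzQ n); rwa [star_mul, hQ] at this
  set D : ℕ → H →L[ℂ] H := fun N => W - ∑ n ∈ Finset.range N, z n * star (v n) with hD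
  have hDsum : ∀ N x, HasSum (fun n => (z (n + N) * star (v (n + N))) x) (D N x) := by
    intro N x
    have h1 := (hasSum_nat_add_iff' N).2 (hW x)
    convert h1 using 1
    simp only [hD, sub_apply, sum_apply, hz]
  have hDsucc : ∀ N, D N = z N * star (v N) + D (N + 1) := fun N => by
    simp only [hD, Finset.sum_range_succ]; abel
  have hzD : ∀ N, star (z N) * D (N + 2) = 0 := by
    intro N
    refine ContinuousLinearMap.ext fun x => ((hDsum (N + 2) x).mapL (star (z N))).unique ?_
    refine HasSum.congr_fun (f := fun _ => 0) hasSum_zero fun n => ?_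
    rw [← mul_apply_eq_comp, ← mul_assoc]
    change (star (z N) * (v (n + (N + 2) + 1) - v (n + (N + 2))) * star (v (n + (N + 2)))) x = 0
    rw [mul_sub, hzvo _ _ (by omega), show n + (N + 2) = n + (N + 1) + 1 by ring,
      hzvo _ _ (by omega)]
    simp
  have hzX : ∀ N, star (z N) * (1 + D N) = star (v N) := by
    intro N
    have e1 : star (z N) * z (N + 1) = -Q := by
      change star (z N) * (v (N + 1 + 1) - v (N + 1)) = _
      rw [mul_sub, hzv1, hzvo _ _ (by omega), zero_sub]
    rw [hDsucc, hDsucc, mul_add, mul_add, mul_add, hzD, ← mul_assoc, hzz, ← mul_assoc, e1, neg_mul,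
      hQv, add_mul, hQv, hzs, mul_one, add_zero]
    abel
  set s : ℕ → H →L[ℂ] H := fun n => 1 - z n * star (z n) with hs
  have hss : ∀ n, star (s n) = s n := fun n => by simp [hs]
  have hss1 : ∀ n, s n * s n = 1 := fun n => by
    have : z n * star (z n) * (z n * star (z n)) = z n * star (z n) + z n * star (z n) := by
      rw [mul_assoc, ← mul_assoc (star (z n)), hzz, add_mul, hQz, mul_add]
    simp only [hs, sub_mul, mul_sub, this, one_mul, mul_one]
    abel
  have hXs : ∀ n, 1 + D (n + 1) = s n * (1 + D n) := fun n => by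
    rw [hs]; simp only
    rw [sub_mul, mul_assoc, hzX, hDsucc n]; simp; abel
  have hYs : ∀ n, v (n + 1) = s n * v n := fun n => by
    rw [hs]; simp only
    rw [sub_mul, mul_assoc, hzv, mul_neg, hzQ, hz]; simp
  have hconj : ∀ n (x y : H →L[ℂ] H), star (s n * x) * (s n * y) = star x * y := fun n x y => by
    rw [star_mul, hss, mul_assoc, ← mul_assoc (s n), hss1, one_mul]
  have hQle : ∀ l n, l ≤ n → ‖star (v n) * c l - b l * star (v n)‖ ≤ κ l * (1 / 2) ^ n := by
    intro l n h
    rw [← norm_star, star_sub, star_mul, star_mul, star_star, hb, hc, norm_sub_rev]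
    exact hκ l n h
  have hκ0 : ∀ l, 0 ≤ κ l := fun l =>
    nonneg_of_mul_nonneg_left ((norm_nonneg _).trans (hκ l l le_rfl)) (by positivity)
  have hpow : ∀ n : ℕ, (1 / 2 : ℝ) ^ (n + 1) ≤ (1 / 2) ^ n := fun n =>
    pow_le_pow_of_le_one (by norm_num) (by norm_num) (Nat.le_succ n)
  have hzκ : ∀ l n, l ≤ n → ‖z n * b l - c l * z n‖ ≤ 2 * (κ l * (1 / 2) ^ n) := by
    intro l n h
    have e : z n * b l - c l * z n =
        (v (n + 1) * b l - c l * v (n + 1)) - (v n * b l - c l * v n) := by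
      simp only [hz, sub_mul, mul_sub]; abel
    rw [e]
    refine (norm_sub_le _ _).trans ?_
    have := hκ l (n + 1) (by omega)
    have := hκ l n h
    have := mul_le_mul_of_nonneg_left (hpow n) (hκ0 l)
    linarith
  have hzκ' : ∀ l n, l ≤ n → ‖star (z n) * c l - b l * star (z n)‖ ≤ 2 * (κ l * (1 / 2) ^ n) := by
    intro l n h
    rw [← norm_star, star_sub, star_mul, star_mul, star_star, hb, hc, norm_sub_rev]
    exact hzκ l n h
  have hlim : ∀ K : ℝ, Tendsto (fun n : ℕ => K * (1 / 2 : ℝ) ^ n) atTop (𝓝 0) := fun K => by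
    have := (tendsto_pow_atTop_nhds_zero_of_lt_one (r := (1 / 2 : ℝ)) (by norm_num)
      (by norm_num)).const_mul K
    rwa [mul_zero] at this
  have hsq : ∀ (f : ℕ → ℝ) (K : ℝ) (l : ℕ), (∀ n, 0 ≤ f n) →
      (∀ n, l ≤ n → f n ≤ K * (1 / 2) ^ n) → Tendsto f atTop (𝓝 0) := fun f K l h0 h1 =>
    tendsto_of_tendsto_of_tendsto_of_le_of_le' tendsto_const_nhds (hlim K)
      (Eventually.of_forall h0) (by filter_upwards [eventually_ge_atTop l] with n hn using h1 n hn)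
  refine ⟨⟨fun n => 1 + D n, v, s, ?_, ?_, hv, ?_, hss, hss1, hXs, hYs, fun l => ?_, fun l => ?_,
    fun l => ?_⟩⟩
  · intro n
    induction n with
    | zero => simpa [hD] using hX1
    | succ n ih => simp only [hXs, hconj] at ih ⊢; exact ih
  · intro n
    induction n with
    | zero => simpa [hD] using hX3
    | succ n ih => rw [hXs, hYs, hconj]; exact ih
  · intro n
    induction n with
    | zero => simpa [hD] using hX2
    | succ n ih =>
      have : ∀ x : H →L[ℂ] H, s n * x * star (s n * x) = s n * (x * star x) * s n := fun x => by
        rw [star_mul, hss]; simp only [mul_assoc]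
      rw [hXs, hYs, this, this, ← add_mul, ← mul_add, ih, mul_one, hss1]
  · refine hsq _ (8 * κ l) l (fun n => norm_nonneg _) fun N hN => ?_
    have hE : ∀ x, HasSum (fun n => ((z (n + N) * star (v (n + N))) * c l -
        c l * (z (n + N) * star (v (n + N)))) x) (((1 + D N) * c l - c l * (1 + D N)) x) := by
      intro x
      have h1 := (hDsum N (c l x)).sub ((hDsum N x).mapL (c l))
      rw [add_mul, mul_add, one_mul, mul_one, add_sub_add_left_eq_sub]
      exact h1
    have hg : HasSum (fun n : ℕ => 4 * κ l * (1 / 2) ^ N * (1 / 2) ^ n)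
        (4 * κ l * (1 / 2) ^ N * 2) := hasSum_geometric_two.mul_left _
    refine (opNorm_le_of_hasSum hE (fun n => ?_) hg).trans_eq (by ring)
    have e : z (n + N) * star (v (n + N)) * c l - c l * (z (n + N) * star (v (n + N))) =
        z (n + N) * (star (v (n + N)) * c l - b l * star (v (n + N))) +
        (z (n + N) * b l - c l * z (n + N)) * star (v (n + N)) := by noncomm_ring
    rw [e]
    have h1 := norm_mul_le_two_mul (hz2 (n + N)) (hQle l (n + N) (by omega))
    have h2 : ‖(z (n + N) * b l - c l * z (n + N)) * star (v (n + N))‖ ≤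
        2 * (κ l * (1 / 2) ^ (n + N)) := by
      refine (norm_mul_le _ _).trans (le_trans ?_ (hzκ l (n + N) (by omega)))
      exact mul_le_of_le_one_right (norm_nonneg _) (by rw [norm_star]; exact hv1 _)
    refine (norm_add_le _ _).trans ?_
    rw [pow_add] at h1 h2
    linarith
  · exact hsq _ (κ l) l (fun n => norm_nonneg _) fun n hn => hκ l n hn
  · refine hsq _ (8 * κ l) l (fun n => norm_nonneg _) fun n hn => ?_
    have e : s n * c l - c l * s n = -(z n * (star (z n) * c l - b l * star (z n)) +
        (z n * b l - c l * z n) * star (z n)) := by simp only [hs]; noncomm_ring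
    rw [e, norm_neg]
    have h1 := norm_mul_le_two_mul (hz2 n) (hzκ' l n hn)
    have h2 := norm_mul_le_mul_two (hzs2 n) (hzκ l n hn)
    refine (norm_add_le _ _).trans ?_
    linarith

end Absorption

section Paths

variable {H : Type*} [NormedAddCommGroup H] [InnerProductSpace ℂ H] [CompleteSpace H]

/-- The path of unitaries from `1` to the symmetry `s`. -/
noncomputable def symmetryPath (s : H →L[ℂ] H) (t : ℝ) : H →L[ℂ] H :=
  ((1 + Complex.exp (t * Real.pi * Complex.I)) / 2) • (1 : H →L[ℂ] H) +
    ((1 - Complex.exp (t * Real.pi * Complex.I)) / 2) • s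

omit [CompleteSpace H] in
theorem continuous_symmetryPath (s : H →L[ℂ] H) : Continuous (symmetryPath s) := by
  unfold symmetryPath
  fun_prop

omit [CompleteSpace H] in
theorem symmetryPath_zero (s : H →L[ℂ] H) : symmetryPath s 0 = 1 := by
  simp [symmetryPath]

omit [CompleteSpace H] in
theorem symmetryPath_one (s : H →L[ℂ] H) : symmetryPath s 1 = s := by
  simp [symmetryPath]

theorem symmetryPath_mem_unitary {s : H →L[ℂ] H} (hs : star s = s) (hss : s * s = 1) (t : ℝ) :
    symmetryPath s t ∈ unitary (H →L[ℂ] H) := by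
  set e := Complex.exp (t * Real.pi * Complex.I) with he
  have h1 : star e * e = 1 := by
    rw [he, ← Complex.ofReal_mul]
    change (starRingEnd ℂ) _ * _ = 1
    rw [← Complex.exp_conj, ← Complex.exp_add]
    simp
  have h2 : star (symmetryPath s t) = ((1 + star e) / 2) • (1 : H →L[ℂ] H) +
      ((1 - star e) / 2) • s := by
    simp only [symmetryPath, ← he, star_add, star_smul, hs, star_one, star_div₀, star_sub]
    norm_num
  have h3 : symmetryPath s t = ((1 + e) / 2) • (1 : H →L[ℂ] H) + ((1 - e) / 2) • s := rfl
  rw [Unitary.mem_iff, h2, h3]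
  have key : ∀ a b a' b' : ℂ, a * a' + b * b' = 1 → a * b' + b * a' = 0 →
      (a • (1 : H →L[ℂ] H) + b • s) * (a' • (1 : H →L[ℂ] H) + b' • s) = 1 := by
    intro a b a' b' e1 e2
    simp only [add_mul, mul_add, smul_mul_smul_comm, hss, one_mul, mul_one]
    have : (a * a') • (1 : H →L[ℂ] H) + (b * a') • s + ((a * b') • s + (b * b') • (1 : H →L[ℂ] H))
      = (a * a' + b * b') • (1 : H →L[ℂ] H) + (a * b' + b * a') • s := by module
    rw [this, e1, e2, one_smul, zero_smul, add_zero]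
  constructor
  · exact key _ _ _ _ (by linear_combination (1 / 2) * h1) (by linear_combination (-1 / 2) * h1)
  · exact key _ _ _ _ (by linear_combination (1 / 2) * h1) (by linear_combination (-1 / 2) * h1)

omit [CompleteSpace H] in
theorem norm_symmetryPath_comm_le (s c : H →L[ℂ] H) (t : ℝ) :
    ‖symmetryPath s t * c - c * symmetryPath s t‖ ≤ ‖s * c - c * s‖ := by
  have e : symmetryPath s t * c - c * symmetryPath s t =
      ((1 - Complex.exp (t * Real.pi * Complex.I)) / 2) • (s * c - c * s) := by
    simp only [symmetryPath, add_mul, mul_add, smul_mul_assoc, mul_smul_comm, one_mul, mul_one]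
    module
  rw [e, norm_smul]
  refine mul_le_of_le_one_left (norm_nonneg _) ?_
  have h := norm_sub_le (1 : ℂ) (Complex.exp (t * Real.pi * Complex.I))
  rw [← Complex.ofReal_mul, Complex.norm_exp_ofReal_mul_I, norm_one] at h
  rw [norm_div, ← Complex.ofReal_mul, Complex.norm_ofNat, div_le_one two_pos]
  linarith

theorem exists_intertwining_paths {b c : ℕ → H →L[ℂ] H} {V : H →L[ℂ] H}
    (hb : ∀ l, star (b l) = b l) (hc : ∀ l, star (c l) = c l)
    (hV : V * star V * V = V) (hVb : ∀ l, V * b l = c l * V)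
    (S : AbsorbingSequence b c (1 - star V * V)) (S' : AbsorbingSequence c b (1 - V * star V)) :
    ∃ w : ℕ → ℝ → H →L[ℂ] H, (∀ n, Continuous (w n)) ∧
      (∀ n t, w n t ∈ unitary (H →L[ℂ] H)) ∧ (∀ n, w n 1 = w (n + 1) 0) ∧
      ∀ l, ∃ δ : ℕ → ℝ, Tendsto δ atTop (𝓝 0) ∧ ∀ n t, ‖w n t * b l - c l * w n t‖ ≤ δ n := by
  have hn1 : ∀ {X : H →L[ℂ] H}, star X * X = 1 → ‖X‖ ≤ 1 := fun h =>
    norm_le_one_of_star_mul_self (Q := 1) (by simp) (by simp) h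
  have hQ1 : star (1 - star V * V) = 1 - star V * V := by simp
  have hQ2 : (1 - star V * V) * (1 - star V * V) = 1 - star V * V := by
    have : star V * V * (star V * V) = star V * V := by rw [mul_assoc, ← mul_assoc V, hV]
    rw [mul_sub, sub_mul, sub_mul, this]; simp
  have hQ1' : star (1 - V * star V) = 1 - V * star V := by simp
  have hQ2' : (1 - V * star V) * (1 - V * star V) = 1 - V * star V := by
    have : V * star V * (V * star V) = V * star V := by rw [← mul_assoc, hV]
    rw [mul_sub, sub_mul, sub_mul, this]; simp
  have hV1 : ‖V‖ ≤ 1 := norm_le_one_of_star_mul_self (Q := star V * V) (by simp)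
    (by rw [mul_assoc, ← mul_assoc V, hV]) rfl
  obtain ⟨X, Y, s, hX, hXY, hY, hsum, hs, hss, hXs, hYs, hXc, hYc, hsc⟩ := S
  obtain ⟨X', Y', s', hX', hXY', hY', hsum', hs', hss', hXs', hYs', hXc', hYc', hsc'⟩ := S'
  have hVY : ∀ n, V * star (Y n) = 0 := fun n => by
    have h := congrArg star (mul_eq_self_of_star_mul_self hQ1 hQ2 (hY n))
    rw [star_mul, hQ1] at h
    rw [← h, ← mul_assoc, mul_sub, ← mul_assoc, hV]; simp
  have hVY' : ∀ n, star V * star (Y' n) = 0 := fun n => by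
    have h := congrArg star (mul_eq_self_of_star_mul_self hQ1' hQ2' (hY' n))
    rw [star_mul, hQ1'] at h
    have h2 : star V * (V * star V) = star V := by
      have := congrArg star hV; simpa only [star_mul, star_star] using this
    rw [← h, ← mul_assoc, mul_sub, h2]; simp
  have hYX : ∀ n, star (Y n) * X n = 0 := fun n => by
    have := congrArg star (hXY n); rwa [star_mul, star_star, star_zero] at this
  have hYX' : ∀ n, star (Y' n) * X' n = 0 := fun n => by
    have := congrArg star (hXY' n); rwa [star_mul, star_star, star_zero] at this
  have hYV : ∀ n, Y n * star V = 0 := fun n => by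
    have := congrArg star (hVY n); rwa [star_mul, star_star, star_zero] at this
  have hYV' : ∀ n, Y' n * V = 0 := fun n => by
    have := congrArg star (hVY' n); rwa [star_mul, star_star, star_zero, star_star] at this
  set u : ℕ → H →L[ℂ] H := fun n =>
    X n * V * star (X' n) + X n * star (Y' n) + Y n * star (X' n) with hu
  have hus : ∀ n, star (u n) =
      X' n * star V * star (X n) + Y' n * star (X n) + X' n * star (Y n) := fun n => by
    simp only [hu, star_add, star_mul, star_star, mul_assoc]
  have hun : ∀ n, u n ∈ unitary (H →L[ℂ] H) := by
    intro n
    rw [Unitary.mem_iff]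
    constructor
    · have : star (u n) * u n = X' n * star V * (star (X n) * X n) * V * star (X' n)
          + X' n * star V * (star (X n) * X n) * star (Y' n)
          + X' n * star V * (star (X n) * Y n) * star (X' n)
          + Y' n * (star (X n) * X n) * V * star (X' n)
          + Y' n * (star (X n) * X n) * star (Y' n) + Y' n * (star (X n) * Y n) * star (X' n)
          + X' n * (star (Y n) * X n) * V * star (X' n) + X' n * (star (Y n) * X n) * star (Y' n)
          + X' n * (star (Y n) * Y n) * star (X' n) := by
        rw [hus]; simp only [hu]; noncomm_ring
      rw [this, hX, hXY, hYX, hY, mul_one, mul_one, hYV', mul_assoc (X' n) (star V) (star (Y' n)),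
        hVY']
      refine Eq.trans ?_ (hsum' n)
      noncomm_ring
    · have : u n * star (u n) = X n * V * (star (X' n) * X' n) * star V * star (X n)
          + X n * V * (star (X' n) * X' n) * star (Y n)
          + X n * V * (star (X' n) * Y' n) * star (X n)
          + Y n * (star (X' n) * X' n) * star V * star (X n)
          + Y n * (star (X' n) * X' n) * star (Y n) + Y n * (star (X' n) * Y' n) * star (X n)
          + X n * (star (Y' n) * X' n) * star V * star (X n)
          + X n * (star (Y' n) * X' n) * star (Y n)
          + X n * (star (Y' n) * Y' n) * star (X n) := by
        rw [hus]; simp only [hu]; noncomm_ring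
      rw [this, hX', hXY', hYX', hY', mul_one, mul_one, hYV, mul_assoc (X n) V (star (Y n)),
        hVY]
      refine Eq.trans ?_ (hsum n)
      noncomm_ring
  have husucc : ∀ n, u (n + 1) = s n * u n * star (s' n) := by
    intro n
    simp only [hu, hXs, hYs, hXs', hYs', star_mul, mul_add, add_mul, mul_assoc]
  have hsu : ∀ n, s n ∈ unitary (H →L[ℂ] H) := fun n => by
    rw [Unitary.mem_iff, hs, hss]; simp
  have hsu' : ∀ n, s' n ∈ unitary (H →L[ℂ] H) := fun n => by
    rw [Unitary.mem_iff, hs', hss']; simp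
  have hc3 : ∀ {x y z : H →L[ℂ] H}, ‖x‖ ≤ 1 → ‖z‖ ≤ 1 → ‖x * y * z‖ ≤ ‖y‖ := fun {x y z} hx hz =>
    (norm_mul_le _ _).trans <| (mul_le_of_le_one_right (norm_nonneg _) hz).trans <|
      (norm_mul_le _ _).trans (mul_le_of_le_one_left (norm_nonneg _) hx)
  have hX1 : ∀ n, ‖X n‖ ≤ 1 := fun n => hn1 (hX n)
  have hX1' : ∀ n, ‖star (X' n)‖ ≤ 1 := fun n => by rw [norm_star]; exact hn1 (hX' n)
  have hY1 : ∀ n, ‖Y n‖ ≤ 1 := fun n => norm_le_one_of_star_mul_self hQ1 hQ2 (hY n)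
  have hY1' : ∀ n, ‖star (Y' n)‖ ≤ 1 := fun n => by
    rw [norm_star]; exact norm_le_one_of_star_mul_self hQ1' hQ2' (hY' n)
  have hub : ∀ n l, ‖u n * b l - c l * u n‖ ≤
      ((‖star (X' n) * b l - b l * star (X' n)‖ + ‖X n * c l - c l * X n‖) +
      (‖star (Y' n) * b l - c l * star (Y' n)‖ + ‖X n * c l - c l * X n‖)) +
      (‖star (X' n) * b l - b l * star (X' n)‖ + ‖Y n * b l - c l * Y n‖) := by
    intro n l
    have e : u n * b l - c l * u n =
      ((X n * V * (star (X' n) * b l - b l * star (X' n)) * 1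
        + 1 * (X n * c l - c l * X n) * (V * star (X' n))) +
      (X n * (star (Y' n) * b l - c l * star (Y' n)) * 1
        + 1 * (X n * c l - c l * X n) * star (Y' n))) +
      (Y n * (star (X' n) * b l - b l * star (X' n)) * 1
        + 1 * (Y n * b l - c l * Y n) * star (X' n)) := by
      have h : X n * V * (star (X' n) * b l - b l * star (X' n)) =
          X n * V * star (X' n) * b l - X n * (c l * V) * star (X' n) := by
        rw [← hVb]; noncomm_ring
      rw [h]
      simp only [hu]
      noncomm_ring
    have h1 : ‖(1 : H →L[ℂ] H)‖ ≤ 1 := norm_le_one_of_mem_unitary (one_mem _)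
    have hVX : ‖V * star (X' n)‖ ≤ 1 :=
      (norm_mul_le _ _).trans (mul_le_one₀ hV1 (norm_nonneg _) (hX1' n))
    have hXV : ‖X n * V‖ ≤ 1 :=
      (norm_mul_le _ _).trans (mul_le_one₀ (hX1 n) (norm_nonneg _) hV1)
    rw [e]
    refine (norm_add₃_le).trans (add_le_add (add_le_add ?_ ?_) ?_)
    · exact (norm_add_le _ _).trans (add_le_add (hc3 hXV h1) (hc3 h1 hVX))
    · exact (norm_add_le _ _).trans (add_le_add (hc3 (hX1 n) h1) (hc3 h1 (hY1' n)))
    · exact (norm_add_le _ _).trans (add_le_add (hc3 (hY1 n) h1) (hc3 h1 (hX1' n)))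
  have hub0 : ∀ l, Tendsto (fun n => ‖u n * b l - c l * u n‖) atTop (𝓝 0) := by
    intro l
    have h1 : Tendsto (fun n => ‖star (X' n) * b l - b l * star (X' n)‖) atTop (𝓝 0) := by
      refine (hXc' l).congr fun n => ?_
      rw [← norm_star, star_sub, star_mul, star_mul, hb, norm_sub_rev]
    have h2 : Tendsto (fun n => ‖star (Y' n) * b l - c l * star (Y' n)‖) atTop (𝓝 0) := by
      refine (hYc' l).congr fun n => ?_
      rw [← norm_star, star_sub, star_mul, star_mul, hb, hc, norm_sub_rev]
    have h3 := ((h1.add (hXc l)).add (h2.add (hXc l))).add (h1.add (hYc l))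
    simp only [add_zero] at h3
    exact squeeze_zero (fun n => norm_nonneg _) (fun n => hub n l) h3
  refine ⟨fun n t => symmetryPath (s n) t * u n * star (symmetryPath (s' n) t), fun n => ?_,
    fun n t => ?_, fun n => ?_, fun l => ?_⟩
  · have := continuous_symmetryPath (s n)
    have := continuous_symmetryPath (s' n)
    fun_prop
  · exact mul_mem (mul_mem (symmetryPath_mem_unitary (hs n) (hss n) t) (hun n))
      (Unitary.star_mem (symmetryPath_mem_unitary (hs' n) (hss' n) t))
  · simp only [symmetryPath_one, symmetryPath_zero, star_one, one_mul, mul_one, husucc]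
  · refine ⟨fun n => ‖s' n * b l - b l * s' n‖ + ‖u n * b l - c l * u n‖ +
      ‖s n * c l - c l * s n‖, ?_, fun n t => ?_⟩
    · simpa using ((hsc' l).add (hub0 l)).add (hsc l)
    · set e := symmetryPath (s n) t with he
      set e' := symmetryPath (s' n) t with he'
      have heu : ‖e‖ ≤ 1 := norm_le_one_of_mem_unitary (symmetryPath_mem_unitary (hs n) (hss n) t)
      have heu' := symmetryPath_mem_unitary (hs' n) (hss' n) t
      have heu1 : ‖star e'‖ ≤ 1 := norm_le_one_of_mem_unitary (Unitary.star_mem heu')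
      have h1 : ‖(1 : H →L[ℂ] H)‖ ≤ 1 := norm_le_one_of_mem_unitary (one_mem _)
      have hu1 : ‖u n‖ ≤ 1 := norm_le_one_of_mem_unitary (hun n)
      have hx : e * u n * star e' * b l - c l * (e * u n * star e') =
        e * u n * (star e' * b l - b l * star e') * 1 +
        e * (u n * b l - c l * u n) * star e' +
        1 * (e * c l - c l * e) * (u n * star e') := by noncomm_ring
      rw [hx]
      refine (norm_add₃_le).trans (add_le_add (add_le_add ?_ (hc3 heu heu1)) ?_)
      · refine (hc3 ((norm_mul_le _ _).trans (mul_le_one₀ heu (norm_nonneg _) hu1)) h1).trans ?_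
        exact (norm_star_mul_sub_le heu').trans (norm_symmetryPath_comm_le _ _ _)
      · refine (hc3 h1 ((norm_mul_le _ _).trans (mul_le_one₀ hu1 (norm_nonneg _) heu1))).trans ?_
        exact norm_symmetryPath_comm_le _ _ _

end Paths

section Partition

/-- The cosine, cut off to its central arch. -/
noncomputable def archCos (x : ℝ) : ℝ := Real.cos (max (-(Real.pi / 2)) (min x (Real.pi / 2)))

theorem archCos_eq_zero_of_le {x : ℝ} (h : x ≤ -(Real.pi / 2)) : archCos x = 0 := by
  have := Real.pi_pos
  rw [archCos, min_eq_left (by linarith), max_eq_left h, Real.cos_neg, Real.cos_pi_div_two]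

theorem archCos_eq_zero_of_ge {x : ℝ} (h : Real.pi / 2 ≤ x) : archCos x = 0 := by
  have := Real.pi_pos
  rw [archCos, min_eq_right h, max_eq_right (by linarith), Real.cos_pi_div_two]

theorem archCos_eq_cos {x : ℝ} (h : -(Real.pi / 2) ≤ x) (h' : x ≤ Real.pi / 2) :
    archCos x = Real.cos x := by
  rw [archCos, min_eq_left h', max_eq_right h]

theorem abs_archCos_sub_le (x y : ℝ) : |archCos x - archCos y| ≤ |x - y| := by
  unfold archCos
  refine (Real.abs_cos_sub_cos_le _ _).trans ?_
  refine (abs_max_sub_max_le_max _ _ _ _).trans ?_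
  rw [sub_self, abs_zero]
  refine max_le (abs_nonneg _) ((abs_min_sub_min_le_max _ _ _ _).trans ?_)
  rw [sub_self, abs_zero]
  exact max_le le_rfl (abs_nonneg _)

theorem hasSum_archCos_sq {x : ℝ} (hx : 0 ≤ x) :
    HasSum (fun i : ℕ => archCos (x - i * (Real.pi / 2)) ^ 2) 1 := by
  have hpi := Real.pi_pos
  have hpi2 : 0 < Real.pi / 2 := by linarith
  obtain ⟨k, hk⟩ : ∃ k : ℕ, k = ⌊x / (Real.pi / 2)⌋₊ := ⟨_, rfl⟩
  have h1 : (k : ℝ) * (Real.pi / 2) ≤ x := by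
    rw [← le_div_iff₀ hpi2, hk]
    exact Nat.floor_le (by positivity)
  have h2 : x < (k + 1 : ℝ) * (Real.pi / 2) := by
    rw [← div_lt_iff₀ hpi2, hk]
    exact Nat.lt_floor_add_one _
  have h3 : ∑ i ∈ ({k, k + 1} : Finset ℕ), archCos (x - i * (Real.pi / 2)) ^ 2 = 1 := by
    rw [Finset.sum_pair (by simp), archCos_eq_cos (by linarith) (by linarith),
      archCos_eq_cos (by push_cast; linarith) (by push_cast; linarith)]
    have : x - ((k + 1 : ℕ) : ℝ) * (Real.pi / 2) = (x - k * (Real.pi / 2)) - Real.pi / 2 := by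
      push_cast; ring
    rw [this, Real.cos_sub_pi_div_two]
    exact Real.cos_sq_add_sin_sq _
  rw [← h3]
  refine hasSum_sum_of_ne_finset_zero fun i hi => ?_
  simp only [Finset.mem_insert, Finset.mem_singleton, not_or] at hi
  rcases lt_or_gt_of_ne hi.1 with h | h
  · have : (i : ℝ) + 1 ≤ k := by exact_mod_cast h
    rw [archCos_eq_zero_of_ge (by nlinarith)]; simp
  · have : (k : ℝ) + 2 ≤ i := by
      have : k + 2 ≤ i := by omega
      exact_mod_cast this
    rw [archCos_eq_zero_of_le (by nlinarith)]; simp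

/-- A partition of unity (in the sense of squares) on `ℕ` by finitely supported functions of
summably small variation. -/
theorem exists_slowly_varying_partition {η : ℝ} (hη : 0 < η) :
    ∃ (c : ℕ → ℕ → ℝ) (J : ℕ → ℕ), (∀ i j, J i ≤ j → c i j = 0) ∧
      (∀ i j, |c i j - c i (j + 1)| ≤ η * (1 / 2) ^ i) ∧ ∀ j, HasSum (fun i => c i j ^ 2) 1 := by
  have hpi := Real.pi_gt_three
  obtain ⟨δ, hδ, hδ1, hδη⟩ : ∃ δ : ℝ, 0 < δ ∧ δ ≤ 1 ∧ 4 * δ ≤ η :=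
    ⟨min 1 (η / 4), by positivity, min_le_left _ _, by linarith [min_le_right 1 (η / 4)]⟩
  let θ : ℕ → ℝ := fun j => δ * Real.log (1 + j)
  have hθ0 : ∀ j, 0 ≤ θ j := fun j =>
    mul_nonneg hδ.le (Real.log_nonneg (by linarith [j.cast_nonneg (α := ℝ)]))
  have hθ : Tendsto θ atTop atTop :=
    (Real.tendsto_log_atTop.comp
      (tendsto_atTop_add_const_left _ 1 tendsto_natCast_atTop_atTop)).const_mul_atTop hδ
  have hJ : ∀ i : ℕ, ∃ J : ℕ, ∀ j, J ≤ j → ((i : ℝ) + 1) * (Real.pi / 2) ≤ θ j := fun i =>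
    eventually_atTop.1 (hθ.eventually_ge_atTop _)
  choose J hJ using hJ
  refine ⟨fun i j => archCos (θ j - i * (Real.pi / 2)), J, fun i j hj => ?_, fun i j => ?_,
    fun j => hasSum_archCos_sq (hθ0 j)⟩
  · exact archCos_eq_zero_of_ge (by linarith [hJ i j hj])
  · have hj : (0 : ℝ) ≤ j := j.cast_nonneg
    have hd0 : θ j ≤ θ (j + 1) := by
      refine mul_le_mul_of_nonneg_left (Real.log_le_log (by linarith) ?_) hδ.le
      push_cast; linarith
    have hd : θ (j + 1) - θ j ≤ δ * (1 / (1 + j)) := by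
      simp only [θ]
      rw [← mul_sub, ← Real.log_div (by positivity) (by positivity)]
      refine mul_le_mul_of_nonneg_left ((Real.log_le_sub_one_of_pos (by positivity)).trans ?_) hδ.le
      push_cast
      rw [div_sub_one (by positivity)]
      exact le_of_eq (by congr 1; ring)
    rcases le_or_gt (θ (j + 1)) (((i : ℝ) - 1) * (Real.pi / 2)) with h | h
    · dsimp only
      rw [archCos_eq_zero_of_le (by linarith), archCos_eq_zero_of_le (by linarith)]
      simp; positivity
    · have h2 : (2 : ℝ) ^ i ≤ 2 * (2 + j) := by
        rcases i with _ | i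
        · simp; linarith
        · have h3 : (i : ℝ) * Real.log 2 ≤ Real.log (2 + j) := by
            have hl : Real.log 2 ≤ 1 := by linarith [Real.log_two_lt_d9]
            have hlog : 0 ≤ Real.log (2 + j) := Real.log_nonneg (by linarith)
            have : θ (j + 1) ≤ Real.log (2 + j) := by
              have : θ (j + 1) = δ * Real.log (2 + j) := by
                simp only [θ]; push_cast; ring_nf
              rw [this]; exact mul_le_of_le_one_left hlog hδ1
            push_cast at h
            have : (i : ℝ) * Real.log 2 ≤ i * (Real.pi / 2) :=
              mul_le_mul_of_nonneg_left (by linarith) i.cast_nonneg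
            nlinarith
          rw [← Real.log_pow] at h3
          have := (Real.log_le_log_iff (by positivity) (by positivity)).1 h3
          rw [pow_succ]; linarith
      have h4 : 1 / (1 + (j : ℝ)) ≤ 4 * (1 / 2) ^ i := by
        rw [one_div_pow, mul_one_div, div_le_div_iff₀ (by positivity) (by positivity)]
        linarith
      dsimp only
      refine (abs_archCos_sub_le _ _).trans ?_
      rw [sub_sub_sub_cancel_right, abs_sub_comm, abs_of_nonneg (by linarith)]
      calc θ (j + 1) - θ j ≤ δ * (4 * (1 / 2) ^ i) :=
            hd.trans (mul_le_mul_of_nonneg_left h4 hδ.le)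
        _ = 4 * δ * (1 / 2) ^ i := by ring
        _ ≤ η * (1 / 2) ^ i := mul_le_mul_of_nonneg_right hδη (by positivity)

end Partition

section Quasicentral

variable {H : Type*} [NormedAddCommGroup H] [InnerProductSpace ℂ H]

theorem exists_filtration [TopologicalSpace.SeparableSpace H] {K : Submodule ℂ H}
    (hK : IsClosed (K : Set H)) (b : ℕ → H →L[ℂ] H) (m : ℕ)
    (hbK : ∀ l < m, ∀ x ∈ K, b l x ∈ K) :
    ∃ F : ℕ → Submodule ℂ H, F 0 = ⊥ ∧ Monotone F ∧ (∀ j, FiniteDimensional ℂ (F j)) ∧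
      (∀ j, F j ≤ K) ∧ (∀ l < m, ∀ j, ∀ x ∈ F j, b l x ∈ F (j + 1)) ∧
      (⨆ j, F j).topologicalClosure = K := by
  have := UniformSpace.secondCountable_of_separable H
  let d : ℕ → K := TopologicalSpace.denseSeq K
  let F : ℕ → Submodule ℂ H := fun j => Nat.rec ⊥ (fun j W => W ⊔ ℂ ∙ (d j : H) ⊔
    (Finset.range m).sup fun l => W.map (b l : H →ₗ[ℂ] H)) j
  have hsucc : ∀ j, F (j + 1) = F j ⊔ ℂ ∙ (d j : H) ⊔
    (Finset.range m).sup fun l => (F j).map (b l : H →ₗ[ℂ] H) := fun j => rfl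
  have hzero : F 0 = ⊥ := rfl
  clear_value F
  have hle : ∀ j, F j ≤ K := by
    intro j
    induction j with
    | zero => rw [hzero]; exact bot_le
    | succ j ih =>
      rw [hsucc]
      refine sup_le (sup_le ih ?_) (Finset.sup_le fun l hl => ?_)
      · rw [Submodule.span_singleton_le_iff_mem]; exact (d j).2
      · rintro _ ⟨x, hx, rfl⟩
        exact hbK l (Finset.mem_range.1 hl) x (ih hx)
  have hmono : Monotone F := monotone_nat_of_le_succ fun j => by
    rw [hsucc]; exact le_sup_left.trans le_sup_left
  refine ⟨F, hzero, hmono, fun j => ?_, hle, fun l hl j x hx => ?_, le_antisymm ?_ ?_⟩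
  · induction j with
    | zero => rw [hzero]; infer_instance
    | succ j ih =>
      have : ∀ l, FiniteDimensional ℂ ((F j).map (b l : H →ₗ[ℂ] H)) :=
        fun l => Module.Finite.map _ _
      have := Submodule.finiteDimensional_finset_sup (Finset.range m)
        fun l => (F j).map (b l : H →ₗ[ℂ] H)
      rw [hsucc]
      exact Submodule.finiteDimensional_sup _ _
  · rw [hsucc]
    refine (le_sup_right : _ ≤ F j ⊔ ℂ ∙ (d j : H) ⊔ _) ?_
    exact Finset.le_sup (f := fun l => (F j).map (b l : H →ₗ[ℂ] H)) (Finset.mem_range.2 hl)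
      ⟨x, hx, rfl⟩
  · exact Submodule.topologicalClosure_minimal _ (iSup_le hle) hK
  · intro x hx
    have h1 : (⟨x, hx⟩ : K) ∈ closure (Set.range d) := TopologicalSpace.denseRange_denseSeq K _
    have h2 := map_mem_closure continuous_subtype_val h1
      (t := ((⨆ j, F j : Submodule ℂ H) : Set H)) (by
        rintro _ ⟨j, rfl⟩
        refine (le_iSup F (j + 1)) ?_
        rw [hsucc]
        exact (le_sup_left : F j ⊔ ℂ ∙ (d j : H) ≤ _)
          ((le_sup_right : _ ≤ F j ⊔ _) (Submodule.mem_span_singleton_self _)))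
    exact h2

theorem norm_sum_sq_of_orthogonal (v : ℕ → H) (h : ∀ i j, i < j → inner ℂ (v i) (v j) = 0)
    (n : ℕ) : ‖∑ i ∈ Finset.range n, v i‖ ^ 2 = ∑ i ∈ Finset.range n, ‖v i‖ ^ 2 := by
  induction n with
  | zero => simp
  | succ n ih =>
    rw [Finset.sum_range_succ, Finset.sum_range_succ, ← ih]
    have : inner ℂ (∑ i ∈ Finset.range n, v i) (v n) = 0 := by
      rw [sum_inner]
      exact Finset.sum_eq_zero fun i hi => h i n (Finset.mem_range.1 hi)
    have := norm_add_sq_eq_norm_sq_add_norm_sq_of_inner_eq_zero _ _ this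
    simpa only [sq] using this

variable [CompleteSpace H]

/-- The properties of the projections onto an increasing sequence of subspaces. -/
structure IncreasingProjections (p : ℕ → H →L[ℂ] H) : Prop where
  zero : p 0 = 0
  star_eq : ∀ j, star (p j) = p j
  mul_of_le : ∀ j k, j ≤ k → p j * p k = p j

namespace IncreasingProjections

variable {p : ℕ → H →L[ℂ] H} (hp : IncreasingProjections p)
include hp

theorem mul_of_ge (j k : ℕ) (h : k ≤ j) : p j * p k = p k := by
  have := congrArg star (hp.mul_of_le k j h)
  rwa [star_mul, hp.star_eq, hp.star_eq] at this

theorem star_diff (j : ℕ) : star (p (j + 1) - p j) = p (j + 1) - p j := by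
  rw [star_sub, hp.star_eq, hp.star_eq]

theorem diff_mul_diff_self (j : ℕ) :
    (p (j + 1) - p j) * (p (j + 1) - p j) = p (j + 1) - p j := by
  rw [sub_mul, mul_sub, mul_sub, hp.mul_of_le _ _ le_rfl, hp.mul_of_le _ _ le_rfl,
    hp.mul_of_le _ _ j.le_succ, hp.mul_of_ge _ _ j.le_succ]
  abel

theorem diff_mul_diff_of_lt {i j : ℕ} (h : i < j) :
    (p (i + 1) - p i) * (p (j + 1) - p j) = 0 := by
  rw [sub_mul, mul_sub, mul_sub, hp.mul_of_le _ _ (by omega), hp.mul_of_le _ _ (by omega),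
    hp.mul_of_le _ _ (by omega), hp.mul_of_le _ _ (by omega)]
  abel

theorem inner_diff_of_lt {i j : ℕ} (h : i < j) (x y : H) :
    inner ℂ ((p (i + 1) - p i) x) ((p (j + 1) - p j) y) = 0 := by
  conv_lhs => rw [← hp.star_diff i]
  rw [inner_star_left, ← mul_apply_eq_comp, hp.diff_mul_diff_of_lt h]
  simp

theorem sum_norm_diff_sq (n : ℕ) (x : H) :
    ∑ j ∈ Finset.range n, ‖(p (j + 1) - p j) x‖ ^ 2 = ‖p n x‖ ^ 2 := by
  rw [← norm_sum_sq_of_orthogonal _ fun i j h => hp.inner_diff_of_lt h x x]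
  congr 2
  simp only [sub_apply]
  rw [Finset.sum_range_sub (fun j => p j x), hp.zero]
  simp

theorem norm_le_one (n : ℕ) : ‖p n‖ ≤ 1 :=
  norm_le_one_of_star_mul_self (hp.star_eq n) (hp.mul_of_le n n le_rfl)
    (by rw [hp.star_eq, hp.mul_of_le n n le_rfl])

/-- The commutator of a slowly varying combination of the differences of the projections with a
self-adjoint operator of propagation one is small. -/
theorem norm_commutator_le {b : H →L[ℂ] H} (hb : star b = b)
    (hbp : ∀ j, p (j + 1) * b * p j = b * p j) (c : ℕ → ℝ) (J : ℕ)
    (hJ : ∀ j, J ≤ j → c j = 0) {ε : ℝ} (hc : ∀ j, |c j - c (j + 1)| ≤ ε) :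
    ‖(∑ j ∈ Finset.range J, (c j : ℂ) • (p (j + 1) - p j)) * b
      - b * ∑ j ∈ Finset.range J, (c j : ℂ) • (p (j + 1) - p j)‖ ≤ 2 * ε * ‖b‖ := by
  have hε : 0 ≤ ε := (abs_nonneg _).trans (hc 0)
  have habel : ∀ n, ∑ j ∈ Finset.range n, (c j : ℂ) • (p (j + 1) - p j) =
      ∑ j ∈ Finset.range n, ((c j - c (j + 1) : ℝ) : ℂ) • p (j + 1) + (c n : ℂ) • p n := by
    intro n
    induction n with
    | zero => simp [hp.zero]
    | succ n ih =>
      rw [Finset.sum_range_succ, Finset.sum_range_succ, ih]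
      push_cast
      module
  let q : ℕ → H →L[ℂ] H := fun j => p (j + 1) - p j
  have hq : ∀ j, star (q j) = q j := hp.star_diff
  let T : H →L[ℂ] H := ∑ j ∈ Finset.range J, ((c j - c (j + 1) : ℝ) : ℂ) • (q (j + 1) * b * q j)
  have hcomm : ∀ j, p (j + 1) * b - b * p (j + 1) = q j * b * q (j + 1) - q (j + 1) * b * q j := by
    intro j
    have h1 : b * p (j + 1) = p (j + 1) * b * p (j + 1) + q (j + 1) * b * q j := by
      have e1 := hbp j
      have e2 := hbp (j + 1)
      have e3 : p (j + 1 + 1) * b * p j = b * p j :=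
        calc p (j + 1 + 1) * b * p j = p (j + 1 + 1) * (p (j + 1) * b * p j) := by
              rw [e1, mul_assoc]
          _ = p (j + 1 + 1) * p (j + 1) * b * p j := by simp only [mul_assoc]
          _ = b * p j := by rw [hp.mul_of_ge _ _ (by omega), e1]
      simp only [q, sub_mul, mul_sub, e1, e2, e3]
      abel
    have h2 := congrArg star h1
    simp only [star_mul, star_add, hq, hp.star_eq, hb, ← mul_assoc] at h2
    generalize p (j + 1) * b * p (j + 1) = X at h1 h2
    rw [h1, h2]
    abel
  have hstar : star T = ∑ j ∈ Finset.range J,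
      ((c j - c (j + 1) : ℝ) : ℂ) • (q j * b * q (j + 1)) := by
    simp only [T, star_sum, star_smul, star_mul, hq, hb, ← mul_assoc]
    simp
  have hT : ‖T‖ ≤ ε * ‖b‖ := by
    refine ContinuousLinearMap.opNorm_le_bound _ (by positivity) fun x => ?_
    refine abs_le_of_sq_le_sq' ?_ (by positivity) |>.2
    have : T x = ∑ j ∈ Finset.range J,
        q (j + 1) (((c j - c (j + 1) : ℝ) : ℂ) • b (q j x)) := by
      simp [T]
    rw [this, norm_sum_sq_of_orthogonal _ fun i j h => hp.inner_diff_of_lt (by omega) _ _]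
    calc _ ≤ ∑ j ∈ Finset.range J, (ε * ‖b‖) ^ 2 * ‖q j x‖ ^ 2 := by
          refine Finset.sum_le_sum fun j _ => ?_
          rw [← mul_pow]
          refine pow_le_pow_left₀ (norm_nonneg _) ?_ 2
          have hq1 : ‖q (j + 1)‖ ≤ 1 := norm_le_one_of_star_mul_self (hq _)
            (hp.diff_mul_diff_self _) (by rw [hq]; exact hp.diff_mul_diff_self _)
          refine ((q (j + 1)).le_opNorm _).trans
            ((mul_le_of_le_one_left (norm_nonneg _) hq1).trans ?_)
          rw [norm_smul, Complex.norm_real, mul_assoc]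
          exact mul_le_mul (hc j) (b.le_opNorm _) (norm_nonneg _) hε
      _ = (ε * ‖b‖) ^ 2 * ‖p J x‖ ^ 2 := by
          rw [← Finset.mul_sum, hp.sum_norm_diff_sq]
      _ ≤ (ε * ‖b‖ * ‖x‖) ^ 2 := by
          rw [mul_pow _ ‖x‖]
          refine mul_le_mul_of_nonneg_left (pow_le_pow_left₀ (norm_nonneg _) ?_ 2) (by positivity)
          exact ((p J).le_opNorm _).trans (mul_le_of_le_one_left (norm_nonneg _) (hp.norm_le_one J))
  have hmain : (∑ j ∈ Finset.range J, (c j : ℂ) • (p (j + 1) - p j)) * b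
      - b * ∑ j ∈ Finset.range J, (c j : ℂ) • (p (j + 1) - p j) = star T - T := by
    rw [habel, hJ J le_rfl, hstar]
    simp only [T, Complex.ofReal_zero, zero_smul, add_zero, Finset.sum_mul, Finset.mul_sum]
    rw [← Finset.sum_sub_distrib, ← Finset.sum_sub_distrib]
    refine Finset.sum_congr rfl fun j _ => ?_
    rw [smul_mul_assoc, mul_smul_comm, ← smul_sub, hcomm, smul_sub]
  rw [hmain]
  refine (norm_sub_le _ _).trans ?_
  rw [norm_star]
  linarith

end IncreasingProjections

end Quasicentral

section Quasicentral

variable {H : Type*} [NormedAddCommGroup H] [InnerProductSpace ℂ H] [CompleteSpace H]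

theorem hasSum_comm_of_nonneg {f : ℕ → ℕ → ℝ} (hf : ∀ i j, 0 ≤ f i j) {g h : ℕ → ℝ} {s : ℝ}
    (hg : ∀ j, HasSum (fun i => f i j) (g j)) (hs : HasSum g s) (hh : ∀ i, HasSum (f i) (h i)) :
    HasSum h s := by
  have h1 : Summable fun z : ℕ × ℕ => f z.2 z.1 := by
    refine (summable_prod_of_nonneg fun z => hf _ _).2 ⟨fun j => (hg j).summable, ?_⟩
    simpa only [(hg _).tsum_eq] using hs.summable
  have h2 : HasSum (fun z : ℕ × ℕ => f z.2 z.1) s := by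
    have := h1.hasSum.prod_fiberwise hg
    rw [hs.unique this]
    exact h1.hasSum
  exact ((Equiv.prodComm ℕ ℕ).hasSum_iff.2 h2).prod_fiberwise hh

theorem IncreasingProjections.of_monotone {F : ℕ → Submodule ℂ H}
    [∀ j, (F j).HasOrthogonalProjection] (h0 : F 0 = ⊥) (hF : Monotone F) :
    IncreasingProjections fun j => (F j).starProjection where
  zero := by
    ext x
    have : (F 0).starProjection x ∈ F 0 := Submodule.starProjection_apply_mem _ _
    simpa using h0.le this
  star_eq j := isStarProjection_starProjection.isSelfAdjoint
  mul_of_le j k h := by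
    have : (F k).starProjection * (F j).starProjection = (F j).starProjection := by
      ext x
      exact Submodule.starProjection_eq_self_iff.2 (hF h (Submodule.starProjection_apply_mem _ _))
    have := congrArg star this
    rwa [star_mul, isStarProjection_starProjection.isSelfAdjoint.star_eq,
      isStarProjection_starProjection.isSelfAdjoint.star_eq] at this

/-- A partition of unity of a reducing subspace into finite rank operators which almost commute
with finitely many given self-adjoint operators. -/
theorem exists_quasicentral_partition [TopologicalSpace.SeparableSpace H] {K : Submodule ℂ H}
    [K.HasOrthogonalProjection] (hK : IsClosed (K : Set H)) (b : ℕ → H →L[ℂ] H)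
    (hb : ∀ l, star (b l) = b l) (m : ℕ) (hbK : ∀ l < m, ∀ x ∈ K, b l x ∈ K) {η : ℝ} (hη : 0 < η) :
    ∃ (C : ℕ → H →L[ℂ] H) (R : ℕ → Submodule ℂ H), (∀ i, FiniteDimensional ℂ (R i)) ∧
      (∀ i, R i ≤ K) ∧ (∀ i, star (C i) = C i) ∧ (∀ i x, C i x ∈ R i) ∧
      (∀ i, ∀ l < m, ∀ x, b l (C i x) ∈ R i) ∧
      (∀ i, ∀ l < m, ‖C i * b l - b l * C i‖ ≤ η * (1 / 2) ^ i) ∧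
      ∀ x, HasSum (fun i => ‖C i x‖ ^ 2) (‖K.starProjection x‖ ^ 2) := by
  obtain ⟨F, hF0, hFm, hFd, hFK, hFb, hFc⟩ := exists_filtration hK b m hbK
  have hlim : ∀ x, Tendsto (fun j => (F j).starProjection x) atTop (𝓝 (K.starProjection x)) := by
    subst hFc
    exact fun x => Submodule.starProjection_tendsto_closure_iSup F hFm x
  let p : ℕ → H →L[ℂ] H := fun j => (F j).starProjection
  have hp : IncreasingProjections p := IncreasingProjections.of_monotone hF0 hFm
  have hpF : ∀ j x, p j x ∈ F j := fun j x => Submodule.starProjection_apply_mem _ _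
  obtain ⟨M, hM, hbM⟩ : ∃ M : ℝ, 0 < M ∧ ∀ l < m, ‖b l‖ ≤ M := by
    refine ⟨1 + ∑ l ∈ Finset.range m, ‖b l‖, by positivity, fun l hl => ?_⟩
    have := Finset.single_le_sum (f := fun l => ‖b l‖) (fun i _ => norm_nonneg (b i))
      (Finset.mem_range.2 hl)
    linarith
  obtain ⟨c, J, hJ, hc, hsum⟩ := exists_slowly_varying_partition
    (η := η / (2 * M)) (by positivity)
  let C : ℕ → H →L[ℂ] H := fun i => ∑ j ∈ Finset.range (J i), (c i j : ℂ) • (p (j + 1) - p j)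
  have hCF : ∀ i x, C i x ∈ F (J i) := by
    intro i x
    simp only [C, sum_apply]
    refine Submodule.sum_mem _ fun j hj => Submodule.smul_mem _ _ (Submodule.sub_mem _ ?_ ?_)
    · exact hFm (Finset.mem_range.1 hj) (hpF (j + 1) x)
    · exact hFm (Finset.mem_range.1 hj).le (hpF j x)
  refine ⟨C, fun i => F (J i + 1), fun i => hFd _, fun i => hFK _, fun i => ?_,
    fun i x => hFm (Nat.le_succ _) (hCF i x), fun i l hl x => hFb l hl _ _ (hCF i x),
    fun i l hl => ?_, fun x => ?_⟩
  · simp only [C, star_sum, star_smul, hp.star_diff]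
    simp
  · refine (hp.norm_commutator_le (hb l) (fun j => ?_) (c i) (J i) (hJ i) (hc i)).trans ?_
    · ext x
      exact Submodule.starProjection_eq_self_iff.2 (hFb l hl _ _ (hpF j x))
    · calc 2 * (η / (2 * M) * (1 / 2) ^ i) * ‖b l‖ ≤ 2 * (η / (2 * M) * (1 / 2) ^ i) * M :=
            mul_le_mul_of_nonneg_left (hbM l hl) (by positivity)
        _ = η * (1 / 2) ^ i := by field_simp
  · refine hasSum_comm_of_nonneg (f := fun i j => c i j ^ 2 * ‖(p (j + 1) - p j) x‖ ^ 2)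
      (g := fun j => ‖(p (j + 1) - p j) x‖ ^ 2) (fun i j => by positivity) (fun j => ?_) ?_
      fun i => ?_
    · simpa using (hsum j).mul_right (‖(p (j + 1) - p j) x‖ ^ 2)
    · rw [hasSum_iff_tendsto_nat_of_nonneg fun j => by positivity]
      simp only [hp.sum_norm_diff_sq]
      exact (hlim x).norm.pow 2
    · have : ‖C i x‖ ^ 2 =
          ∑ j ∈ Finset.range (J i), c i j ^ 2 * ‖(p (j + 1) - p j) x‖ ^ 2 := by
        have h1 : C i x = ∑ j ∈ Finset.range (J i), (c i j : ℂ) • (p (j + 1) - p j) x := by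
          simp only [C, sum_apply, smul_apply]
        rw [h1, norm_sum_sq_of_orthogonal]
        · simp [norm_smul, mul_pow]
        · intro k l hkl
          rw [inner_smul_left, inner_smul_right, hp.inner_diff_of_lt hkl]
          simp
      rw [this]
      refine hasSum_sum_of_ne_finset_zero fun j hj => ?_
      rw [hJ i j (by simpa using hj)]
      simp

end Quasicentral

section Piece

theorem exists_inv_sqrt_one_sub {A : Type*} [CStarAlgebra A] {y : A} (hy : IsSelfAdjoint y)
    (h : ‖y‖ ≤ 1 / 2) : ∃ s : A, star s = s ∧ s * s * (1 - y) = 1 ∧ Commute s y ∧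
      (∀ q, Commute y q → Commute s q) ∧ ‖s - 1‖ ≤ 2 * ‖y‖ := by
  let f : ℝ → ℝ := fun t => (√(1 - t))⁻¹
  have hs : ∀ t ∈ spectrum ℝ y, |t| ≤ ‖y‖ := fun t ht => by
    rcases subsingleton_or_nontrivial A with hA | hA
    · simp at ht
    · exact spectrum.norm_le_norm_of_mem ht
  have hpos : ∀ t ∈ spectrum ℝ y, 1 / 2 ≤ 1 - t := fun t ht => by
    linarith [le_abs_self t, hs t ht]
  have hf : ContinuousOn f (spectrum ℝ y) := by
    refine ContinuousOn.inv₀ (by fun_prop) fun t ht => ?_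
    exact (Real.sqrt_pos.2 (by linarith [hpos t ht])).ne'
  have hcomm : ∀ q, Commute y q → Commute (cfc f y) q := fun q hq => hy.commute_cfc hq f
  refine ⟨cfc f y, (cfc_predicate f y : IsSelfAdjoint _), ?_, hcomm y (Commute.refl y), hcomm, ?_⟩
  · have h1 : (1 : A) - y = cfc (fun t : ℝ => 1 - t) y := by
      rw [cfc_sub (fun _ : ℝ => (1 : ℝ)) (fun t : ℝ => t) y, cfc_const_one ℝ y, cfc_id' ℝ y]
    rw [h1, ← cfc_mul f f y hf hf, ← cfc_mul (fun t => f t * f t) _ y (hf.mul hf) (by fun_prop),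
      ← cfc_const_one ℝ y]
    refine cfc_congr fun t ht => ?_
    have h2 : 0 < 1 - t := by linarith [hpos t ht]
    have h3 := Real.mul_self_sqrt h2.le
    have h4 := Real.sqrt_pos.2 h2
    simp only [f]
    field_simp
    rw [sq, h3]
  · rw [← cfc_const_one ℝ y, ← cfc_sub f _ y hf (by fun_prop)]
    refine norm_cfc_le (by positivity) fun t ht => ?_
    have h2 := hpos t ht
    have h3 := Real.sq_sqrt (by linarith : 0 ≤ 1 - t)
    have h4 : 1 / 2 ≤ √(1 - t) := Real.le_sqrt_of_sq_le (by norm_num; linarith)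
    have h5 : f t - 1 = t / (√(1 - t) * (1 + √(1 - t))) := by
      simp only [f]
      field_simp
      linarith
    rw [h5, Real.norm_eq_abs, abs_div, abs_of_pos (by positivity : 0 < √(1 - t) * (1 + √(1 - t))),
      div_le_iff₀ (by positivity)]
    nlinarith [hs t ht, abs_nonneg t, norm_nonneg y]

variable {H : Type*} [NormedAddCommGroup H] [InnerProductSpace ℂ H] [CompleteSpace H]

theorem exists_isometry_near {u p g : H →L[ℂ] H} (hu : u ∈ unitary (H →L[ℂ] H))
    (hp : star p = p) (hpp : p * p = p) (hg : star g = g) (hgg : g * g = g)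
    (h : ‖g * u * p‖ ≤ 1 / 2) :
    ∃ w, star w * w = p ∧ g * w = 0 ∧ ‖w - u * p‖ ≤ 5 * ‖g * u * p‖ := by
  obtain ⟨hu1, hu2⟩ := Unitary.mem_iff.1 hu
  obtain ⟨k, hk⟩ : ∃ k, k = g * u * p := ⟨_, rfl⟩
  rw [← hk] at h ⊢
  have hkp : k * p = k := by rw [hk, mul_assoc, hpp]
  have hpk : p * star k = star k := by rw [← hp, ← star_mul, hkp]
  have hgk : g * k = k := by rw [hk, ← mul_assoc, ← mul_assoc, hgg]
  have hy1 : ‖star k * k‖ = ‖k‖ * ‖k‖ := CStarRing.norm_star_mul_self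
  have hy2 : ‖star k * k‖ ≤ 1 / 2 * ‖k‖ := by
    rw [hy1]; exact mul_le_mul_of_nonneg_right h (norm_nonneg _)
  obtain ⟨s, hs, hss, hsy, hsq, hs1⟩ := exists_inv_sqrt_one_sub (y := star k * k)
    (IsSelfAdjoint.star_mul_self k) (by linarith)
  have hsp : Commute s (1 - p) := hsq _ (by
    rw [commute_iff_eq, mul_sub, sub_mul, mul_assoc _ k p, hkp,
      ← mul_assoc p, hpk, mul_one, one_mul])
  let z : H →L[ℂ] H := u * p - k
  have hzz : star z * z = 1 - star k * k - (1 - p) := by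
    have h1 : star k * (u * p) = star k * k := by
      have : star k = star k * g := by
        conv_lhs => rw [← hgk, star_mul, hg]
      conv_rhs => rw [hk, ← hk]
      rw [hk] at this ⊢
      conv_lhs => rw [this]
      simp only [mul_assoc]
    have h2 : p * star u * k = star k * k := by
      have := congrArg star h1
      simpa [star_mul, hp] using this
    have h3 : p * star u * (u * p) = p := by
      rw [mul_assoc, ← mul_assoc (star u), hu1, one_mul, hpp]
    have : star z = p * star u - star k := by simp [z, star_mul, hp]
    rw [this]
    simp only [z]
    rw [mul_sub, sub_mul, sub_mul, h1, h2, h3]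
    abel
  have hsps : s * (1 - p) * s = 1 - p := by
    have h1 : (1 - star k * k) * (1 - p) = 1 - p := by
      rw [mul_sub, mul_one, sub_mul, one_mul, mul_assoc, hkp]; abel
    calc s * (1 - p) * s = s * s * (1 - p) := by
            rw [mul_assoc, ← hsp.eq, ← mul_assoc]
      _ = s * s * (1 - star k * k) * (1 - p) := by
            rw [mul_assoc (s * s), h1]
      _ = 1 - p := by rw [hss, one_mul]
  have hsys : s * (1 - star k * k) * s = 1 := by
    have : Commute s (1 - star k * k) := (Commute.one_right s).sub_right hsy
    rw [mul_assoc, ← this.eq, ← mul_assoc, hss]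
  have hww : star (z * s) * (z * s) = p := by
    rw [star_mul, hs, mul_assoc, ← mul_assoc (star z), hzz, ← mul_assoc, mul_sub, sub_mul, hsys,
      hsps]
    abel
  refine ⟨z * s, hww, ?_, ?_⟩
  · rw [← mul_assoc]
    simp only [z]
    rw [mul_sub, hgk, ← mul_assoc, ← hk, sub_self, zero_mul]
  · have hz : ‖z‖ ≤ 2 := by
      refine (norm_sub_le _ _).trans ?_
      have h1 := (norm_unitary_mul_le hu p)
      have h2 := norm_le_one_of_star_mul_self hp hpp (by rw [hp, hpp])
      linarith
    have : z * s - u * p = z * (s - 1) - k := by simp only [z]; noncomm_ring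
    rw [this]
    refine (norm_sub_le _ _).trans ?_
    have := (norm_mul_le z (s - 1)).trans (mul_le_mul hz hs1 (norm_nonneg _) (by norm_num))
    linarith [norm_nonneg k]

omit [CompleteSpace H] in
theorem norm_starProjection_mul_mul_starProjection_le {G R : Submodule ℂ H}
    [FiniteDimensional ℂ G] [FiniteDimensional ℂ R] (u : H →L[ℂ] H) {κ : ℝ}
    (h : ∀ i j, ‖inner ℂ (u (stdOrthonormalBasis ℂ R i : H)) (stdOrthonormalBasis ℂ G j : H)‖ ≤ κ) :
    ‖G.starProjection * u * R.starProjection‖ ≤ Module.finrank ℂ R * Module.finrank ℂ G * κ := by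
  have hterm : ∀ i j, ‖InnerProductSpace.rankOne ℂ (stdOrthonormalBasis ℂ G j : H)
      (stdOrthonormalBasis ℂ G j : H) * u * InnerProductSpace.rankOne ℂ
        (stdOrthonormalBasis ℂ R i : H) (stdOrthonormalBasis ℂ R i : H)‖ ≤ κ := by
    intro i j
    have hκ : 0 ≤ κ := (norm_nonneg _).trans (h i j)
    have he : ‖(stdOrthonormalBasis ℂ R i : H)‖ = 1 := (stdOrthonormalBasis ℂ R).norm_eq_one i
    have hg : ‖(stdOrthonormalBasis ℂ G j : H)‖ = 1 := (stdOrthonormalBasis ℂ G).norm_eq_one j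
    refine ContinuousLinearMap.opNorm_le_bound _ hκ fun x => ?_
    simp only [mul_apply_eq_comp, InnerProductSpace.rankOne_apply, map_smul, norm_smul,
      hg, mul_one]
    rw [mul_comm κ, norm_inner_symm, norm_inner_symm _ (u _)]
    exact mul_le_mul ((norm_inner_le_norm _ _).trans (by rw [he, mul_one])) (h i j)
      (norm_nonneg _) (norm_nonneg _)
  rw [(stdOrthonormalBasis ℂ G).starProjection_eq_sum_rankOne,
    (stdOrthonormalBasis ℂ R).starProjection_eq_sum_rankOne, Finset.mul_sum]
  refine (norm_sum_le_of_le _ (f := fun i => _) (n := fun _ => Module.finrank ℂ G * κ)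
    fun i _ => ?_).trans (le_of_eq ?_)
  · rw [Finset.sum_mul, Finset.sum_mul]
    refine (norm_sum_le_of_le _ fun j _ => hterm i j).trans (le_of_eq ?_)
    simp
  · simp [mul_assoc]

/-- Over a finite-dimensional subspace `R` of the kernel of `V`, an isometry which is close to an
almost intertwining unitary can be found with range orthogonal to a given finite-dimensional
subspace. -/
theorem exists_isometry_orthogonal {b c : ℕ → H →L[ℂ] H} {V : H →L[ℂ] H}
    (hV : ApproxIntertwines b c V) (R G : Submodule ℂ H) [FiniteDimensional ℂ R]
    [FiniteDimensional ℂ G] (hR : ∀ x ∈ R, V x = 0) (m : ℕ) {ε : ℝ} (hε : 0 < ε) :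
    ∃ u ∈ unitary (H →L[ℂ] H), ∃ w : H →L[ℂ] H, (∀ l < m, ‖u * b l - c l * u‖ ≤ ε) ∧
      star w * w = R.starProjection ∧ G.starProjection * w = 0 ∧
      ‖w - u * R.starProjection‖ ≤ ε := by
  classical
  obtain ⟨δ, hδ, hδ1, hδε⟩ : ∃ δ : ℝ, 0 < δ ∧ δ ≤ 1 / 2 ∧ 5 * δ ≤ ε :=
    ⟨min (1 / 2) (ε / 5), by positivity,
      min_le_left _ _, by linarith [min_le_right (1 / 2) (ε / 5)]⟩
  obtain ⟨N, hN⟩ : ∃ N : ℝ, N = Module.finrank ℂ R * Module.finrank ℂ G := ⟨_, rfl⟩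
  have hN0 : 0 ≤ N := by rw [hN]; positivity
  obtain ⟨u, hu, hub, hui⟩ := hV m
    (Finset.univ.image (fun i => (stdOrthonormalBasis ℂ R i : H)) ∪
      Finset.univ.image (fun i => (stdOrthonormalBasis ℂ G i : H)))
    (min ε (δ / (N + 1))) (by positivity)
  have hk : ‖G.starProjection * u * R.starProjection‖ ≤ δ := by
    refine (norm_starProjection_mul_mul_starProjection_le u (κ := δ / (N + 1))
      fun i j => ?_).trans ?_
    · have := hui (stdOrthonormalBasis ℂ R i : H) (by simp) (stdOrthonormalBasis ℂ G j : H)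
        (by simp)
      rw [hR _ (stdOrthonormalBasis ℂ R i).2, sub_zero] at this
      exact this.trans (min_le_right _ _)
    · rw [← hN, mul_div_assoc', div_le_iff₀ (by positivity)]
      nlinarith
  obtain ⟨w, hw, hgw, hwu⟩ := exists_isometry_near hu
    isStarProjection_starProjection.isSelfAdjoint.star_eq
    isStarProjection_starProjection.isIdempotentElem
    isStarProjection_starProjection.isSelfAdjoint.star_eq
    isStarProjection_starProjection.isIdempotentElem (hk.trans hδ1)
  exact ⟨u, hu, w, fun l hl => (hub l hl).trans (min_le_left _ _), hw, hgw, by linarith⟩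

end Piece

section Isometries

variable {H : Type*} [NormedAddCommGroup H] [InnerProductSpace ℂ H] [CompleteSpace H]

theorem exists_orthogonal_choice (P : ℕ → (H →L[ℂ] H) → Prop) (R : ℕ → Submodule ℂ H)
    [∀ k, FiniteDimensional ℂ (R k)]
    (h : ∀ (k : ℕ) (G : Submodule ℂ H) [FiniteDimensional ℂ G], ∃ w : H →L[ℂ] H,
      P k w ∧ star w * w = (R k).starProjection ∧ G.starProjection * w = 0) :
    ∃ w : ℕ → H →L[ℂ] H, (∀ k, P k (w k)) ∧
      (∀ k, star (w k) * w k = (R k).starProjection) ∧ ∀ j k, j ≠ k → star (w j) * w k = 0 := by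
  choose W hWP hW hWG using fun (k : ℕ) (G : {G : Submodule ℂ H // FiniteDimensional ℂ G}) =>
    haveI := G.2
    h k G.1
  let G : ℕ → {G : Submodule ℂ H // FiniteDimensional ℂ G} := fun k =>
    Nat.rec ⟨⊥, inferInstance⟩ (fun k G => ⟨G.1 ⊔ (R k).map (W k G : H →ₗ[ℂ] H), by
      have := G.2
      have : FiniteDimensional ℂ ((R k).map (W k G : H →ₗ[ℂ] H)) := Module.Finite.map _ _
      exact Submodule.finiteDimensional_sup _ _⟩) k
  have hsucc : ∀ k, (G (k + 1)).1 = (G k).1 ⊔ (R k).map (W k (G k) : H →ₗ[ℂ] H) := fun k => rfl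
  have hmono : Monotone fun k => (G k).1 := monotone_nat_of_le_succ fun k => by
    rw [hsucc]; exact le_sup_left
  have hmem : ∀ k x, W k (G k) x ∈ (G (k + 1)).1 := fun k x => by
    have h1 : W k (G k) * (R k).starProjection = W k (G k) :=
      mul_eq_self_of_star_mul_self isStarProjection_starProjection.isSelfAdjoint.star_eq
        isStarProjection_starProjection.isIdempotentElem (hW k (G k))
    have h2 : W k (G k) x = W k (G k) ((R k).starProjection x) := by
      conv_lhs => rw [← h1]
      rfl
    rw [hsucc, h2]
    exact (le_sup_right : _ ≤ (G k).1 ⊔ _)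
      ⟨_, Submodule.starProjection_apply_mem (R k) x, rfl⟩
  have hlt : ∀ j k, j < k → star (W k (G k)) * W j (G j) = 0 := by
    intro j k hjk
    have := (G k).2
    have h1 : (G k).1.starProjection * W j (G j) = W j (G j) := by
      ext x
      exact Submodule.starProjection_eq_self_iff.2 (hmono hjk (hmem j x))
    have h2 := congrArg star (hWG k (G k))
    rw [star_mul, isStarProjection_starProjection.isSelfAdjoint.star_eq, star_zero] at h2
    rw [← h1, ← mul_assoc, h2, zero_mul]
  refine ⟨fun k => W k (G k), fun k => hWP _ _, fun k => hW _ _, fun j k hjk => ?_⟩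
  rcases lt_or_gt_of_ne hjk with h1 | h1
  · simpa using congrArg star (hlt j k h1)
  · exact hlt k j h1

theorem ker_starProjection_eq {V : H →L[ℂ] H} (hV : V * star V * V = V)
    [V.ker.HasOrthogonalProjection] : V.ker.starProjection = 1 - star V * V := by
  ext x
  refine (Submodule.eq_starProjection_of_mem_of_inner_eq_zero ?_ fun y hy => ?_)
  · have : V * (1 - star V * V) = 0 := by rw [mul_sub, mul_one, ← mul_assoc, hV, sub_self]
    exact congrArg (fun T : H →L[ℂ] H => T x) this
  · have hy' : V y = 0 := hy
    simp [inner_star_left, hy']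

theorem norm_piece_le {u w C p b c : H →L[ℂ] H} {ε η : ℝ} (hw : ‖w‖ ≤ 1) (hC : ‖C‖ ≤ 1)
    (hpC : p * C = C) (hpbC : p * (b * C) = b * C) (hub : ‖u * b - c * u‖ ≤ ε)
    (hwu : ‖w - u * p‖ ≤ ε) (hCb : ‖C * b - b * C‖ ≤ η) :
    ‖w * C * b - c * (w * C)‖ ≤ η + ε * (1 + ‖b‖ + ‖c‖) := by
  have hε : 0 ≤ ε := (norm_nonneg _).trans hwu
  have h : w * C * b - c * (w * C) = w * (C * b - b * C) + (w - u * p) * (b * C)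
      + (u * b - c * u) * C - c * ((w - u * p) * C) := by
    have h1 : (w - u * p) * (b * C) = w * (b * C) - u * (b * C) := by
      rw [sub_mul, mul_assoc u, hpbC]
    have h2 : (w - u * p) * C = w * C - u * C := by
      rw [sub_mul, mul_assoc u, hpC]
    rw [h1, h2]
    noncomm_ring
  have e1 : ‖w * (C * b - b * C)‖ ≤ η :=
    (norm_mul_le _ _).trans ((mul_le_of_le_one_left (norm_nonneg _) hw).trans hCb)
  have e2 : ‖(w - u * p) * (b * C)‖ ≤ ε * ‖b‖ :=
    (norm_mul_le _ _).trans (mul_le_mul hwu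
      ((norm_mul_le _ _).trans (mul_le_of_le_one_right (norm_nonneg _) hC)) (norm_nonneg _) hε)
  have e3 : ‖(u * b - c * u) * C‖ ≤ ε :=
    (norm_mul_le _ _).trans ((mul_le_of_le_one_right (norm_nonneg _) hC).trans hub)
  have e4 : ‖c * ((w - u * p) * C)‖ ≤ ‖c‖ * ε :=
    (norm_mul_le _ _).trans (mul_le_mul_of_nonneg_left
      ((norm_mul_le _ _).trans ((mul_le_of_le_one_right (norm_nonneg _) hC).trans hwu))
      (norm_nonneg _))
  rw [h]
  refine (norm_sub_le _ _).trans ?_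
  have := norm_add₃_le (a := w * (C * b - b * C)) (b := (w - u * p) * (b * C))
    (c := (u * b - c * u) * C)
  linarith

theorem star_mul_eq_zero_of_hasSum {y z : ℕ → H →L[ℂ] H} {v w : H →L[ℂ] H}
    (hv : ∀ x, HasSum (fun i => y i x) (v x)) (hw : ∀ x, HasSum (fun i => z i x) (w x))
    (h : ∀ i j, star (y i) * z j = 0) : star v * w = 0 := by
  have h1 : ∀ i x x', inner ℂ (y i x) (w x') = 0 := fun i x x' => by
    refine ((hw x').mapL (innerSL ℂ (y i x))).unique ?_
    convert hasSum_zero using 2 with j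
    have := congrArg (fun T : H →L[ℂ] H => inner ℂ x (T x')) (h i j)
    simpa [inner_star_right] using this
  ext x'
  refine ext_inner_left ℂ fun x => ?_
  rw [mul_apply_eq_comp, inner_star_right, zero_apply, inner_zero_right, ← inner_conj_symm]
  have : HasSum (fun i => inner ℂ (w x') (y i x)) (inner ℂ (w x') (v x)) :=
    (hv x).mapL (innerSL ℂ (w x'))
  rw [this.unique (by
    convert hasSum_zero using 2 with i
    rw [← inner_conj_symm, h1, map_zero]), map_zero]

theorem star_mul_self_eq_of_hasSum {y : ℕ → H →L[ℂ] H} {v P : H →L[ℂ] H} (hP : star P = P)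
    (hPP : P * P = P) (hv : ∀ x, HasSum (fun i => y i x) (v x))
    (h : ∀ i j, i ≠ j → star (y i) * y j = 0)
    (hy : ∀ x, HasSum (fun i => ‖y i x‖ ^ 2) (‖P x‖ ^ 2)) : star v * v = P := by
  have h1 : ∀ i x, inner ℂ (v x) (y i x) = ((‖y i x‖ ^ 2 : ℝ) : ℂ) := fun i x => by
    have : inner ℂ (y i x) (v x) = ((‖y i x‖ ^ 2 : ℝ) : ℂ) := by
      refine ((hv x).mapL (innerSL ℂ (y i x))).unique ?_
      have h2 : inner ℂ (y i x) (y i x) = ((‖y i x‖ ^ 2 : ℝ) : ℂ) := by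
        rw [inner_self_eq_norm_sq_to_K]; norm_cast
      rw [← h2]
      refine hasSum_single i fun j hj => ?_
      have := congrArg (fun T : H →L[ℂ] H => inner ℂ x (T x)) (h i j hj.symm)
      simpa [inner_star_right] using this
    rw [← inner_conj_symm, this, Complex.conj_ofReal]
  have h3 : ∀ x, inner ℂ (v x) (v x) = inner ℂ (P x) (P x) := fun x => by
    have h2 : inner ℂ (P x) (P x) = ((‖P x‖ ^ 2 : ℝ) : ℂ) := by
      rw [inner_self_eq_norm_sq_to_K]; norm_cast
    rw [h2]
    refine ((hv x).mapL (innerSL ℂ (v x))).unique ?_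
    simp only [innerSL_apply_apply, h1]
    exact Complex.hasSum_ofReal.2 (hy x)
  have h4 : ((star v * v : H →L[ℂ] H) : H →ₗ[ℂ] H) = (P : H →ₗ[ℂ] H) := by
    refine (ext_inner_map _ _).1 fun x => ?_
    have e1 : inner ℂ ((star v * v) x) x = inner ℂ (v x) (v x) := by
      rw [mul_apply_eq_comp, inner_star_left]
    have e2 : inner ℂ (P x) x = inner ℂ (P x) (P x) := by
      rw [← inner_star_left, hP, ← mul_apply_eq_comp, hPP]
    exact e1.trans ((h3 x).trans e2.symm)
  exact ContinuousLinearMap.coe_injective h4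

end Isometries

section Absorbing

variable {H : Type*} [NormedAddCommGroup H] [InnerProductSpace ℂ H] [CompleteSpace H]

theorem nonempty_absorbingSequence_of_approxIntertwines [TopologicalSpace.SeparableSpace H]
    {b c : ℕ → H →L[ℂ] H} {V : H →L[ℂ] H} (hb : ∀ l, star (b l) = b l)
    (hc : ∀ l, star (c l) = c l) (hV : ApproxIntertwines b c V) (hVV : V * star V * V = V)
    (hVb : ∀ l, V * b l = c l * V) : Nonempty (AbsorbingSequence b c (1 - star V * V)) := by
  have hcl : IsClosed (V.ker : Set H) := ContinuousLinearMap.isClosed_ker V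
  have : CompleteSpace V.ker := hcl.completeSpace_coe
  have hP : V.ker.starProjection = 1 - star V * V := ker_starProjection_eq hVV
  have hbK : ∀ l, ∀ x ∈ V.ker, b l x ∈ V.ker := fun l x hx => by
    have h1 : V x = 0 := hx
    have h2 := congrArg (fun T : H →L[ℂ] H => T x) (hVb l)
    simp only [mul_apply_eq_comp, h1, map_zero] at h2
    exact h2
  choose C R hRd hRK hCs hCR hbCR hCb hCsum using fun n : ℕ =>
    exists_quasicentral_partition hcl b hb (n + 1) (fun l _ => hbK l)
      (η := (1 / 2 : ℝ) ^ n) (by positivity)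
  have hQ : star (1 - star V * V) = 1 - star V * V := by
    rw [← hP]; exact isStarProjection_starProjection.isSelfAdjoint
  have hQQ : (1 - star V * V) * (1 - star V * V) = 1 - star V * V := by
    rw [← hP]; exact isStarProjection_starProjection.isIdempotentElem
  have hC1 : ∀ n i, ‖C n i‖ ≤ 1 := fun n i => by
    refine ContinuousLinearMap.opNorm_le_bound _ zero_le_one fun x => ?_
    rw [one_mul]
    have h1 := le_hasSum (hCsum n x) i fun j _ => by positivity
    exact (abs_le_of_sq_le_sq' (h1) (norm_nonneg _)).2.trans
      (Submodule.norm_starProjection_apply_le _ _)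
  obtain ⟨w, hwP, hw, hwo⟩ := exists_orthogonal_choice
    (fun k w => ‖w‖ ≤ 1 ∧ ∀ l ≤ k.unpair.1,
      ‖w * C k.unpair.1 k.unpair.2 * b l - c l * (w * C k.unpair.1 k.unpair.2)‖ ≤
        (1 / 2) ^ k.unpair.1 * (1 / 2) ^ k.unpair.2 * (2 + ‖b l‖ + ‖c l‖))
    (fun k => R k.unpair.1 k.unpair.2) (by
      intro k G hG
      obtain ⟨n, i⟩ := k.unpair
      obtain ⟨u, hu, w, hub, hw, hGw, hwu⟩ := exists_isometry_orthogonal hV (R n i) G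
        (fun x hx => hRK n i hx) (n + 1) (ε := (1 / 2) ^ n * (1 / 2) ^ i) (by positivity)
      have hw1 : ‖w‖ ≤ 1 := norm_le_one_of_star_mul_self
        isStarProjection_starProjection.isSelfAdjoint.star_eq
        isStarProjection_starProjection.isIdempotentElem hw
      refine ⟨w, ⟨hw1, fun l hl => ?_⟩, hw, hGw⟩
      refine (norm_piece_le hw1 (hC1 n i) ?_ ?_ (hub l (Nat.lt_succ_of_le hl)) hwu
        (hCb n i l (Nat.lt_succ_of_le hl))).trans (le_of_eq (by ring))
      · ext x; exact Submodule.starProjection_eq_self_iff.2 (hCR n i x)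
      · ext x
        exact Submodule.starProjection_eq_self_iff.2 (hbCR n i l (Nat.lt_succ_of_le hl) x))
  let y : ℕ → ℕ → H →L[ℂ] H := fun n i => w (Nat.pair n i) * C n i
  have hyo : ∀ n i n' i', (n, i) ≠ (n', i') → star (y n i) * y n' i' = 0 := by
    intro n i n' i' hne
    have h1 : Nat.pair n i ≠ Nat.pair n' i' := fun h => hne (by
      rw [Nat.pair_eq_pair] at h; rw [h.1, h.2])
    simp only [y, star_mul]
    rw [mul_assoc, ← mul_assoc (star (w _)), hwo _ _ h1, zero_mul, mul_zero]
  have hyn : ∀ n i x, ‖y n i x‖ = ‖C n i x‖ := fun n i x => by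
    have h1 := hw (Nat.pair n i)
    simp only [Nat.unpair_pair] at h1
    have h2 : (R n i).starProjection (C n i x) = C n i x :=
      Submodule.starProjection_eq_self_iff.2 (hCR n i x)
    have h3 : inner ℂ (y n i x) (y n i x) = inner ℂ (C n i x) (C n i x) := by
      have h4 : inner ℂ (C n i x) (C n i x) =
          inner ℂ ((R n i).starProjection (C n i x)) (C n i x) := by rw [h2]
      rw [h4, ← h1, mul_apply_eq_comp, mul_apply_eq_comp, inner_star_left]
    rw [← sq_eq_sq₀ (norm_nonneg _) (norm_nonneg _)]
    rw [inner_self_eq_norm_sq_to_K, inner_self_eq_norm_sq_to_K] at h3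
    exact_mod_cast h3
  have hysum : ∀ n x, HasSum (fun i => ‖y n i x‖ ^ 2) (‖(1 - star V * V) x‖ ^ 2) := fun n x => by
    rw [← hP]
    simpa only [hyn] using hCsum n x
  choose v hv using fun n => exists_hasSum_of_orthogonal (y n)
    (fun i j hij => hyo n i n j (by simpa using hij)) fun x => (hysum n x).summable
  refine nonempty_absorbingSequence hb hc hQ hQQ v (fun n => ?_) (fun n m hnm => ?_)
    (fun l => 2 * (2 + ‖b l‖ + ‖c l‖)) (fun l n hln => ?_)
  · exact star_mul_self_eq_of_hasSum hQ hQQ (hv n) (fun i j hij => hyo n i n j (by simpa using hij))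
      (hysum n)
  · exact star_mul_eq_zero_of_hasSum (hv n) (hv m) fun i j => hyo n i m j fun h => hnm (by
      simpa using congrArg Prod.fst h)
  · refine opNorm_le_of_hasSum (E := fun i => y n i * b l - c l * y n i)
      (ε := fun i => (1 / 2) ^ n * (1 / 2) ^ i * (2 + ‖b l‖ + ‖c l‖)) (fun x => ?_)
      (fun i => ?_) ?_
    · exact (hv n (b l x)).sub ((hv n x).mapL (c l))
    · have := (hwP (Nat.pair n i)).2 l
      simp only [Nat.unpair_pair] at this
      exact this hln
    · have h1 := (hasSum_geometric_two.mul_left ((1 / 2 : ℝ) ^ n)).mul_right (2 + ‖b l‖ + ‖c l‖)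
      have h2 : (1 / 2 : ℝ) ^ n * 2 * (2 + ‖b l‖ + ‖c l‖) =
        2 * (2 + ‖b l‖ + ‖c l‖) * (1 / 2) ^ n := by ring
      rwa [h2] at h1

end Absorbing

section Orbit

variable {A H : Type*} [CStarAlgebra A] [NormedAddCommGroup H] [InnerProductSpace ℂ H]
  [CompleteSpace H] {π : A →⋆ₐ[ℂ] (H →L[ℂ] H)} {f : A → (H →L[ℂ] H)}

theorem conj_mem_closure_unitaryOrbitBH (hf : f ∈ closure (unitaryOrbitBH π)) {v : H →L[ℂ] H}
    (hv : v ∈ unitary (H →L[ℂ] H)) :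
    (fun a => v * f a * star v) ∈ closure (unitaryOrbitBH π) := by
  refine map_mem_closure (f := fun g : A → (H →L[ℂ] H) => fun a => v * g a * star v)
    (by fun_prop) hf ?_
  rintro _ ⟨u, hu, rfl⟩
  refine ⟨u * star v, mul_mem hu (Unitary.star_mem hv), ?_⟩
  funext a
  simp only [star_mul, star_star, mul_assoc]

theorem map_add_of_mem_closure_unitaryOrbitBH (hf : f ∈ closure (unitaryOrbitBH π)) (x y : A) :
    f (x + y) = f x + f y := by
  have hcl : IsClosed {g : A → (H →L[ℂ] H) | g (x + y) = g x + g y} :=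
    isClosed_eq (by fun_prop) (by fun_prop)
  refine closure_minimal ?_ hcl hf
  rintro _ ⟨u, -, rfl⟩
  simp [mul_add, add_mul]

theorem map_smul_of_mem_closure_unitaryOrbitBH (hf : f ∈ closure (unitaryOrbitBH π)) (z : ℂ)
    (x : A) : f (z • x) = z • f x := by
  have hcl : IsClosed {g : A → (H →L[ℂ] H) | g (z • x) = z • g x} :=
    isClosed_eq (by fun_prop) (by fun_prop)
  refine closure_minimal ?_ hcl hf
  rintro _ ⟨u, -, rfl⟩
  simp

theorem map_star_of_mem_closure_unitaryOrbitBH (hf : f ∈ closure (unitaryOrbitBH π)) (x : A) :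
    f (star x) = star (f x) := by
  have hcl : IsClosed {g : A → (H →L[ℂ] H) | g (star x) = star (g x)} :=
    isClosed_eq (by fun_prop) (by fun_prop)
  refine closure_minimal ?_ hcl hf
  rintro _ ⟨u, -, rfl⟩
  simp [mul_assoc, map_star]

theorem norm_sub_le_of_mem_closure_unitaryOrbitBH (hf : f ∈ closure (unitaryOrbitBH π))
    (x y : A) : ‖f x - f y‖ ≤ ‖x - y‖ := by
  refine closure_minimal (t := {g | ‖g x - g y‖ ≤ ‖x - y‖}) ?_
    (isClosed_le (by fun_prop) (by fun_prop)) hf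
  rintro _ ⟨u, hu, rfl⟩
  have : star u * π x * u - star u * π y * u = star u * π (x - y) * u := by
    rw [map_sub, mul_sub, sub_mul]
  change ‖star u * π x * u - star u * π y * u‖ ≤ ‖x - y‖
  rw [this]
  exact (norm_mul_unitary_le hu _).trans ((norm_unitary_mul_le (Unitary.star_mem hu) _).trans
    (NonUnitalStarAlgHom.norm_apply_le π _))

theorem exists_unitary_of_mem_closure_unitaryOrbitBH (hf : f ∈ closure (unitaryOrbitBH π))
    (a : ℕ → A) (m : ℕ) {ε : ℝ} (hε : 0 < ε) :
    ∃ u ∈ unitary (H →L[ℂ] H), ∀ l < m, ‖u * f (a l) - π (a l) * u‖ ≤ ε := by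
  have hO : IsOpen (⋂ l ∈ Finset.range m, {g : A → (H →L[ℂ] H) | ‖g (a l) - f (a l)‖ < ε}) :=
    isOpen_biInter_finset fun l _ => isOpen_lt (by fun_prop) continuous_const
  obtain ⟨_, hg, u, hu, rfl⟩ := mem_closure_iff.1 hf _ hO (by simp [hε])
  refine ⟨u, hu, fun l hl => ?_⟩
  have h1 : ‖star u * π (a l) * u - f (a l)‖ < ε := by
    simpa using Set.mem_iInter₂.1 hg l (Finset.mem_range.2 hl)
  have h2 : u * f (a l) - π (a l) * u = -(u * (star u * π (a l) * u - f (a l))) := by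
    rw [mul_sub, ← mul_assoc, ← mul_assoc, (Unitary.mem_iff.1 hu).2, one_mul]
    abel
  rw [h2, norm_neg]
  exact (norm_unitary_mul_le hu _).trans h1.le

theorem exists_paths_of_mem_closure_unitaryOrbitBH [TopologicalSpace.SeparableSpace A]
    [TopologicalSpace.SeparableSpace H] (hf : f ∈ closure (unitaryOrbitBH π)) :
    ∃ w : ℕ → ℝ → H →L[ℂ] H, (∀ n, Continuous (w n)) ∧
      (∀ n t, w n t ∈ unitary (H →L[ℂ] H)) ∧ (∀ n, w n 1 = w (n + 1) 0) ∧
      ∀ a, ∀ ε > 0, ∀ᶠ n in atTop, ∀ t, ‖w n t * f a - π a * w n t‖ ≤ ε := by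
  have := UniformSpace.secondCountable_of_separable A
  let d : ℕ → selfAdjoint A := TopologicalSpace.denseSeq (selfAdjoint A)
  have hb : ∀ l, star (f (d l)) = f (d l) := fun l => by
    rw [← map_star_of_mem_closure_unitaryOrbitBH hf, (d l).2.star_eq]
  have hc : ∀ l, star (π (d l)) = π (d l) := fun l => by
    rw [← map_star, (d l).2.star_eq]
  obtain ⟨T, hT⟩ := exists_approxIntertwines (fun l => f (d l)) (fun l => π (d l))
    fun m ε hε => exists_unitary_of_mem_closure_unitaryOrbitBH hf (fun l => (d l : A)) m hε
  obtain ⟨V, hV, hVV⟩ := hT.exists_partialIsometry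
  have hVV' : star V * star (star V) * star V = star V := by
    have := congrArg star hVV
    simpa [star_mul, mul_assoc] using this
  obtain ⟨S⟩ := nonempty_absorbingSequence_of_approxIntertwines hb hc hV hVV hV.mul_eq
  obtain ⟨S'⟩ := nonempty_absorbingSequence_of_approxIntertwines hc hb hV.star hVV' hV.star.mul_eq
  rw [star_star] at S'
  obtain ⟨w, hwc, hwu, hw1, hw⟩ := exists_intertwining_paths hb hc hVV hV.mul_eq S S'
  refine ⟨w, hwc, hwu, hw1, ?_⟩
  have hsa : ∀ a : selfAdjoint A, ∀ ε > 0, ∀ᶠ n in atTop, ∀ t,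
      ‖w n t * f a - π a * w n t‖ ≤ ε := by
    intro a ε hε
    obtain ⟨l, hl⟩ := (TopologicalSpace.denseRange_denseSeq (selfAdjoint A)).exists_dist_lt a
      (ε := ε / 3) (by positivity)
    have hl' : ‖(a : A) - d l‖ < ε / 3 := by
      rw [dist_eq_norm] at hl; exact hl
    obtain ⟨δ, hδ, hδw⟩ := hw l
    filter_upwards [hδ.eventually_le_const (show 0 < ε / 3 by positivity)] with n hn t
    have h1 : w n t * f a - π a * w n t = w n t * (f a - f (d l))
        + (w n t * f (d l) - π (d l) * w n t) - π ((a : A) - d l) * w n t := by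
      rw [map_sub]; noncomm_ring
    have h2 := (norm_unitary_mul_le (hwu n t) (f a - f (d l))).trans
      (norm_sub_le_of_mem_closure_unitaryOrbitBH hf _ _)
    have h3 := (norm_mul_unitary_le (hwu n t) (π ((a : A) - d l))).trans
      (NonUnitalStarAlgHom.norm_apply_le π _)
    have h4 := hδw n t
    rw [h1]
    refine (norm_sub_le _ _).trans ?_
    have := norm_add_le (w n t * (f a - f (d l))) (w n t * f (d l) - π (d l) * w n t)
    linarith
  intro a ε hε
  filter_upwards [hsa (realPart a) (ε / 2) (by positivity),
    hsa (imaginaryPart a) (ε / 2) (by positivity)] with n h1 h2 t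
  have h3 : w n t * f a - π a * w n t =
      (w n t * f (realPart a) - π (realPart a) * w n t)
      + Complex.I • (w n t * f (imaginaryPart a) - π (imaginaryPart a) * w n t) := by
    conv_lhs => rw [← realPart_add_I_smul_imaginaryPart a]
    rw [map_add_of_mem_closure_unitaryOrbitBH hf, map_smul_of_mem_closure_unitaryOrbitBH hf,
      map_add, map_smul, mul_add, add_mul, mul_smul_comm, smul_mul_assoc, smul_sub]
    abel
  rw [h3]
  refine (norm_add_le _ _).trans ?_
  rw [norm_smul, Complex.norm_I, one_mul]
  linarith [h1 t, h2 t]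

theorem joinedIn_closure_unitaryOrbitBH [TopologicalSpace.SeparableSpace A]
    [TopologicalSpace.SeparableSpace H] (hf : f ∈ closure (unitaryOrbitBH π))
    (hπ : (π : A → (H →L[ℂ] H)) ∈ closure (unitaryOrbitBH π)) :
    JoinedIn (closure (unitaryOrbitBH π)) f π := by
  obtain ⟨w, hwc, hwu, hw1, hw⟩ := exists_paths_of_mem_closure_unitaryOrbitBH hf
  let Φ : (H →L[ℂ] H) → A → (H →L[ℂ] H) := fun v a => v * f a * star v
  have hΦ : Continuous Φ := by fun_prop
  have hΦS : ∀ v ∈ unitary (H →L[ℂ] H), Φ v ∈ closure (unitaryOrbitBH π) := fun v hv =>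
    conj_mem_closure_unitaryOrbitBH hf hv
  have hstart : JoinedIn (closure (unitaryOrbitBH π)) f (Φ (w 0 0)) := by
    have h1 := ((joinedIn_unitary_one (w 0 0) (hwu 0 0)).map_continuousOn hΦ.continuousOn).mono
      (by rintro _ ⟨v, hv, rfl⟩; exact hΦS v hv)
    have h2 : Φ 1 = f := by funext a; simp [Φ]
    rw [h2] at h1
    exact h1.symm
  refine hstart.trans (joinedIn_of_tendsto_paths (fun n => Φ (w n 0)) _ (fun n =>
    { toFun := fun t => Φ (w n t)
      continuous_toFun := hΦ.comp ((hwc n).comp continuous_subtype_val)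
      source' := by simp
      target' := by simp [hw1] }) (fun n t => hΦS _ (hwu n t)) hπ ?_)
  have hlim : Tendsto (fun q : ℕ × unitInterval => Φ (w q.1 q.2)) (atTop ×ˢ ⊤) (𝓝 π) := by
    refine tendsto_pi_nhds.2 fun a => Metric.tendsto_nhds.2 fun ε hε => ?_
    refine mem_prod_top.2 ?_
    filter_upwards [hw a (ε / 2) (by positivity)] with n hn t
    have h1 : Φ (w n t) a - π a = (w n t * f a - π a * w n t) * star (w n t) := by
      rw [sub_mul, mul_assoc (π a), (Unitary.mem_iff.1 (hwu n t)).2, mul_one]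
    change dist (Φ (w n t) a) (π a) < ε
    rw [dist_eq_norm, h1]
    linarith [norm_mul_unitary_le (Unitary.star_mem (hwu n t)) (w n t * f a - π a * w n t), hn t]
  exact fun O hO => mem_prod_top.1 (hlim hO)

end Orbit

theorem stmt7 (A : Type*) [CStarAlgebra A] [TopologicalSpace.SeparableSpace A]
    (H : Type*) [NormedAddCommGroup H] [InnerProductSpace ℂ H] [CompleteSpace H]
    [TopologicalSpace.SeparableSpace H] (hinf : ¬ FiniteDimensional ℂ H)
    (π : A →⋆ₐ[ℂ] (H →L[ℂ] H)) :
    IsPathConnected (closure (unitaryOrbitBH π)) := by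
  have hπ : (π : A → (H →L[ℂ] H)) ∈ closure (unitaryOrbitBH π) :=
    subset_closure ⟨1, one_mem _, by simp⟩
  exact ⟨π, hπ, fun _ hf => (joinedIn_closure_unitaryOrbitBH hf hπ).symm⟩
end

section
/- Suppose A₁ ⊆ A₂ ⊆ ⋯ are unital C*-subalgebras of a separable unital C*-algebra A with A equal to the norm closure of ∪_{n∈ℕ} A_n, B is a unital C*-algebra, and π, ρ: A → B are unital *-homomorphisms such that for every n ∈ ℕ: (1) there is a unitary u_n ∈ B with u_n* ρ(a) u_n = π(a) for all a ∈ A_n, and (2) the unitary group of the relative commutant ρ(A_n)′ ∩ B is connected. Then there is a strong internal path from π to ρ; that is, there is a continuous map γ: [0,1) → U_B such that for every a ∈ A, ‖γ(t)* π(a) γ(t) − ρ(a)‖ → 0 as t → 1⁻. -/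
open Filter

/-- Countably many paths, the `n`-th one lying in `S n` for a decreasing sequence `S`, concatenate
to a path on `[0, ∞)` which eventually lies in every `S n`. -/
lemma exists_continuousOn_Ici_of_joinedIn {X : Type*} [TopologicalSpace X] {S : ℕ → Set X}
    (hS : Antitone S) {x : ℕ → X} (h : ∀ n, JoinedIn (S n) (x n) (x (n + 1))) :
    ∃ g : ℝ → X, ContinuousOn g (Set.Ici 0) ∧ ∀ n : ℕ, ∀ t : ℝ, n ≤ t → g t ∈ S n := by
  refine ⟨fun t => (h ⌊t⌋₊).somePath.extend (t - ⌊t⌋₊), ?_, fun n t ht => ?_⟩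
  · have hlf : LocallyFinite fun n : ℕ => Set.Icc (n : ℝ) (n + 1) := by
      have : LocallyFinite fun n : ℤ => Set.Icc (n : ℝ) (n + 1) :=
        locallyFinite_Icc_of_tendsto tendsto_intCast_atTop_atTop
          (tendsto_atBot_add_const_right _ _ (tendsto_intCast_atBot_iff.2 tendsto_id))
      simpa [Function.comp_def] using this.comp_injective Nat.cast_injective
    refine (hlf.continuousOn_iUnion (fun _ => isClosed_Icc) fun n => ?_).mono fun t ht =>
      Set.mem_iUnion.2 ⟨⌊t⌋₊, Nat.floor_le ht, (Nat.lt_floor_add_one t).le⟩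
    have hc : Continuous fun t : ℝ => (h n).somePath.extend (t - n) := by fun_prop
    refine hc.continuousOn.congr fun t ht => ?_
    rcases ht.2.lt_or_eq with hlt | rfl
    · obtain rfl : ⌊t⌋₊ = n := (Nat.floor_eq_iff (n.cast_nonneg.trans ht.1)).2 ⟨ht.1, hlt⟩
      rfl
    · have : ⌊(n : ℝ) + 1⌋₊ = n + 1 := by exact_mod_cast Nat.floor_natCast (R := ℝ) (n + 1)
      simp [this]
  · refine hS (Nat.le_floor ht) ?_
    beta_reduce
    rw [Path.extend_apply _ ⟨sub_nonneg.2 (Nat.floor_le (n.cast_nonneg.trans ht)), by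
      linarith [Nat.lt_floor_add_one t]⟩]
    exact (h _).somePath_mem _

/-- In a closed star subalgebra of a C⋆-algebra, unitaries are joined by a path of unitaries as
soon as the unitary group is connected. -/
lemma StarSubalgebra.isPathConnected_unitary {B : Type*} [CStarAlgebra B] (C : StarSubalgebra ℂ B)
    (hC : IsClosed (C : Set B)) (h : IsConnected {b : B | b ∈ unitary B ∧ b ∈ C}) :
    IsPathConnected {b : B | b ∈ unitary B ∧ b ∈ C} := by
  let f : unitary C → B := fun u => ((u : C) : B)
  have hf : Topology.IsInducing f :=
    Topology.IsInducing.subtypeVal.comp Topology.IsInducing.subtypeVal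
  have hrange : f '' Set.univ = {b : B | b ∈ unitary B ∧ b ∈ C} := by
    ext b
    constructor
    · rintro ⟨u, -, rfl⟩
      refine ⟨Unitary.mem_iff.2 ⟨?_, ?_⟩, (u : C).2⟩
      · exact congrArg Subtype.val (Unitary.mem_iff.1 u.2).1
      · exact congrArg Subtype.val (Unitary.mem_iff.1 u.2).2
    · rintro ⟨hb, hbC⟩
      exact ⟨⟨⟨b, hbC⟩, Unitary.mem_iff.2 ⟨Subtype.ext (Unitary.mem_iff.1 hb).1,
        Subtype.ext (Unitary.mem_iff.1 hb).2⟩⟩, trivial, rfl⟩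
  rw [← hrange] at h ⊢
  have : ConnectedSpace (unitary C) :=
    connectedSpace_iff_univ.2 ⟨Set.univ_nonempty, hf.isPreconnected_image.1 h.isPreconnected⟩
  have : PathConnectedSpace (unitary C) := pathConnectedSpace_iff_connectedSpace.2 this
  exact isPathConnected_univ.image hf.continuous

theorem stmt9 (A : Type*) [CStarAlgebra A] [TopologicalSpace.SeparableSpace A]
    (𝒜 : ℕ → StarSubalgebra ℂ A) (hmono : Monotone 𝒜)
    (hdense : closure (⋃ n, ((𝒜 n : Set A))) = Set.univ)
    (B : Type*) [CStarAlgebra B] (π ρ : A →⋆ₐ[ℂ] B)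
    (h1 : ∀ n : ℕ, ∃ u ∈ unitary B, ∀ a ∈ 𝒜 n, star u * ρ a * u = π a)
    (h2 : ∀ n : ℕ, IsConnected {b : B | (star b * b = 1 ∧ b * star b = 1) ∧
      ∀ a ∈ 𝒜 n, b * ρ a = ρ a * b}) :
    ∃ γ : ℝ → B, ContinuousOn γ (Set.Ico 0 1) ∧
      (∀ t ∈ Set.Ico (0 : ℝ) 1, γ t ∈ unitary B) ∧
      ∀ a : A, Tendsto (fun t => star (γ t) * π a * γ t)
        (nhdsWithin 1 (Set.Ico 0 1)) (nhds (ρ a)) := by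
  choose u hu huρ using h1
  let T : ℕ → Set B := fun n => {b | (star b * b = 1 ∧ b * star b = 1) ∧
    ∀ a ∈ 𝒜 n, b * ρ a = ρ a * b}
  let S : ℕ → Set B := fun n => {w | w ∈ unitary B ∧ ∀ a ∈ 𝒜 n, star w * π a * w = ρ a}
  have hT : ∀ n, IsPathConnected (T n) := fun n => by
    have hmem : T n = {b : B | b ∈ unitary B ∧
        b ∈ StarSubalgebra.centralizer ℂ (ρ '' (𝒜 n : Set A))} := by
      ext b
      simp only [T, Set.mem_ofPred_eq, Unitary.mem_iff, StarSubalgebra.mem_centralizer_iff,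
        Set.forall_mem_image, SetLike.mem_coe, ← map_star]
      exact and_congr_right fun _ => ⟨fun h a ha => ⟨(h a ha).symm, (h _ (star_mem ha)).symm⟩,
        fun h a ha => (h ha).1.symm⟩
    rw [hmem]
    exact StarSubalgebra.isPathConnected_unitary _ (Set.isClosed_centralizer _) (hmem ▸ h2 n)
  have hS : Antitone S := fun m n hmn w hw => ⟨hw.1, fun a ha => hw.2 a (hmono hmn ha)⟩
  have hjoin : ∀ n, JoinedIn (S n) (star (u n)) (star (u (n + 1))) := fun n => by
    have hun := Unitary.mem_iff.1 (hu n)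
    have hun' := Unitary.mem_iff.1 (hu (n + 1))
    have hone : (1 : B) ∈ T n := by simp [T]
    have hmul : u (n + 1) * star (u n) ∈ T n := by
      refine ⟨Unitary.mem_iff.1 (mul_mem (hu (n + 1)) (Unitary.star_mem (hu n))), fun a ha => ?_⟩
      have e1 := huρ n a ha
      have e2 := huρ (n + 1) a (hmono n.le_succ ha)
      calc u (n + 1) * star (u n) * ρ a
          = u (n + 1) * (star (u n) * ρ a * u n) * star (u n) := by simp [mul_assoc, hun.2]
        _ = u (n + 1) * (star (u (n + 1)) * ρ a * u (n + 1)) * star (u n) := by rw [e1, e2]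
        _ = (u (n + 1) * star (u (n + 1))) * ρ a * (u (n + 1) * star (u n)) := by noncomm_ring
        _ = ρ a * (u (n + 1) * star (u n)) := by rw [hun'.2, one_mul]
    have hpath := ((hT n).joinedIn _ hone _ hmul).map
      (f := fun p => star (u n) * star p) (by fun_prop)
    have hend : star (u n) * star (u (n + 1) * star (u n)) = star (u (n + 1)) := by
      rw [star_mul, star_star, ← mul_assoc, hun.1, one_mul]
    simp only [star_one, mul_one, hend] at hpath
    refine hpath.mono ?_
    rintro _ ⟨p, ⟨hp, hpρ⟩, rfl⟩
    refine ⟨mul_mem (Unitary.star_mem (hu n)) (Unitary.star_mem (Unitary.mem_iff.2 hp)),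
      fun a ha => ?_⟩
    calc star (star (u n) * star p) * π a * (star (u n) * star p)
        = p * (u n * star (u n)) * ρ a * (u n * star (u n)) * star p := by
          rw [← huρ n a ha, star_mul, star_star, star_star]; noncomm_ring
      _ = ρ a := by rw [hun.2, mul_one, mul_one, hpρ a ha, mul_assoc, hp.2, mul_one]
  obtain ⟨g, hg, hgS⟩ := exists_continuousOn_Ici_of_joinedIn hS hjoin
  have hnonneg : ∀ t ∈ Set.Ico (0 : ℝ) 1, 0 ≤ t / (1 - t) := fun t ht =>
    div_nonneg ht.1 (sub_nonneg.2 ht.2.le)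
  have hunit : ∀ t ∈ Set.Ico (0 : ℝ) 1, g (t / (1 - t)) ∈ unitary B := fun t ht =>
    (hgS 0 _ (by simpa using hnonneg t ht)).1
  refine ⟨fun t => g (t / (1 - t)), hg.comp (continuousOn_id.div (by fun_prop) fun t ht =>
    (sub_pos.2 ht.2).ne') hnonneg, hunit, fun a => ?_⟩
  have htop : Tendsto (fun t : ℝ => t / (1 - t)) (nhdsWithin 1 (Set.Ico 0 1)) atTop := by
    refine Tendsto.pos_mul_atTop one_pos (tendsto_id.mono_left nhdsWithin_le_nhds)
      (tendsto_inv_nhdsGT_zero.comp (tendsto_nhdsWithin_iff.2 ⟨?_, ?_⟩))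
    · have : Continuous fun t : ℝ => 1 - t := by fun_prop
      simpa using (this.tendsto 1).mono_left nhdsWithin_le_nhds
    · filter_upwards [self_mem_nhdsWithin] with t ht using sub_pos.2 ht.2
  rw [Metric.tendsto_nhds]
  intro ε hε
  obtain ⟨b, hb, hab⟩ := Metric.mem_closure_iff.1 (hdense ▸ Set.mem_univ a) (ε / 2) (half_pos hε)
  obtain ⟨n, hn⟩ := Set.mem_iUnion.1 hb
  filter_upwards [htop.eventually_ge_atTop (n : ℝ)] with t ht
  obtain ⟨hw, hwρ⟩ := hgS n _ ht
  generalize g (t / (1 - t)) = w at hw hwρ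
  have hsplit : star w * π a * w - ρ a = star w * π (a - b) * w - ρ (a - b) := by
    rw [map_sub, map_sub, ← hwρ b hn]; noncomm_ring
  rw [dist_eq_norm] at hab ⊢
  calc ‖star w * π a * w - ρ a‖ ≤ ‖star w * π (a - b) * w‖ + ‖ρ (a - b)‖ :=
        hsplit ▸ norm_sub_le _ _
    _ = ‖π (a - b)‖ + ‖ρ (a - b)‖ := by
        rw [CStarRing.norm_mul_mem_unitary _ hw,
          CStarRing.norm_mem_unitary_mul _ (Unitary.star_mem hw)]
    _ ≤ ‖a - b‖ + ‖a - b‖ :=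
        add_le_add (NonUnitalStarAlgHom.norm_apply_le π _) (NonUnitalStarAlgHom.norm_apply_le ρ _)
    _ < ε := by linarith
end

section
/- Suppose A is a separable unital AF C*-algebra (i.e., there is an increasing sequence A₁ ⊆ A₂ ⊆ ⋯ of finite-dimensional unital C*-subalgebras containing the unit whose union is dense in A), B is a unital C*-algebra with property HUC, and π ∈ Rep(A,B). Then the closure U_B(π)⁻ of the unitary orbit of π in the topology of pointwise norm convergence is path-connected. -/
/-- The unitary orbit of a unital *-homomorphism `π : A → B`, as a set of functions `A → B`
(with the topology of pointwise norm convergence, i.e. the product topology). -/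
def unitaryOrbit {A B : Type*} [CStarAlgebra A] [CStarAlgebra B] (π : A →⋆ₐ[ℂ] B) :
    Set (A → B) :=
  {f | ∃ u ∈ unitary B, f = fun a => star u * π a * u}

/-- Property HUC for a unital C*-algebra `B`: for every projection `p ∈ B`, the unitary
group of the corner `pBp` (with unit `p`) is connected. -/
def PropHUCAlg (B : Type*) [CStarAlgebra B] : Prop :=
  ∀ p : B, IsSelfAdjoint p → p * p = p →
    IsConnected {u : B | p * u * p = u ∧ star u * u = p ∧ u * star u = p}


/-- The trace of the left regular representation of a finite-dimensional algebra. -/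
noncomputable def regularTrace (F : Type*) [Ring F] [Algebra ℂ F] : F →ₗ[ℂ] ℂ :=
  LinearMap.trace ℂ F ∘ₗ (Algebra.lmul ℂ F).toLinearMap

section RegularTrace

variable {F : Type*} [CStarAlgebra F]

lemma regularTrace_mul_comm (x y : F) : regularTrace F (x * y) = regularTrace F (y * x) := by
  simp only [regularTrace, LinearMap.comp_apply, AlgHom.toLinearMap_apply, map_mul]
  exact LinearMap.trace_mul_comm _ _ _

lemma spectrum_lmul (x : F) : spectrum ℂ (Algebra.lmul ℂ F x) = spectrum ℂ x := by
  refine (AlgHom.spectrum_apply_subset _ _).antisymm fun z hz => ?_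
  rw [spectrum.mem_iff] at hz ⊢
  rwa [← AlgHom.commutes (Algebra.lmul ℂ F), ← map_sub, Algebra.lmul_isUnit_iff]

lemma spectrum_star_mul_self_re_nonneg (x : F) {z : ℂ} (hz : z ∈ spectrum ℂ (star x * x)) :
    0 ≤ z.re := by
  refine spectrum_star_mul_self_nonneg (b := x) z.re ?_
  have h := (IsSelfAdjoint.star_mul_self x).mem_spectrum_eq_re hz
  rw [← spectrum.algebraMap_mem_iff ℂ]
  rwa [h] at hz

variable [FiniteDimensional ℂ F]

lemma finite_spectrum_of_finiteDimensional (x : F) : (spectrum ℂ x).Finite := by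
  rw [← spectrum_lmul]
  exact Module.End.finite_spectrum _

/-- The regular trace of `x` is a sum over a multiset whose members are the spectral values. -/
lemma exists_multiset_sum_eq_regularTrace (x : F) :
    ∃ s : Multiset ℂ, regularTrace F x = s.sum ∧ ∀ z, z ∈ s ↔ z ∈ spectrum ℂ x := by
  refine ⟨(Algebra.lmul ℂ F x).charpoly.roots,
    Module.End.trace_eq_sum_roots_charpoly_of_splits (IsAlgClosed.splits _), fun z => ?_⟩
  rw [Polynomial.mem_roots (LinearMap.charpoly_monic _).ne_zero,
    ← Module.End.mem_spectrum_iff_isRoot_charpoly, spectrum_lmul]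

lemma IsSelfAdjoint.regularTrace_im {x : F} (hx : IsSelfAdjoint x) :
    (regularTrace F x).im = 0 := by
  obtain ⟨s, hs, hmem⟩ := exists_multiset_sum_eq_regularTrace x
  rw [hs, ← Complex.coe_imAddGroupHom, map_multiset_sum]
  refine Multiset.sum_eq_zero fun r hr => ?_
  obtain ⟨z, hz, rfl⟩ := Multiset.mem_map.1 hr
  exact hx.im_eq_zero_of_mem_spectrum ((hmem z).1 hz)

lemma regularTrace_star (x : F) : regularTrace F (star x) = star (regularTrace F x) := by
  have h1 := (IsSelfAdjoint.add_star_self x).regularTrace_im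
  have h2 : (regularTrace F (Complex.I • (x - star x))).im = 0 := by
    refine IsSelfAdjoint.regularTrace_im ?_
    rw [IsSelfAdjoint, star_smul, star_sub, star_star, ← neg_sub x (star x), smul_neg,
      ← neg_smul]
    simp
  simp only [map_add, map_smul, map_sub, smul_eq_mul, Complex.add_im, Complex.mul_im,
    Complex.sub_re, Complex.sub_im, Complex.I_re, Complex.I_im] at h1 h2
  apply Complex.ext
  · simp; linarith
  · simp; linarith

lemma regularTrace_star_mul_self_re_nonneg (x : F) : 0 ≤ (regularTrace F (star x * x)).re := by
  obtain ⟨s, hs, hmem⟩ := exists_multiset_sum_eq_regularTrace (star x * x)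
  rw [hs, ← Complex.coe_reAddGroupHom, map_multiset_sum]
  refine Multiset.sum_nonneg fun r hr => ?_
  obtain ⟨z, hz, rfl⟩ := Multiset.mem_map.1 hr
  exact spectrum_star_mul_self_re_nonneg x ((hmem z).1 hz)

lemma eq_zero_of_regularTrace_star_mul_self {x : F} (h : regularTrace F (star x * x) = 0) :
    x = 0 := by
  obtain ⟨s, hs, hmem⟩ := exists_multiset_sum_eq_regularTrace (star x * x)
  have hre : ((s.map Complex.reAddGroupHom).sum) = 0 := by
    rw [← map_multiset_sum, ← hs, h, map_zero]
  have hnonneg : ∀ r ∈ s.map Complex.reAddGroupHom, 0 ≤ r := fun r hr => by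
    obtain ⟨z, hz, rfl⟩ := Multiset.mem_map.1 hr
    exact spectrum_star_mul_self_re_nonneg x ((hmem z).1 hz)
  have hzero := Multiset.all_zero_of_le_zero_le_of_sum_eq_zero hnonneg hre
  have hsa := IsSelfAdjoint.star_mul_self x
  have hsp : spectrum ℂ (star x * x) ⊆ {0} := fun z hz => by
    rw [Set.mem_singleton_iff, hsa.mem_spectrum_eq_re hz]
    exact_mod_cast hzero _ (Multiset.mem_map_of_mem Complex.reAddGroupHom ((hmem z).2 hz))
  have : star x * x = 0 := by
    have := hsa.isStarNormal
    exact CFC.eq_zero_of_spectrum_subset_zero (R := ℂ) (p := IsStarNormal) _ hsp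
  exact CStarRing.star_mul_self_eq_zero_iff x |>.1 this

end RegularTrace

/-- Gram-Schmidt for an inner product that need not induce the ambient norm. -/
lemma InnerProductSpace.Core.exists_orthonormal_basis {V : Type*} [AddCommGroup V] [Module ℂ V]
    [FiniteDimensional ℂ V] (c : InnerProductSpace.Core ℂ V) :
    ∃ (n : ℕ) (b : Module.Basis (Fin n) ℂ V), ∀ i j, c.inner (b i) (b j) = if i = j then 1 else 0 := by
  let := c.toNormedAddCommGroup
  let : InnerProductSpace ℂ V := InnerProductSpace.ofCore c.toCore
  exact ⟨_, (stdOrthonormalBasis ℂ V).toBasis, fun i j => by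
    simpa using orthonormal_iff_ite.1 (stdOrthonormalBasis ℂ V).orthonormal i j⟩

/-- The defining property of the Casimir element: `∑ xᵢ ⊗ xᵢ*` commutes with the algebra. -/
def IsCasimir {F : Type*} [CStarAlgebra F] {n : ℕ} (x : Fin n → F) : Prop :=
  ∀ a, ∃ c : Fin n → Fin n → ℂ, (∀ i, a * x i = ∑ j, c j i • x j) ∧
    ∀ j, star (x j) * a = ∑ i, c j i • star (x i)

/-- A finite-dimensional C*-algebra has a self-adjoint separability system: a finite family whose
Casimir element `∑ xᵢ ⊗ xᵢ*` commutes with the algebra, and which multiplies out to `1`. -/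
lemma exists_casimir (F : Type*) [CStarAlgebra F] [FiniteDimensional ℂ F] :
    ∃ (n : ℕ) (x : Fin n → F),
      IsCasimir x ∧ ∑ i, x i * star (x i) = 1 ∧ Submodule.span ℂ (Set.range x) = ⊤ := by
  let core : InnerProductSpace.Core ℂ F :=
    { inner := fun x y => regularTrace F (star x * y)
      conj_inner_symm := fun x y => by
        change star (regularTrace F (star y * x)) = _
        rw [← regularTrace_star, star_mul, star_star]
      re_inner_nonneg := regularTrace_star_mul_self_re_nonneg
      add_left := fun x y z => by simp [add_mul]
      smul_left := fun x y r => by simp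
      definite := fun x hx => eq_zero_of_regularTrace_star_mul_self hx }
  obtain ⟨n, b, hb⟩ := core.exists_orthonormal_basis
  replace hb : ∀ i j, regularTrace F (star (b i) * b j) = if i = j then 1 else 0 := hb
  have hrepr : ∀ y j, b.repr y j = regularTrace F (star (b j) * y) := fun y j => by
    conv_rhs => rw [← b.sum_repr y, Finset.mul_sum, map_sum]
    simp only [mul_smul_comm, map_smul, hb]
    simp
  have hexp : ∀ y, y = ∑ j, regularTrace F (star (b j) * y) • b j := fun y => by
    conv_lhs => rw [← b.sum_repr y]
    simp [hrepr]
  have htr : ∀ a, regularTrace F a = ∑ i, regularTrace F (star (b i) * (a * b i)) := fun a => by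
    rw [regularTrace, LinearMap.comp_apply, LinearMap.trace_eq_matrix_trace ℂ b, Matrix.trace]
    refine Finset.sum_congr rfl fun i _ => ?_
    simp [LinearMap.toMatrix_apply, hrepr, regularTrace]
  refine ⟨n, b, fun a => ⟨fun j i => regularTrace F (star (b j) * (a * b i)),
    fun i => hexp _, fun j => ?_⟩, ?_, b.span_eq⟩
  · have h := congrArg star (hexp (star a * b j))
    simp only [star_mul, star_star, star_sum, star_smul, ← regularTrace_star] at h
    rw [h]
    simp only [mul_assoc]
  · refine sub_eq_zero.1 (eq_zero_of_regularTrace_star_mul_self ?_)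
    generalize star (∑ i, b i * star (b i) - 1) = y
    rw [mul_sub, map_sub, mul_one, htr y, Finset.mul_sum, map_sum, sub_eq_zero]
    refine Finset.sum_congr rfl fun i _ => ?_
    rw [← mul_assoc, regularTrace_mul_comm]

section Casimir

variable {F B : Type*} [CStarAlgebra F] [CStarAlgebra B] {n : ℕ} {x : Fin n → F}

lemma IsCasimir.intertwine (hx : IsCasimir x) (φ ψ : F →⋆ₐ[ℂ] B) (b : B) (a : F) :
    φ a * ∑ i, φ (x i) * b * ψ (star (x i)) = (∑ i, φ (x i) * b * ψ (star (x i))) * ψ a := by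
  obtain ⟨c, h1, h2⟩ := hx a
  simp only [Finset.mul_sum, Finset.sum_mul]
  calc ∑ i, φ a * (φ (x i) * b * ψ (star (x i)))
      = ∑ i, φ (a * x i) * b * ψ (star (x i)) := by simp [mul_assoc]
    _ = ∑ i, ∑ j, c j i • (φ (x j) * b * ψ (star (x i))) := by
      simp only [h1, map_sum, map_smul, Finset.sum_mul, smul_mul_assoc]
    _ = ∑ j, ∑ i, c j i • (φ (x j) * b * ψ (star (x i))) := Finset.sum_comm
    _ = ∑ j, φ (x j) * b * ψ (star (x j) * a) := by
      simp only [h2, map_sum, map_smul, Finset.mul_sum, mul_smul_comm]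
    _ = _ := by simp [mul_assoc]

/-- Polar decomposition of an invertible element. -/
lemma exists_unitary_polar {z : B} (hz : IsUnit z) :
    ∃ t, z * t ∈ unitary B ∧ ∀ y, Commute y (star z * z) → Commute y t := by
  let _ : PartialOrder B := CStarAlgebra.spectralOrder B
  have _ : StarOrderedRing B := CStarAlgebra.spectralOrderedRing B
  have hnn : 0 ≤ star z * z := star_mul_self_nonneg z
  have hss : CFC.sqrt (star z * z) * CFC.sqrt (star z * z) = star z * z :=
    CFC.sqrt_mul_sqrt_self _ hnn
  have hssa : IsSelfAdjoint (CFC.sqrt (star z * z)) := (CFC.sqrt_nonneg _).isSelfAdjoint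
  have hsc : ∀ y, Commute y (star z * z) → Commute y (CFC.sqrt (star z * z)) := fun y hy => by
    rw [CFC.sqrt_eq_cfc]
    exact (hy.symm.cfc_nnreal _).symm
  have hsu : IsUnit (CFC.sqrt (star z * z)) :=
    (CFC.isUnit_sqrt_iff _ hnn).2 (hz.star.mul hz)
  obtain ⟨s, hs⟩ := hsu
  rw [← hs] at hss hssa hsc
  have hst : star (↑s⁻¹ : B) = ↑s⁻¹ := by
    have h : star s = s := Units.ext hssa
    rw [← Units.coe_star, star_inv, h]
  refine ⟨↑s⁻¹, ?_, fun y hy => (hsc y hy).units_inv_right⟩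
  have hleft : star (z * ↑s⁻¹) * (z * ↑s⁻¹) = 1 := by
    rw [star_mul, hst]
    calc (↑s⁻¹ : B) * star z * (z * ↑s⁻¹) = ↑s⁻¹ * (star z * z) * ↑s⁻¹ := by simp only [mul_assoc]
      _ = 1 := by rw [← hss]; simp
  refine Unitary.mem_iff.2 ⟨hleft, ?_⟩
  obtain ⟨v, hv⟩ := hz.mul s⁻¹.isUnit
  rw [← hv] at hleft ⊢
  have hinv : star (v : B) = ↑v⁻¹ := Units.eq_inv_of_mul_eq_one_right hleft
  rw [hinv, Units.mul_inv]

/-- Two unital *-homomorphisms whose averaged intertwiner is close to `1` are unitarily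
equivalent. -/
lemma IsCasimir.exists_unitary_conj (hx : IsCasimir x) (φ ψ : F →⋆ₐ[ℂ] B)
    (h : ‖∑ i, φ (x i) * ψ (star (x i)) - 1‖ < 1) :
    ∃ w ∈ unitary B, ∀ a, φ a * w = w * ψ a := by
  set z := ∑ i, φ (x i) * ψ (star (x i)) with hzdef
  have hint : ∀ a, φ a * z = z * ψ a := fun a => by
    simpa [hzdef] using hx.intertwine φ ψ 1 a
  have hz : IsUnit z := by
    have := isUnit_one_sub_of_norm_lt_one (x := 1 - z) (by rwa [norm_sub_rev])
    simpa using this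
  obtain ⟨t, htu, ht⟩ := exists_unitary_polar hz
  refine ⟨z * t, htu, fun a => ?_⟩
  have hcomm : Commute (ψ a) (star z * z) := by
    have h2 : star z * φ a = ψ a * star z := by
      have := congrArg star (hint (star a))
      simpa [map_star] using this
    calc ψ a * (star z * z) = star z * (φ a * z) := by rw [← mul_assoc, ← h2, mul_assoc]
      _ = star z * z * ψ a := by rw [hint, mul_assoc]
  rw [← mul_assoc, hint, mul_assoc, (ht _ hcomm).eq, mul_assoc]

/-- The (unnormalised) averaging map onto the commutant of the range of `φ`. -/
def casimirAvg (x : Fin n → F) (φ : F →⋆ₐ[ℂ] B) (b : B) : B :=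
  ∑ i, φ (x i) * b * φ (star (x i))

lemma IsCasimir.commute_avg (hx : IsCasimir x) (φ : F →⋆ₐ[ℂ] B) (a : F) (b : B) :
    Commute (φ a) (casimirAvg x φ b) :=
  hx.intertwine φ φ b a

lemma star_casimirAvg (φ : F →⋆ₐ[ℂ] B) (b : B) :
    star (casimirAvg x φ b) = casimirAvg x φ (star b) := by
  simp [casimirAvg, star_sum, map_star, mul_assoc]

lemma casimirAvg_mul_right (φ : F →⋆ₐ[ℂ] B) {d : B} (hd : ∀ a, Commute (φ a) d) (b : B) :
    casimirAvg x φ (b * d) = casimirAvg x φ b * d := by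
  simp only [casimirAvg, Finset.sum_mul, mul_assoc]
  exact Finset.sum_congr rfl fun i _ => by rw [(hd _).eq]

lemma casimirAvg_mul_left (φ : F →⋆ₐ[ℂ] B) {d : B} (hd : ∀ a, Commute (φ a) d) (b : B) :
    casimirAvg x φ (d * b) = d * casimirAvg x φ b := by
  simp only [casimirAvg, Finset.mul_sum, ← mul_assoc]
  exact Finset.sum_congr rfl fun i _ => by rw [(hd _).eq]

lemma casimirAvg_smul (φ : F →⋆ₐ[ℂ] B) (k : ℝ) (b : B) :
    casimirAvg x φ (k • b) = k • casimirAvg x φ b := by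
  simp [casimirAvg, Finset.smul_sum]

lemma continuous_casimirAvg (φ : F →⋆ₐ[ℂ] B) : Continuous (casimirAvg x φ) := by
  unfold casimirAvg
  fun_prop

lemma casimirAvg_map (φ : F →⋆ₐ[ℂ] B) (a : F) :
    casimirAvg x φ (φ a) = φ (casimirAvg x (StarAlgHom.id ℂ F) a) := by
  simp [casimirAvg]

/-- A nonzero projection `e` with one-dimensional corner `eFe = ℂe`. -/
structure IsMinimalProjection (e : F) : Prop where
  isSelfAdjoint : IsSelfAdjoint e
  mul_self : e * e = e
  ne_zero : e ≠ 0
  exists_smul : ∀ a, ∃ k : ℂ, e * a * e = k • e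

lemma IsMinimalProjection.sum_norm_sq_ne_zero {e : F} (he : IsMinimalProjection e)
    (hspan : Submodule.span ℂ (Set.range x) = ⊤) {l : Fin n → ℂ}
    (hl : ∀ i, e * x i * e = l i • e) : ∑ i, ‖l i‖ ^ 2 ≠ 0 := by
  intro h0
  rw [Finset.sum_eq_zero_iff_of_nonneg fun i _ => by positivity] at h0
  have hker : Submodule.span ℂ (Set.range x) ≤
      LinearMap.ker (LinearMap.mulRight ℂ e ∘ₗ LinearMap.mulLeft ℂ e) := by
    rw [Submodule.span_le]
    rintro _ ⟨i, rfl⟩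
    have : l i = 0 := by simpa using h0 i (Finset.mem_univ i)
    simp [hl, this]
  have h1 : (1 : F) ∈ LinearMap.ker (LinearMap.mulRight ℂ e ∘ₗ LinearMap.mulLeft ℂ e) :=
    hker (hspan ▸ Submodule.mem_top)
  exact he.ne_zero (by simpa [he.mul_self] using h1)

lemma IsCasimir.avg_mul_minimalProjection (hx : IsCasimir x) {e : F} (he : IsMinimalProjection e)
    {l : Fin n → ℂ} (hl : ∀ i, e * x i * e = l i • e) (φ : F →⋆ₐ[ℂ] B) {b : B}
    (hb : φ e * b * φ e = b) : casimirAvg x φ b * φ e = (∑ i, ‖l i‖ ^ 2 : ℝ) • b := by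
  have hpp : φ e * φ e = φ e := by rw [← map_mul, he.mul_self]
  have hstar : ∀ i, e * star (x i) * e = star (l i) • e := fun i => by
    have := congrArg star (hl i)
    simpa [he.isSelfAdjoint.star_eq, mul_assoc] using this
  calc casimirAvg x φ b * φ e = φ e * casimirAvg x φ b * φ e := by
        rw [(hx.commute_avg φ e b).eq, mul_assoc, hpp]
    _ = ∑ i, φ e * (φ (x i) * (φ e * b * φ e) * φ (star (x i))) * φ e := by
        rw [hb, casimirAvg, Finset.mul_sum, Finset.sum_mul]
    _ = ∑ i, φ (e * x i * e) * b * φ (e * star (x i) * e) := by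
        simp only [map_mul, mul_assoc]
    _ = ∑ i, ‖l i‖ ^ 2 • (φ e * b * φ e) := by
        refine Finset.sum_congr rfl fun i _ => ?_
        rw [hl, hstar, map_smul, map_smul, smul_mul_assoc, smul_mul_assoc, mul_smul_comm,
          smul_smul, ← Complex.coe_smul, Complex.ofReal_pow, ← Complex.mul_conj']
        rfl
    _ = _ := by rw [hb, ← Finset.sum_smul]

lemma IsCasimir.avg_mul_avg (hx : IsCasimir x) {e : F} (he : IsMinimalProjection e)
    {l : Fin n → ℂ} (hl : ∀ i, e * x i * e = l i • e) (φ : F →⋆ₐ[ℂ] B) {b c : B}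
    (hb : b * φ e = b) (hc : φ e * c * φ e = c) :
    casimirAvg x φ b * casimirAvg x φ c = (∑ i, ‖l i‖ ^ 2 : ℝ) • casimirAvg x φ (b * c) := by
  rw [← casimirAvg_mul_right φ (fun a => hx.commute_avg φ a c)]
  nth_rw 1 [← hb]
  rw [mul_assoc, (hx.commute_avg φ e c).eq, hx.avg_mul_minimalProjection he hl φ hc,
    mul_smul_comm, casimirAvg_smul]

end Casimir

section MinimalProjection

variable {F : Type*} [CStarAlgebra F] [FiniteDimensional ℂ F]

/-- Below every nonzero projection there is a minimal one. -/
lemma exists_isMinimalProjection {r : F} (hr : IsSelfAdjoint r) (hrr : r * r = r) (hr0 : r ≠ 0) :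
    ∃ e : F, IsMinimalProjection e ∧ r * e = e := by
  let S : Set F := {e | IsSelfAdjoint e ∧ e * e = e ∧ e ≠ 0 ∧ r * e = e}
  obtain ⟨e, ⟨hsa, hee, he0, hre⟩, hmin⟩ := (InvImage.wf
    (fun e : F => LinearMap.range (LinearMap.mulLeft ℂ e))
    (wellFounded_lt (α := Submodule ℂ F))).has_min S ⟨r, hr, hrr, hr0, hrr⟩
  have hmin' : ∀ p : F, IsSelfAdjoint p → p * p = p → p ≠ 0 → e * p = p → p = e := by
    intro p hp hpp hp0 hep
    have hle : LinearMap.range (LinearMap.mulLeft ℂ p) ≤ LinearMap.range (LinearMap.mulLeft ℂ e) := by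
      rintro _ ⟨y, rfl⟩
      exact ⟨p * y, by simp [← mul_assoc, hep]⟩
    have hnlt := hmin p ⟨hp, hpp, hp0, by rw [← hep, ← mul_assoc, hre]⟩
    have heq := hle.eq_of_not_lt hnlt
    obtain ⟨y, hy⟩ : e ∈ LinearMap.range (LinearMap.mulLeft ℂ p) := by
      rw [heq]
      exact ⟨1, by simp⟩
    have hpe : p * e = e := by
      rw [← hy, LinearMap.mulLeft_apply, ← mul_assoc, hpp]
    have := congrArg star hpe
    rw [star_mul, hp.star_eq, hsa.star_eq, hep] at this
    exact this
  have hself : ∀ h : F, IsSelfAdjoint h → ∃ k : ℂ, e * h * e = k • e := by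
    intro a ha
    set h := e * a * e with hdef
    have hh : IsSelfAdjoint h := by
      rw [IsSelfAdjoint, hdef, star_mul, star_mul, hsa.star_eq, ha.star_eq, mul_assoc]
    have heh : e * h = h := by rw [hdef, ← mul_assoc, ← mul_assoc, hee]
    by_cases h0 : h = 0
    · exact ⟨0, by simp [h0]⟩
    have hfin : (spectrum ℝ h).Finite := by
      refine Set.Finite.of_finite_image (f := Complex.ofReal) ?_ Complex.ofReal_injective.injOn
      refine (finite_spectrum_of_finiteDimensional h).subset ?_
      rintro _ ⟨t, ht, rfl⟩
      exact (spectrum.algebraMap_mem_iff ℂ).2 ht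
    have hcont : ∀ f : ℝ → ℝ, ContinuousOn f (spectrum ℝ h) := fun f => hfin.continuousOn f
    obtain ⟨μ, hμ, hμ0⟩ : ∃ μ ∈ spectrum ℝ h, μ ≠ 0 := by
      by_contra! hall
      exact h0 (CFC.eq_zero_of_spectrum_subset_zero (R := ℝ) (p := IsSelfAdjoint) h hall)
    let δ : ℝ → ℝ := fun t => if t = μ then 1 else 0
    have hhp : h * cfc δ h = μ • cfc δ h := by
      nth_rw 1 [← cfc_id' ℝ h]
      rw [← cfc_mul _ _ h (hcont _) (hcont _), ← cfc_smul _ _ h (hcont _)]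
      refine cfc_congr fun t _ => ?_
      by_cases ht : t = μ <;> simp [δ, ht]
    have hpe : cfc δ h = e := by
      refine hmin' _ (cfc_predicate δ h) ?_ ?_ ?_
      · rw [← cfc_mul _ _ h (hcont _) (hcont _)]
        refine cfc_congr fun t _ => ?_
        by_cases ht : t = μ <;> simp [δ, ht]
      · intro hzero
        have h1 : (1 : ℝ) ∈ spectrum ℝ (cfc δ h) := by
          rw [cfc_map_spectrum δ h hh (hcont _)]
          exact ⟨μ, hμ, by simp [δ]⟩
        rw [hzero] at h1
        have _ : Nontrivial F := ⟨⟨e, 0, he0⟩⟩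
        simp at h1
      · have : cfc δ h = μ⁻¹ • (h * cfc δ h) := by rw [hhp, smul_smul, inv_mul_cancel₀ hμ0, one_smul]
        rw [this, mul_smul_comm, ← mul_assoc, heh]
    refine ⟨μ, ?_⟩
    rw [hpe] at hhp
    have : h * e = h := by rw [hdef, mul_assoc, hee]
    rw [this] at hhp
    rw [hhp, Complex.coe_smul]
  refine ⟨e, ⟨hsa, hee, he0, fun a => ?_⟩, hre⟩
  obtain ⟨k₁, h₁⟩ := hself (realPart a) (realPart a).2
  obtain ⟨k₂, h₂⟩ := hself (imaginaryPart a) (imaginaryPart a).2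
  refine ⟨k₁ + Complex.I * k₂, ?_⟩
  conv_lhs => rw [← realPart_add_I_smul_imaginaryPart a]
  rw [mul_add, add_mul, h₁, mul_smul_comm, smul_mul_assoc, h₂, smul_smul, add_smul]

end MinimalProjection

section Commutant

variable {F B : Type*} [CStarAlgebra F] [CStarAlgebra B]

/-- The commutant of the range of `φ`. -/
abbrev commutant (φ : F →⋆ₐ[ℂ] B) : StarSubalgebra ℂ B :=
  StarSubalgebra.centralizer ℂ (Set.range φ)

lemma mem_commutant_iff {φ : F →⋆ₐ[ℂ] B} {d : B} :
    d ∈ commutant φ ↔ ∀ a, Commute (φ a) d := by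
  rw [StarSubalgebra.mem_centralizer_iff]
  refine ⟨fun h a => (h _ ⟨a, rfl⟩).1, ?_⟩
  rintro h _ ⟨a, rfl⟩
  exact ⟨h a, by rw [← map_star]; exact h _⟩

instance isClosed_commutant (φ : F →⋆ₐ[ℂ] B) : IsClosed (commutant φ : Set B) :=
  Set.isClosed_centralizer _

/-- Unitaries of the commutant of `φ` that agree off the central projection `q` lie in the same
connected component. -/
def ConnectedUnder (φ : F →⋆ₐ[ℂ] B) (q : F) : Prop :=
  ∀ g h : unitary (commutant φ), ((1 - φ q) * (g : B) = (1 - φ q) * (h : B)) →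
    h ∈ connectedComponent g

lemma mk_mem_unitary_commutant {φ : F →⋆ₐ[ℂ] B} {d : B} (hd : d ∈ unitary B)
    (hc : d ∈ commutant φ) : (⟨d, hc⟩ : commutant φ) ∈ unitary (commutant φ) :=
  Unitary.mem_iff.2 ⟨Subtype.ext (Unitary.mem_iff.1 hd).1, Subtype.ext (Unitary.mem_iff.1 hd).2⟩

lemma coe_mem_unitary {φ : F →⋆ₐ[ℂ] B} (g : unitary (commutant φ)) : (g : B) ∈ unitary B :=
  Unitary.mem_iff.2 ⟨congrArg Subtype.val (Unitary.mem_iff.1 g.2).1,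
    congrArg Subtype.val (Unitary.mem_iff.1 g.2).2⟩

/-- Gluing two unitaries along a projection commuting with both. -/
lemma glue_mem_unitary {p u s : B} (hp : IsSelfAdjoint p) (hpp : p * p = p)
    (hu : u ∈ unitary B) (hpu : Commute p u) (hs1 : star s * s = p) (hs2 : s * star s = p)
    (hps : p * s = s) (hsp : s * p = s) : (1 - p) * u + s ∈ unitary B := by
  have hps' : p * star s = star s := by simpa [hp.star_eq] using congrArg star hsp
  have hsp' : star s * p = star s := by simpa [hp.star_eq] using congrArg star hps
  have hpu' : Commute p (star u) := by simpa [hp.star_eq] using hpu.star_star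
  obtain ⟨h1, h2⟩ := Unitary.mem_iff.1 hu
  have hq : (1 - p) * (1 - p) = 1 - p := by simp [mul_sub, sub_mul, hpp]
  have hqu : Commute (1 - p) u := (Commute.one_left u).sub_left hpu
  have hqu' : Commute (1 - p) (star u) := (Commute.one_left _).sub_left hpu'
  have hqs : (1 - p) * s = 0 := by rw [sub_mul, one_mul, hps, sub_self]
  have hsq : s * (1 - p) = 0 := by rw [mul_sub, mul_one, hsp, sub_self]
  have hqs' : (1 - p) * star s = 0 := by rw [sub_mul, one_mul, hps', sub_self]
  have hsq' : star s * (1 - p) = 0 := by rw [mul_sub, mul_one, hsp', sub_self]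
  have hstar : star ((1 - p) * u + s) = star u * (1 - p) + star s := by
    simp [hp.star_eq]
  refine Unitary.mem_iff.2 ⟨?_, ?_⟩
  · rw [hstar]
    calc (star u * (1 - p) + star s) * ((1 - p) * u + s)
        = star u * ((1 - p) * (1 - p)) * u + star u * ((1 - p) * s) + star s * (1 - p) * u
            + star s * s := by noncomm_ring
      _ = 1 := by rw [hq, hqs, hsq', hs1, ← hqu'.eq, mul_assoc, h1]; simp
  · rw [hstar, hqu.eq]
    calc (u * (1 - p) + s) * (star u * (1 - p) + star s)
        = (u * (1 - p) + s) * ((1 - p) * star u + star s) := by rw [hqu'.eq]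
      _ = u * ((1 - p) * (1 - p)) * star u + u * ((1 - p) * star s) + s * (1 - p) * star u
            + s * star s := by noncomm_ring
      _ = 1 := by rw [hq, hqs', hsq, hs2, ← hqu.eq, mul_assoc, h2]; simp

/-- The central support of a minimal projection supports a copy of its corner in the commutant, so
property HUC connects unitaries of the commutant that agree off that support. -/
lemma exists_central_support {n : ℕ} {x : Fin n → F} (hx : IsCasimir x)
    (hspan : Submodule.span ℂ (Set.range x) = ⊤) (hB : PropHUCAlg B) (φ : F →⋆ₐ[ℂ] B)
    {e : F} (he : IsMinimalProjection e) :
    ∃ z : F, IsSelfAdjoint z ∧ z * z = z ∧ (∀ a, Commute a z) ∧ z ≠ 0 ∧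
      (∀ r, (∀ a, Commute a r) → r * e = e → r * z = z) ∧ ConnectedUnder φ z := by
  choose l hl using fun i => he.exists_smul (x i)
  have hk0 := he.sum_norm_sq_ne_zero hspan hl
  set k : ℝ := ∑ i, ‖l i‖ ^ 2 with hk
  have hpp : φ e * φ e = φ e := by rw [← map_mul, he.mul_self]
  have hpsa : star (φ e) = φ e := by rw [← map_star, he.isSelfAdjoint.star_eq]
  have hid : ∀ a : F, StarAlgHom.id ℂ F a = a := fun _ => rfl
  have heee : StarAlgHom.id ℂ F e * e * StarAlgHom.id ℂ F e = e := by
    simp [hid, he.mul_self]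
  set z : F := k⁻¹ • casimirAvg x (StarAlgHom.id ℂ F) e with hz
  have hze : z * e = e := by
    have := hx.avg_mul_minimalProjection he hl (StarAlgHom.id ℂ F) heee
    rw [hid, ← hk] at this
    rw [hz, smul_mul_assoc, this, inv_smul_smul₀ hk0]
  have hzsa : IsSelfAdjoint z := by
    rw [IsSelfAdjoint, hz, star_smul, star_casimirAvg, he.isSelfAdjoint.star_eq, star_trivial]
  have hzz : z * z = z := by
    have := hx.avg_mul_avg he hl (StarAlgHom.id ℂ F) (b := e) he.mul_self heee
    rw [← hk, he.mul_self] at this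
    rw [hz, smul_mul_smul_comm, this, mul_smul, inv_smul_smul₀ hk0]
  have hzc : ∀ a, Commute a z := fun a =>
    (hx.commute_avg (StarAlgHom.id ℂ F) a e).smul_right _
  refine ⟨z, hzsa, hzz, hzc, fun h0 => he.ne_zero (by rw [← hze, h0, zero_mul]),
    fun r hr hre => ?_, fun g h hgh => ?_⟩
  · rw [hz, mul_smul_comm, ← casimirAvg_mul_left _ hr, hre]
  have hφz : φ z = k⁻¹ • casimirAvg x φ (φ e) := by
    rw [hz, casimirAvg_map, ← Complex.coe_smul, map_smul, Complex.coe_smul]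
  have hZsa : IsSelfAdjoint (φ z) := hzsa.map φ
  have hZZ : φ z * φ z = φ z := by rw [← map_mul, hzz]
  have hcom : ∀ u : unitary (commutant φ), ∀ a, Commute (φ a) (u : B) := fun u =>
    mem_commutant_iff.1 (u : commutant φ).2
  let S : Set B := {u : B | φ e * u * φ e = u ∧ star u * u = φ e ∧ u * star u = φ e}
  have hS : IsConnected S := hB (φ e) hpsa hpp
  have hSmul : ∀ b c : B, b * φ e = b → φ e * c * φ e = c →
      (k⁻¹ • casimirAvg x φ b) * (k⁻¹ • casimirAvg x φ c) = k⁻¹ • casimirAvg x φ (b * c) := by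
    intro b c hb hc
    rw [smul_mul_smul_comm, hx.avg_mul_avg he hl φ hb hc, ← hk, mul_smul, inv_smul_smul₀ hk0]
  have hΘu : ∀ s ∈ S, (1 - φ z) * (g : B) + k⁻¹ • casimirAvg x φ s ∈ unitary B := by
    rintro s ⟨hs, hs1, hs2⟩
    have hsr : s * φ e = s := by rw [← hs, mul_assoc, hpp]
    have hsl : φ e * s = s := by rw [← hs, ← mul_assoc, ← mul_assoc, hpp]
    have hs' : φ e * star s * φ e = star s := by
      simpa [hpsa, mul_assoc] using congrArg star hs
    have hsr' : star s * φ e = star s := by simpa [hpsa] using congrArg star hsl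
    have hstar : star (k⁻¹ • casimirAvg x φ s) = k⁻¹ • casimirAvg x φ (star s) := by
      rw [star_smul, star_casimirAvg, star_trivial]
    refine glue_mem_unitary hZsa hZZ (coe_mem_unitary g) (hcom g z) ?_ ?_ ?_ ?_
    · rw [hstar, hSmul _ _ hsr' hs, hs1, hφz]
    · rw [hstar, hSmul _ _ hsr hs', hs2, hφz]
    · rw [hφz, hSmul _ _ hpp hs, hsl]
    · rw [hφz, hSmul _ _ hsr (by rw [hpp, hpp]), hsr]
  have hΘc : ∀ s, (1 - φ z) * (g : B) + k⁻¹ • casimirAvg x φ s ∈ commutant φ := fun s =>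
    mem_commutant_iff.2 fun a => (((Commute.one_right _).sub_right
      ((hzc a).map φ)).mul_right (hcom g a)).add_right ((hx.commute_avg φ a s).smul_right _)
  let Θ : S → unitary (commutant φ) := fun s =>
    ⟨⟨_, hΘc s⟩, mk_mem_unitary_commutant (hΘu s s.2) (hΘc s)⟩
  have hΘ : Continuous Θ := by
    refine Continuous.subtype_mk (Continuous.subtype_mk ?_ _) _
    exact continuous_const.add
      (((continuous_casimirAvg φ).comp continuous_subtype_val).const_smul _)
  have _ : PreconnectedSpace S := isPreconnected_iff_preconnectedSpace.1 hS.isPreconnected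
  have hrange : ∀ u : unitary (commutant φ), (1 - φ z) * (g : B) = (1 - φ z) * (u : B) →
      u ∈ Set.range Θ := by
    intro u hgu
    obtain ⟨hu1, hu2⟩ := Unitary.mem_iff.1 (coe_mem_unitary u)
    have hue := (hcom u e).eq
    have hmem : (u : B) * φ e ∈ S := by
      refine ⟨?_, ?_, ?_⟩
      · rw [← mul_assoc, hue, mul_assoc, mul_assoc, hpp, hpp]
      · rw [star_mul, hpsa, mul_assoc, ← mul_assoc (star _), hu1, one_mul, hpp]
      · rw [star_mul, hpsa, mul_assoc, ← mul_assoc (φ e), hpp, ← mul_assoc, ← hue, mul_assoc, hu2,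
          mul_one]
    refine ⟨⟨_, hmem⟩, Subtype.ext (Subtype.ext ?_)⟩
    change (1 - φ z) * (g : B) + k⁻¹ • casimirAvg x φ ((u : B) * φ e) = u
    rw [hgu, casimirAvg_mul_left φ (hcom u), ← mul_smul_comm, ← hφz, sub_mul, one_mul,
      (hcom u z).eq, sub_add_cancel]
  exact (isPreconnected_range hΘ).subset_connectedComponent (hrange g rfl) (hrange h hgh)

lemma ConnectedUnder.add {φ : F →⋆ₐ[ℂ] B} {q z : F} (hq : ConnectedUnder φ q)
    (hz : ConnectedUnder φ z) (hzsa : IsSelfAdjoint z) (hzz : z * z = z) (hzc : ∀ a, Commute a z)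
    (hqz : q * z = 0) : ConnectedUnder φ (q + z) := by
  intro g h hgh
  have hcom : ∀ u : unitary (commutant φ), ∀ a, Commute (φ a) (u : B) := fun u =>
    mem_commutant_iff.1 (u : commutant φ).2
  have hZZ : φ z * φ z = φ z := by rw [← map_mul, hzz]
  have hZsa : IsSelfAdjoint (φ z) := hzsa.map φ
  have hQZ : φ q * φ z = 0 := by rw [← map_mul, hqz, map_zero]
  obtain ⟨hh1, hh2⟩ := Unitary.mem_iff.1 (coe_mem_unitary h)
  have hhz := (hcom h z).eq
  have hmu : (1 - φ z) * (g : B) + φ z * (h : B) ∈ unitary B := by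
    refine glue_mem_unitary hZsa hZZ (coe_mem_unitary g) (hcom g z) ?_ ?_ ?_ ?_
    · rw [hhz, star_mul, hZsa.star_eq, mul_assoc, ← mul_assoc (star _), hh1, one_mul, hZZ]
    · rw [star_mul, hZsa.star_eq, mul_assoc, ← mul_assoc (h : B), hh2, one_mul, hZZ]
    · rw [← mul_assoc, hZZ]
    · rw [mul_assoc, ← hhz, ← mul_assoc, hZZ]
  have hmc : (1 - φ z) * (g : B) + φ z * (h : B) ∈ commutant φ :=
    mem_commutant_iff.2 fun a => (((Commute.one_right _).sub_right
      ((hzc a).map φ)).mul_right (hcom g a)).add_right (((hzc a).map φ).mul_right (hcom h a))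
  let m : unitary (commutant φ) := ⟨⟨_, hmc⟩, mk_mem_unitary_commutant hmu hmc⟩
  have hgm : m ∈ connectedComponent g := by
    refine hz g m ?_
    change _ = (1 - φ z) * ((1 - φ z) * (g : B) + φ z * (h : B))
    have hqq : (1 - φ z) * (1 - φ z) = 1 - φ z := by simp [mul_sub, sub_mul, hZZ]
    have hqz : (1 - φ z) * φ z = 0 := by rw [sub_mul, one_mul, hZZ, sub_self]
    rw [mul_add, ← mul_assoc, ← mul_assoc, hqq, hqz, zero_mul, add_zero]
  have hmh : h ∈ connectedComponent m := by
    refine hq m h ?_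
    change (1 - φ q) * ((1 - φ z) * (g : B) + φ z * (h : B)) = _
    rw [map_add] at hgh
    calc (1 - φ q) * ((1 - φ z) * (g : B) + φ z * (h : B))
        = (1 - (φ q + φ z)) * (g : B) + φ z * h + φ q * φ z * (g - h) := by noncomm_ring
      _ = (1 - φ q) * h := by rw [hgh, hQZ]; noncomm_ring
  rwa [connectedComponent_eq hgm]

/-- Property HUC passes to commutants of finite-dimensional algebras: their unitary groups are
connected. -/
lemma preconnectedSpace_unitary_commutant [FiniteDimensional ℂ F] (hB : PropHUCAlg B)
    (φ : F →⋆ₐ[ℂ] B) : PreconnectedSpace (unitary (commutant φ)) := by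
  obtain ⟨n, x, hx, -, hspan⟩ := exists_casimir F
  let Q : Set F := {q | IsSelfAdjoint q ∧ q * q = q ∧ (∀ a, Commute a q) ∧ ConnectedUnder φ q}
  have h0 : (0 : F) ∈ Q := by
    refine ⟨IsSelfAdjoint.zero F, mul_zero 0, fun a => Commute.zero_right a, fun g h hgh => ?_⟩
    have : g = h := Subtype.ext (Subtype.ext (by simpa using hgh))
    exact this ▸ mem_connectedComponent
  obtain ⟨q, ⟨hqsa, hqq, hqc, hq⟩, hmax⟩ := (InvImage.wf
    (fun q : F => LinearMap.range (LinearMap.mulLeft ℂ q))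
    (wellFounded_gt (α := Submodule ℂ F))).has_min Q ⟨0, h0⟩
  have hq1 : q = 1 := by
    by_contra hne
    obtain ⟨e, he, hre⟩ := exists_isMinimalProjection (r := 1 - q)
      ((IsSelfAdjoint.one F).sub hqsa) (by simp [mul_sub, sub_mul, hqq])
      (sub_ne_zero.2 (Ne.symm hne))
    obtain ⟨z, hzsa, hzz, hzc, hz0, hrz, hz⟩ := exists_central_support hx hspan hB φ he
    have hqz : q * z = 0 := by
      have := hrz (1 - q) (fun a => (Commute.one_right a).sub_right (hqc a)) hre
      simpa [sub_mul] using this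
    have hzq : z * q = 0 := by rw [← (hzc q).eq, hqz]
    refine hmax (q + z) ⟨hqsa.add hzsa, by simp [mul_add, add_mul, hqq, hzz, hqz, hzq],
      fun a => (hqc a).add_right (hzc a), hq.add hz hzsa hzz hzc hqz⟩ ?_
    refine lt_of_le_of_ne ?_ fun heq => hz0 ?_
    · rintro _ ⟨y, rfl⟩
      exact ⟨q * y, by simp [← mul_assoc, add_mul, hqq, hzq]⟩
    · obtain ⟨y, hy⟩ : z ∈ LinearMap.range (LinearMap.mulLeft ℂ q) := by
        rw [show LinearMap.range (LinearMap.mulLeft ℂ q) = _ from heq]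
        exact ⟨z, by simp [add_mul, hqz, hzz]⟩
      rw [LinearMap.mulLeft_apply] at hy
      rw [← hqz, ← hy, ← mul_assoc, hqq]
  refine preconnectedSpace_iff_connectedComponent.2 fun g => Set.eq_univ_of_forall fun h => ?_
  exact hq g h (by simp [hq1])

/-- A unitary commuting with the range of `φ` is joined to `1` through such unitaries. -/
lemma exists_path_commutant [FiniteDimensional ℂ F] (hB : PropHUCAlg B) (φ : F →⋆ₐ[ℂ] B) {c : B}
    (hc : c ∈ unitary B) (hcomm : ∀ a, Commute (φ a) c) :
    ∃ γ : ℝ → B, Continuous γ ∧ (∀ t, γ t ∈ unitary B) ∧ (∀ t a, Commute (φ a) (γ t)) ∧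
      (∀ t ≤ 0, γ t = 1) ∧ ∀ t, 1 ≤ t → γ t = c := by
  have _ := preconnectedSpace_unitary_commutant hB φ
  have _ : ConnectedSpace (unitary (commutant φ)) := { toNonempty := ⟨1⟩ }
  have _ : PathConnectedSpace (unitary (commutant φ)) :=
    pathConnectedSpace_iff_connectedSpace.2 inferInstance
  let p : Path (1 : unitary (commutant φ)) ⟨_, mk_mem_unitary_commutant hc
    (mem_commutant_iff.2 hcomm)⟩ := PathConnectedSpace.somePath _ _
  refine ⟨fun t => (p.extend t : B), ?_, fun t => coe_mem_unitary _,
    fun t => mem_commutant_iff.1 (p.extend t : commutant φ).2, fun t ht => ?_, fun t ht => ?_⟩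
  · exact continuous_subtype_val.comp (continuous_subtype_val.comp p.continuous_extend)
  · simp [p.extend_of_le_zero ht]
  · simp [p.extend_of_one_le ht]

end Commutant

section UnitaryOrbit

variable {A B : Type*} [CStarAlgebra A] [CStarAlgebra B]

/-- The conjugate of a unital *-homomorphism by a unitary. -/
def StarAlgHom.unitaryConj (π : A →⋆ₐ[ℂ] B) {u : B} (hu : u ∈ unitary B) : A →⋆ₐ[ℂ] B where
  toFun a := star u * π a * u
  map_one' := by simp [(Unitary.mem_iff.1 hu).1]
  map_mul' a b := by
    calc star u * π (a * b) * u = star u * π a * 1 * π b * u := by simp [mul_assoc]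
      _ = star u * π a * u * (star u * π b * u) := by
        rw [← (Unitary.mem_iff.1 hu).2]; simp only [mul_assoc]
  map_zero' := by simp
  map_add' a b := by simp [mul_add, add_mul]
  commutes' r := by
    rw [AlgHomClass.commutes, ← Algebra.commutes r (star u), mul_assoc,
      (Unitary.mem_iff.1 hu).1, mul_one]
  map_star' a := by simp [map_star, mul_assoc]

lemma StarAlgHom.unitaryConj_apply (π : A →⋆ₐ[ℂ] B) {u : B} (hu : u ∈ unitary B) (a : A) :
    π.unitaryConj hu a = star u * π a * u := rfl

lemma isClosed_range_coe_starAlgHom :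
    IsClosed (Set.range (fun ψ : A →⋆ₐ[ℂ] B => (ψ : A → B))) := by
  have h : Set.range (fun ψ : A →⋆ₐ[ℂ] B => (ψ : A → B)) =
      {g | (∀ a b, g (a * b) = g a * g b) ∧ (∀ a b, g (a + b) = g a + g b) ∧
        (∀ r, g (algebraMap ℂ A r) = algebraMap ℂ B r) ∧ ∀ a, g (star a) = star (g a)} := by
    ext g
    constructor
    · rintro ⟨ψ, rfl⟩
      exact ⟨map_mul ψ, map_add ψ, AlgHomClass.commutes ψ, map_star ψ⟩
    · rintro ⟨hmul, hadd, halg, hstar⟩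
      exact ⟨{ toFun := g
               map_one' := by simpa using halg 1
               map_mul' := hmul
               map_zero' := by simpa using halg 0
               map_add' := hadd
               commutes' := halg
               map_star' := hstar }, rfl⟩
  rw [h]
  simp only [Set.ofPred_and, Set.ofPred_forall]
  refine IsClosed.inter ?_ (IsClosed.inter ?_ (IsClosed.inter ?_ ?_))
  · exact isClosed_iInter fun a => isClosed_iInter fun b => isClosed_eq (by fun_prop) (by fun_prop)
  · exact isClosed_iInter fun a => isClosed_iInter fun b => isClosed_eq (by fun_prop) (by fun_prop)
  · exact isClosed_iInter fun a => isClosed_eq (by fun_prop) (by fun_prop)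
  · exact isClosed_iInter fun a => isClosed_eq (by fun_prop) (by fun_prop)

lemma exists_starAlgHom_of_mem_closure {π : A →⋆ₐ[ℂ] B} {f : A → B}
    (hf : f ∈ closure (unitaryOrbit π)) : ∃ ψ : A →⋆ₐ[ℂ] B, (ψ : A → B) = f := by
  refine closure_minimal ?_ isClosed_range_coe_starAlgHom hf
  rintro _ ⟨u, hu, rfl⟩
  exact ⟨π.unitaryConj hu, rfl⟩

lemma StarSubalgebra.isClosed_of_finiteDimensional (S : StarSubalgebra ℂ A)
    [FiniteDimensional ℂ S] : IsClosed (S : Set A) :=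
  have : FiniteDimensional ℂ (Subalgebra.toSubmodule S.toSubalgebra) := ‹_›
  Submodule.closed_of_finiteDimensional (Subalgebra.toSubmodule S.toSubalgebra)

/-- On a finite-dimensional subalgebra, a limit of unitary conjugates is a unitary conjugate. -/
lemma exists_unitary_conj_eq_on (S : StarSubalgebra ℂ A) [FiniteDimensional ℂ S]
    {π ψ : A →⋆ₐ[ℂ] B} (hψ : (ψ : A → B) ∈ closure (unitaryOrbit π)) :
    ∃ u ∈ unitary B, ∀ a ∈ S, star u * π a * u = ψ a := by
  have _ := S.isClosed_of_finiteDimensional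
  obtain ⟨n, x, hx, hx1, -⟩ := exists_casimir S
  let Φ : (A → B) → B := fun g => ∑ i, g (x i) * ψ (star (x i : A))
  have hΦ : Continuous Φ := by fun_prop
  have hΦψ : Φ ψ = 1 := by
    have h := congrArg (fun y : S => ψ y) hx1
    simpa [Φ] using h
  have hopen : IsOpen {g | ‖Φ g - 1‖ < 1} := isOpen_lt (by fun_prop) continuous_const
  obtain ⟨_, hg, u, hu, rfl⟩ := mem_closure_iff.1 hψ _ hopen (by simp [hΦψ])
  obtain ⟨w, hw, hconj⟩ := hx.exists_unitary_conj ((π.unitaryConj hu).comp S.subtype)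
    (ψ.comp S.subtype) hg
  refine ⟨u * w, mul_mem hu hw, fun a ha => ?_⟩
  have h : star u * π a * u * w = w * ψ a := hconj ⟨a, ha⟩
  calc star (u * w) * π a * (u * w) = star w * (star u * π a * u * w) := by
        simp [mul_assoc]
    _ = ψ a := by rw [h, ← mul_assoc, (Unitary.mem_iff.1 hw).1, one_mul]

/-- Unitaries conjugating `π` to `ψ` on each member of an increasing sequence of subalgebras can be
chosen along a continuous ray. -/
lemma exists_ray (hB : PropHUCAlg B) {𝒜 : ℕ → StarSubalgebra ℂ A} (hmono : Monotone 𝒜)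
    (hfd : ∀ n, FiniteDimensional ℂ (𝒜 n)) {π ψ : A →⋆ₐ[ℂ] B} {u : ℕ → B}
    (hu : ∀ n, u n ∈ unitary B) (huψ : ∀ n, ∀ a ∈ 𝒜 n, star (u n) * π a * u n = ψ a) :
    ∃ Γ : ℝ → B, Continuous Γ ∧ (∀ t, Γ t ∈ unitary B) ∧
      ∀ (n : ℕ) (t : ℝ), n ≤ t → ∀ a ∈ 𝒜 n, star (Γ t) * π a * Γ t = ψ a := by
  have _ := fun n => (𝒜 n).isClosed_of_finiteDimensional
  have hcancel : ∀ n, ∀ a ∈ 𝒜 n, π a * u n = u n * ψ a := fun n a ha => by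
    rw [← huψ n a ha, ← mul_assoc, ← mul_assoc, (Unitary.mem_iff.1 (hu n)).2, one_mul]
  have hcancel' : ∀ n, ∀ a ∈ 𝒜 n, star (u n) * π a = ψ a * star (u n) := fun n a ha => by
    rw [← huψ n a ha, mul_assoc _ (u n), (Unitary.mem_iff.1 (hu n)).2, mul_one]
  have hcomm : ∀ n (a : 𝒜 n), Commute ((π.comp (𝒜 n).subtype) a) (u (n + 1) * star (u n)) := by
    intro n a
    have ha := a.2
    change π a * (u (n + 1) * star (u n)) = u (n + 1) * star (u n) * π a
    rw [← mul_assoc, hcancel (n + 1) a (hmono n.le_succ ha), mul_assoc, mul_assoc,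
      hcancel' n a ha]
  choose γ hγc hγu hγcomm hγ0 hγ1 using fun n => exists_path_commutant hB
    (π.comp (𝒜 n).subtype) (mul_mem (hu (n + 1)) (Unitary.star_mem (hu n))) (hcomm n)
  let P : ℕ → ℝ → B := fun n => Nat.rec (fun _ => u 0) (fun n p t => γ n (t - n) * p t) n
  have hPs : ∀ n t, P (n + 1) t = γ n (t - n) * P n t := fun _ _ => rfl
  have hPc : ∀ n, Continuous (P n) := by
    intro n
    induction n with
    | zero => exact continuous_const
    | succ n ih => exact ((hγc n).comp (by fun_prop)).mul ih
  have hPu : ∀ n t, P n t ∈ unitary B := by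
    intro n t
    induction n with
    | zero => exact hu 0
    | succ n ih => exact mul_mem (hγu n _) ih
  have hstab : ∀ (t : ℝ) (n m : ℕ), t ≤ n → n ≤ m → P m t = P n t := by
    intro t n m ht hnm
    induction m, hnm using Nat.le_induction with
    | base => rfl
    | succ m hnm ih =>
      have : (n : ℝ) ≤ m := by exact_mod_cast hnm
      rw [hPs, hγ0 m _ (by linarith), one_mul, ih]
  have hend : ∀ (n : ℕ) (t : ℝ), n ≤ t → P n t = u n := by
    intro n t ht
    induction n with
    | zero => rfl
    | succ n ih =>
      push_cast at ht
      rw [hPs, hγ1 n _ (by linarith), ih (by linarith), mul_assoc, (Unitary.mem_iff.1 (hu n)).1,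
        mul_one]
  have hfix : ∀ (n m : ℕ) (t : ℝ), n ≤ t → n ≤ m → ∀ a ∈ 𝒜 n,
      star (P m t) * π a * P m t = ψ a := by
    intro n m t ht hnm a ha
    induction m, hnm using Nat.le_induction with
    | base => rw [hend n t ht, huψ n a ha]
    | succ m hnm ih =>
      have hc : π a * γ m (t - m) = γ m (t - m) * π a :=
        (hγcomm m (t - m) ⟨a, hmono hnm ha⟩).eq
      rw [hPs, star_mul, ← ih]
      calc star (P m t) * star (γ m (t - m)) * π a * (γ m (t - m) * P m t)
          = star (P m t) * star (γ m (t - m)) * (π a * γ m (t - m)) * P m t := by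
            simp only [mul_assoc]
        _ = star (P m t) * (star (γ m (t - m)) * γ m (t - m)) * π a * P m t := by
            rw [hc]; simp only [mul_assoc]
        _ = _ := by rw [(Unitary.mem_iff.1 (hγu m _)).1, mul_one]
  have hΓ : ∀ (t : ℝ) (m : ℕ), t ≤ m → P ⌈t⌉₊ t = P m t := fun t m ht =>
    (hstab t _ m (Nat.le_ceil t) (Nat.ceil_le.2 ht)).symm
  refine ⟨fun t => P ⌈t⌉₊ t, continuous_iff_continuousAt.2 fun t₀ => ?_, fun t => hPu _ _,
    fun n t ht => hfix n _ t ht (by exact_mod_cast ht.trans (Nat.le_ceil t))⟩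
  obtain ⟨N, hN⟩ := exists_nat_gt t₀
  refine (hPc N).continuousAt.congr ?_
  filter_upwards [gt_mem_nhds hN] with t ht
  exact (hΓ t N ht.le).symm

lemma joinedIn_closure_unitaryOrbit (hB : PropHUCAlg B) (π : A →⋆ₐ[ℂ] B) {u : B}
    (hu : u ∈ unitary B) :
    JoinedIn (closure (unitaryOrbit π)) π (fun a => star u * π a * u) := by
  obtain ⟨γ, hγc, hγu, -, hγ0, hγ1⟩ := exists_path_commutant hB (StarAlgHom.ofId ℂ B) hu
    fun r => Algebra.commutes r u
  refine JoinedIn.ofLine (f := fun t a => star (γ t) * π a * γ t) ?_ ?_ ?_ ?_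
  · exact (continuous_pi fun a => by fun_prop).continuousOn
  · funext a
    simp [hγ0 0 le_rfl]
  · funext a
    simp [hγ1 1 le_rfl]
  · rintro _ ⟨t, -, rfl⟩
    exact subset_closure ⟨γ t, hγu t, rfl⟩

end UnitaryOrbit

theorem stmt10 (A : Type*) [CStarAlgebra A] [TopologicalSpace.SeparableSpace A]
    (𝒜 : ℕ → StarSubalgebra ℂ A) (hmono : Monotone 𝒜)
    (hfd : ∀ n, FiniteDimensional ℂ (𝒜 n))
    (hdense : closure (⋃ n, ((𝒜 n : Set A))) = Set.univ)
    (B : Type*) [CStarAlgebra B] (hB : PropHUCAlg B) (π : A →⋆ₐ[ℂ] B) :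
    IsPathConnected (closure (unitaryOrbit π)) := by
  refine ⟨π, subset_closure ⟨1, one_mem _, by simp⟩, fun {f} hf => ?_⟩
  obtain ⟨ψ, rfl⟩ := exists_starAlgHom_of_mem_closure hf
  choose u hu huψ using fun n => exists_unitary_conj_eq_on (𝒜 n) hf
  obtain ⟨Γ, hΓc, hΓu, hΓψ⟩ := exists_ray hB hmono hfd hu huψ
  refine (joinedIn_closure_unitaryOrbit hB π (hΓu 1)).trans (JoinedIn.symm ?_)
  let h : ℝ → A → B := fun s a => if s ≤ 0 then ψ a else star (Γ s⁻¹) * π a * Γ s⁻¹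
  refine JoinedIn.ofLine (f := h) ?_ (by funext a; simp [h]) (by funext a; simp [h]) ?_
  · refine continuousOn_pi.2 fun a s hs => ?_
    rcases hs.1.eq_or_lt with rfl | hs0
    · refine ContinuousAt.continuousWithinAt (Metric.continuousAt_iff.2 fun ε hε => ?_)
      obtain ⟨b, hb, hab⟩ := Metric.mem_closure_iff.1 (hdense ▸ Set.mem_univ a) (ε / 2) (by linarith)
      obtain ⟨n, hbn⟩ := Set.mem_iUnion.1 hb
      refine ⟨((n : ℝ) + 1)⁻¹, by positivity, fun {t} ht => ?_⟩
      have hψ0 : h 0 a = ψ a := by simp [h]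
      rw [hψ0]
      by_cases ht0 : t ≤ 0
      · simpa [h, ht0] using hε
      push Not at ht0
      have hnt : (n : ℝ) ≤ t⁻¹ := by
        rw [Real.dist_0_eq_abs, abs_of_pos ht0] at ht
        have := (lt_inv_comm₀ ht0 (by positivity)).1 ht
        linarith
      have hta : h t a = π.unitaryConj (hΓu t⁻¹) a := by
        simp [h, ht0.not_ge, StarAlgHom.unitaryConj_apply]
      have htb : π.unitaryConj (hΓu t⁻¹) b = ψ b := hΓψ n t⁻¹ hnt b hbn
      rw [dist_eq_norm] at hab ⊢
      calc ‖h t a - ψ a‖ = ‖π.unitaryConj (hΓu t⁻¹) (a - b) - ψ (a - b)‖ := by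
            rw [hta, map_sub, map_sub, htb]; congr 1; abel
        _ ≤ ‖a - b‖ + ‖a - b‖ := (norm_sub_le _ _).trans
            (add_le_add (NonUnitalStarAlgHom.norm_apply_le _ _)
              (NonUnitalStarAlgHom.norm_apply_le _ _))
        _ < ε := by linarith
    · refine ContinuousAt.continuousWithinAt ?_
      have hinv : ContinuousAt (fun t : ℝ => Γ t⁻¹) s :=
        hΓc.continuousAt.comp (continuousAt_inv₀ hs0.ne')
      refine ((hinv.star.mul (continuousAt_const (y := π a))).mul hinv).congr ?_
      filter_upwards [lt_mem_nhds hs0] with t ht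
      simp [h, ht.not_ge]
  · rintro _ ⟨t, -, rfl⟩
    by_cases ht : t ≤ 0
    · have : h t = ψ := by funext a; simp [h, ht]
      exact this ▸ hf
    · exact subset_closure ⟨Γ t⁻¹, hΓu _, by funext a; simp [h, ht]⟩
end
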